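/- There exist absolute constants C, c > 0 such that the following holds. Let p be a prime with p ≡ 3 (mod 4) and let E ⊆ F_p² with |E| ≤ c·p^{8/5}. Then T(E) ≤ C·( |E|²·log|E| + |Δ(E)|^{4/15}·|E|^{33/15} + |E|^{5/3}·|Δ(E)|^{4/15}·□(E)^{4/15} ). -/

import Mathlib

open Finset

namespace FpDist

/-- Points of `𝔽_p²`. -/
abbrev Pt (p : ℕ) := ZMod p × ZMod p

/-- The "distance" `‖x - y‖ = (x₁-y₁)² + (x₂-y₂)²` in `𝔽_p²`. -/
def dist2 {p : ℕ} (x y : Pt p) : ZMod p := (x.1 - y.1)^2 + (x.2 - y.2)^2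

/-- `‖x‖ = x₁² + x₂²`. -/
def norm2 {p : ℕ} (x : Pt p) : ZMod p := x.1^2 + x.2^2

/-- The distance set `Δ(E) = {‖x - y‖ : x, y ∈ E}`. -/
def distSet {p : ℕ} (E : Finset (Pt p)) : Finset (ZMod p) :=
  (E ×ˢ E).image fun q => dist2 q.1 q.2

/-- `(a, b, c)` is a corner if `(b - a) · (c - a) = 0`. -/
def IsCorner {p : ℕ} (a b c : Pt p) : Prop :=
  (b.1 - a.1) * (c.1 - a.1) + (b.2 - a.2) * (c.2 - a.2) = 0

/-- `(a, b, c, d)` forms a rectangle if `(a,b,d), (b,a,c), (c,b,d), (d,a,c)` are corners. -/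
def IsRectangle {p : ℕ} (a b c d : Pt p) : Prop :=
  IsCorner a b d ∧ IsCorner b a c ∧ IsCorner c b d ∧ IsCorner d a c

/-- `□(E)`: the number of non-degenerate rectangles `(a,b,c,d) ∈ E⁴`
(non-degenerate: not all four vertices lie on one line). -/
noncomputable def rectCount (p : ℕ) [Fact p.Prime] (E : Finset (Pt p)) : ℕ :=
  Set.ncard {q : Pt p × Pt p × Pt p × Pt p |
    q.1 ∈ E ∧ q.2.1 ∈ E ∧ q.2.2.1 ∈ E ∧ q.2.2.2 ∈ E ∧
    IsRectangle q.1 q.2.1 q.2.2.1 q.2.2.2 ∧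
    ¬ Collinear (ZMod p) ({q.1, q.2.1, q.2.2.1, q.2.2.2} : Set (Pt p))}

/-- `T(E)`: the number of isosceles triangles, i.e. triples `(a,b,c) ∈ E³`
with `‖a - c‖ = ‖b - c‖ ≠ 0`. -/
def triCount {p : ℕ} (E : Finset (Pt p)) : ℕ :=
  ((E ×ˢ E ×ˢ E).filter fun q =>
    dist2 q.1 q.2.2 = dist2 q.2.1 q.2.2 ∧ dist2 q.1 q.2.2 ≠ 0).card

section Elimination

open MvPolynomial

theorem exists_resultant_combination {B : Type*} [CommRing B] [IsDomain B]
    [UniqueFactorizationMonoid B] {G R : Polynomial B} (hG : Irreducible G)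
    (hd : G.natDegree ≠ 0) (hR : ¬ G ∣ R) :
    Polynomial.resultant G R ≠ 0 ∧
      ∃ p q, G * p + R * q = Polynomial.C (Polynomial.resultant G R) := by
  classical
  let _ : GCDMonoid B := UniqueFactorizationMonoid.toGCDMonoid B
  have hprim : G.IsPrimitive := hG.isPrimitive hd
  have hinj := IsFractionRing.injective B (FractionRing B)
  have hirr : Irreducible (G.map (algebraMap B (FractionRing B))) :=
    hprim.irreducible_iff_irreducible_map_fraction_map.1 hG
  have hnd : ¬ G.map (algebraMap B (FractionRing B)) ∣ R.map (algebraMap B (FractionRing B)) :=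
    fun h => hR (hprim.dvd_of_fraction_map_dvd_fraction_map h)
  have hcop := hirr.coprime_iff_not_dvd.2 hnd
  refine ⟨fun h0 => ?_, ?_⟩
  · have h1 : Polynomial.resultant (G.map (algebraMap B (FractionRing B)))
        (R.map (algebraMap B (FractionRing B))) = 0 := by
      rw [Polynomial.natDegree_map_eq_of_injective hinj,
        Polynomial.natDegree_map_eq_of_injective hinj, Polynomial.resultant_map_map, h0, map_zero]
    exact (Polynomial.resultant_eq_zero_iff.1 h1).2 hcop
  · obtain ⟨p, q, -, -, h⟩ := Polynomial.exists_mul_add_mul_eq_C_resultant G R le_rfl le_rfl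
      (Or.inl hd)
    exact ⟨p, q, h⟩

theorem degreeOf_resultant_le {K : Type*} [CommRing K] {k : ℕ} (j : Fin k) {m n a b : ℕ}
    (G R : Polynomial (MvPolynomial (Fin k) K)) (hG : ∀ i, degreeOf j (G.coeff i) ≤ a)
    (hR : ∀ i, degreeOf j (R.coeff i) ≤ b) :
    degreeOf j (Polynomial.resultant G R m n) ≤ m * b + n * a := by
  classical
  rw [Polynomial.resultant, Matrix.det_apply]
  refine (degreeOf_sum_le _ _ _).trans (Finset.sup_le fun σ _ => ?_)
  have h1 : degreeOf j (Equiv.Perm.sign σ • ∏ i, Polynomial.sylvester G R m n (σ i) i) ≤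
      degreeOf j (∏ i, Polynomial.sylvester G R m n (σ i) i) := by
    rcases Int.units_eq_one_or (Equiv.Perm.sign σ) with h | h <;> simp [h, degreeOf_neg]
  refine h1.trans ((degreeOf_prod_le _ _ _).trans ?_)
  rw [Fin.sum_univ_add]
  have hA : ∀ i : Fin m, degreeOf j (Polynomial.sylvester G R m n (σ (Fin.castAdd n i))
      (Fin.castAdd n i)) ≤ b := by
    intro i
    simp only [Polynomial.sylvester, Matrix.of_apply, Fin.addCases_left]
    split_ifs <;> simp [hR]
  have hB : ∀ i : Fin n, degreeOf j (Polynomial.sylvester G R m n (σ (Fin.natAdd m i))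
      (Fin.natAdd m i)) ≤ a := by
    intro i
    simp only [Polynomial.sylvester, Matrix.of_apply, Fin.addCases_right]
    split_ifs <;> simp [hG]
  have h2 := Finset.sum_le_sum fun i (_ : i ∈ (univ : Finset (Fin m))) => hA i
  have h3 := Finset.sum_le_sum fun i (_ : i ∈ (univ : Finset (Fin n))) => hB i
  simp only [sum_const, card_univ, Fintype.card_fin, smul_eq_mul] at h2 h3
  exact Nat.add_le_add h2 h3

variable {K : Type*} [Field K]

theorem finSuccEquiv_symm_C (ρ : MvPolynomial (Fin 2) K) :
    (finSuccEquiv K 2).symm (Polynomial.C ρ) = rename Fin.succ ρ := by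
  rw [AlgEquiv.symm_apply_eq]
  have hext : (Polynomial.CAlgHom : MvPolynomial (Fin 2) K →ₐ[K] _) =
      (finSuccEquiv K 2 : MvPolynomial (Fin 3) K →ₐ[K] _).comp (rename Fin.succ) :=
    algHom_ext fun i => by simp [finSuccEquiv_X_succ]
  exact DFunLike.congr_fun hext ρ

theorem exists_rename_of_degreeOf_eq_zero {g : MvPolynomial (Fin 3) K} (hd : degreeOf 0 g = 0) :
    ∃ r : MvPolynomial (Fin 2) K, rename Fin.succ r = g ∧ degreeOf 0 r ≤ degreeOf 1 g := by
  rw [← natDegree_finSuccEquiv] at hd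
  refine ⟨(finSuccEquiv K 2 g).coeff 0, ?_, degreeOf_coeff_finSuccEquiv g 0 0⟩
  rw [← finSuccEquiv_symm_C, ← Polynomial.eq_C_of_natDegree_eq_zero hd, AlgEquiv.symm_apply_apply]

theorem exists_elimination {g R : MvPolynomial (Fin 3) K} (hg : Irreducible g)
    (hR : ¬ g ∣ R) :
    ∃ r : MvPolynomial (Fin 2) K, r ≠ 0 ∧
      (∃ a b, rename Fin.succ r = a * g + b * R) ∧
      degreeOf 0 r ≤ degreeOf 0 g * degreeOf 1 R + max 1 (degreeOf 0 R) * degreeOf 1 g := by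
  set e := finSuccEquiv K 2 with he
  by_cases hd : degreeOf 0 g = 0
  · obtain ⟨r, hr, hrd⟩ := exists_rename_of_degreeOf_eq_zero hd
    refine ⟨r, fun h => hg.ne_zero ?_, ⟨1, 0, ?_⟩, hrd.trans ?_⟩
    · rw [← hr, h, map_zero]
    · rw [hr]; ring
    · refine (Nat.le_mul_of_pos_left _ ?_).trans (Nat.le_add_left _ _)
      positivity
  have hd' : (e g).natDegree ≠ 0 := by rwa [natDegree_finSuccEquiv]
  have hG : Irreducible (e g) := (MulEquiv.irreducible_iff e).2 hg
  have hR' : ¬ e g ∣ e R := fun h => hR ((map_dvd_iff e).1 h)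
  obtain ⟨h0, p, q, h⟩ := exists_resultant_combination hG hd' hR'
  have hres : degreeOf 0 (Polynomial.resultant (e g) (e R)) ≤
      degreeOf 0 g * degreeOf 1 R + degreeOf 0 R * degreeOf 1 g := by
    rw [← natDegree_finSuccEquiv g, ← natDegree_finSuccEquiv R]
    exact degreeOf_resultant_le 0 _ _ (fun i => degreeOf_coeff_finSuccEquiv g 0 i)
      (fun i => degreeOf_coeff_finSuccEquiv R 0 i)
  refine ⟨_, h0, ⟨e.symm p, e.symm q, ?_⟩, hres.trans ?_⟩
  · rw [← finSuccEquiv_symm_C, ← he, ← h]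
    simp [mul_comm]
  · gcongr
    exact le_max_right _ _

end Elimination

section RuledSurface

open MvPolynomial

variable {K : Type*} [Field K]

theorem natDegree_aeval_le {σ S : Type*} [Fintype σ] [CommRing S] [Algebra K S]
    (f : σ → Polynomial S) (w : σ → ℕ) (hf : ∀ i, (f i).natDegree ≤ w i)
    (q : MvPolynomial σ K) :
    (aeval f q).natDegree ≤ ∑ i, degreeOf i q * w i := by
  classical
  rw [aeval_def, eval₂_eq']
  refine Polynomial.natDegree_sum_le_of_forall_le _ _ fun m hm => ?_
  refine Polynomial.natDegree_mul_le.trans ?_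
  rw [Polynomial.algebraMap_apply, Polynomial.natDegree_C, zero_add]
  refine (Polynomial.natDegree_prod_le _ _).trans (Finset.sum_le_sum fun i _ => ?_)
  refine Polynomial.natDegree_pow_le.trans (Nat.mul_le_mul ?_ (hf i))
  exact degreeOf_le_iff.1 le_rfl m hm

/-- The `t`-`v` part of the second fundamental form of `g` along its tangent direction. -/
noncomputable def flecnode (g : MvPolynomial (Fin 3) K) : MvPolynomial (Fin 3) K :=
  pderiv 0 (pderiv 0 g) * pderiv 2 g ^ 2 - 2 * pderiv 0 (pderiv 2 g) * pderiv 0 g * pderiv 2 g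
    + pderiv 2 (pderiv 2 g) * pderiv 0 g ^ 2

/-- Derivative along the tangent field `g_v ∂_t - g_t ∂_v`. -/
noncomputable def tangentDer (g : MvPolynomial (Fin 3) K) :
    Derivation K (MvPolynomial (Fin 3) K) (MvPolynomial (Fin 3) K) :=
  pderiv 2 g • pderiv 0 - pderiv 0 g • pderiv 2

theorem tangentDer_apply (g q : MvPolynomial (Fin 3) K) :
    tangentDer g q = pderiv 2 g * pderiv 0 q - pderiv 0 g * pderiv 2 q := by
  simp [tangentDer]

/-- The tangent derivation extended coefficientwise. -/
noncomputable def tangentDerCoeff (g : MvPolynomial (Fin 3) K) :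
    Derivation K (Polynomial (MvPolynomial (Fin 3) K)) (Polynomial (MvPolynomial (Fin 3) K)) :=
  (PolynomialModule.equivPolynomialSelf (R := MvPolynomial (Fin 3) K)).toLinearMap.compDer
    (tangentDer g).mapCoeffs

theorem coeff_tangentDerCoeff (g : MvPolynomial (Fin 3) K)
    (P : Polynomial (MvPolynomial (Fin 3) K)) (k : ℕ) :
    (tangentDerCoeff g P).coeff k = tangentDer g (P.coeff k) := rfl

/-- The substitution flowing a point along its tangent direction. -/
noncomputable def tangentShift (g : MvPolynomial (Fin 3) K) :
    MvPolynomial (Fin 3) K →ₐ[K] Polynomial (MvPolynomial (Fin 3) K) :=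
  aeval ![Polynomial.C (X 0) + Polynomial.X * Polynomial.C (pderiv 2 g), Polynomial.C (X 1),
    Polynomial.C (X 2) - Polynomial.X * Polynomial.C (pderiv 0 g)]

theorem tangentDerCoeff_C (g r : MvPolynomial (Fin 3) K) :
    tangentDerCoeff g (Polynomial.C r) = Polynomial.C (tangentDer g r) := by
  ext k
  rw [coeff_tangentDerCoeff, Polynomial.coeff_C, Polynomial.coeff_C]
  split_ifs <;> simp

theorem tangentDerCoeff_X (g : MvPolynomial (Fin 3) K) :
    tangentDerCoeff g Polynomial.X = 0 := by
  refine Polynomial.ext fun k => ?_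
  rw [coeff_tangentDerCoeff, Polynomial.coeff_X]
  split_ifs <;> simp

theorem pderiv_comm_apply {σ : Type*} (i j : σ) (q : MvPolynomial σ K) :
    pderiv i (pderiv j q) = pderiv j (pderiv i q) := by
  classical
  have h : ⁅(pderiv i : Derivation K (MvPolynomial σ K) (MvPolynomial σ K)),
      (pderiv j : Derivation K (MvPolynomial σ K) (MvPolynomial σ K))⁆ = 0 :=
    derivation_ext fun k => by
      rw [Derivation.commutator_apply]
      simp [pderiv_X, Pi.single_apply, apply_ite]
  have h2 := DFunLike.congr_fun h q
  rwa [Derivation.commutator_apply, Derivation.zero_apply, sub_eq_zero] at h2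

theorem tangentShift_identity (g q : MvPolynomial (Fin 3) K) :
    Polynomial.C (pderiv 0 g) * tangentDerCoeff g (tangentShift g q) =
      (Polynomial.C (pderiv 0 g) + Polynomial.X * Polynomial.C (tangentDer g (pderiv 0 g))) *
        Polynomial.derivative (tangentShift g q)
      - Polynomial.X * Polynomial.C (flecnode g) * tangentShift g (pderiv 0 q) := by
  induction q using MvPolynomial.induction_on with
  | C a =>
    have : tangentShift g (C a) = Polynomial.C (C a) := by
      simp [tangentShift]
    rw [this, tangentDerCoeff_C]
    have h2 : tangentDer g (C a) = 0 := (tangentDer g).map_algebraMap a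
    simp [h2]
  | add p q hp hq =>
    simp only [map_add, mul_add, hp, hq]
    ring
  | mul_X p i hp =>
    have key : Polynomial.C (pderiv 0 g) * tangentDerCoeff g (tangentShift g (X i)) =
      (Polynomial.C (pderiv 0 g) + Polynomial.X * Polynomial.C (tangentDer g (pderiv 0 g))) *
        Polynomial.derivative (tangentShift g (X i))
      - Polynomial.X * Polynomial.C (flecnode g) * tangentShift g (pderiv 0 (X i)) := by
      have comm : pderiv 2 (pderiv 0 g) = pderiv 0 (pderiv 2 g) := pderiv_comm_apply 2 0 g
      have two : (Polynomial.C 2 : Polynomial (MvPolynomial (Fin 3) K)) = 2 := rfl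
      fin_cases i
      · simp [tangentShift, tangentDerCoeff_C, tangentDerCoeff_X, flecnode,
          tangentDer_apply, comm, pderiv_X, two]
        ring
      · simp [tangentShift, tangentDerCoeff_C, tangentDer_apply, pderiv_X]
      · simp [tangentShift, tangentDerCoeff_C, tangentDerCoeff_X, flecnode,
          tangentDer_apply, comm, pderiv_X, two]
        ring
    simp only [map_mul, Derivation.leibniz, smul_eq_mul, Polynomial.derivative_mul, map_add]
    linear_combination (tangentShift g p) * key + (tangentShift g (X i)) * hp

theorem dvd_coeff_tangentShift {g : MvPolynomial (Fin 3) K} (hg : Prime g)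
    (ht : ¬ g ∣ pderiv 0 g) (hF : g ∣ flecnode g)
    (hchar : ∀ k : ℕ, 0 < k → k ≤ degreeOf 0 g + degreeOf 2 g → (k : K) ≠ 0) (k : ℕ) :
    g ∣ (tangentShift g g).coeff k := by
  have hdeg : (tangentShift g g).natDegree ≤ degreeOf 0 g + degreeOf 2 g := by
    refine (natDegree_aeval_le _ ![1, 0, 1] (fun i => ?_) g).trans ?_
    · fin_cases i
      · simp only [Fin.zero_eta, Matrix.cons_val_zero]
        compute_degree
      · simp
      · simp only [Fin.reduceFinMk, Matrix.cons_val]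
        compute_degree
    · simp [Fin.sum_univ_three]
  have hD : ∀ r, g ∣ r → g ∣ tangentDer g r := by
    rintro _ ⟨h, rfl⟩
    have h0 : tangentDer g g = 0 := by rw [tangentDer_apply]; ring
    rw [Derivation.leibniz, h0]
    simp
  induction k with
  | zero =>
    have : (tangentShift g g).coeff 0 = g := by
      rw [Polynomial.coeff_zero_eq_eval_zero]
      have hext : ((Polynomial.aeval (0 : MvPolynomial (Fin 3) K)).restrictScalars K).comp
          (tangentShift g) = AlgHom.id K _ := algHom_ext fun i => by
        fin_cases i <;> simp [tangentShift]
      simpa [Polynomial.aeval_def] using DFunLike.congr_fun hext g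
    rw [this]
  | succ k ih =>
    by_cases hk : k + 1 ≤ degreeOf 0 g + degreeOf 2 g
    · have h : Polynomial.C (pderiv 0 g) * tangentDerCoeff g (tangentShift g g) =
          Polynomial.C (pderiv 0 g) * Polynomial.derivative (tangentShift g g) +
            Polynomial.X * (Polynomial.C (tangentDer g (pderiv 0 g)) *
              Polynomial.derivative (tangentShift g g) -
            Polynomial.C (flecnode g) * tangentShift g (pderiv 0 g)) := by
        rw [tangentShift_identity]; ring
      replace h := congrArg (fun P => P.coeff k) h
      simp only [Polynomial.coeff_add, Polynomial.coeff_C_mul, coeff_tangentDerCoeff,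
        Polynomial.coeff_derivative] at h
      have h1 : g ∣ pderiv 0 g * ((tangentShift g g).coeff (k + 1) * (k + 1)) := by
        refine (dvd_add_left ?_).1 (h ▸ (hD _ ih).mul_left _)
        cases k with
        | zero => simp
        | succ k =>
          rw [Polynomial.coeff_X_mul, Polynomial.coeff_sub, Polynomial.coeff_C_mul,
            Polynomial.coeff_C_mul, Polynomial.coeff_derivative]
          exact dvd_sub ((Dvd.dvd.mul_right (by exact_mod_cast ih) _).mul_left _)
            (hF.mul_right _)
      have h2 : IsUnit ((k : MvPolynomial (Fin 3) K) + 1) := by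
        have h3 : IsUnit ((k + 1 : ℕ) : K) := (hchar (k + 1) (by omega) hk).isUnit
        have := h3.map (C : K →+* MvPolynomial (Fin 3) K)
        simpa using this
      exact (h2.dvd_mul_right).1 ((hg.dvd_or_dvd h1).resolve_left ht)
    · rw [Polynomial.coeff_eq_zero_of_natDegree_lt (by omega)]
      exact dvd_zero _

end RuledSurface

section LineRestriction

open MvPolynomial

variable {K : Type*} [Field K]

/-- Restriction to the line `t = M u + c`, `v = V`, parametrised by `u`. -/
noncomputable def restrictU (M c V : K) : MvPolynomial (Fin 3) K →ₐ[K] Polynomial K :=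
  aeval ![Polynomial.C M * Polynomial.X + Polynomial.C c, Polynomial.X, Polynomial.C V]

/-- Restriction to the line `t = M v + c`, `u = V`, parametrised by `v`. -/
noncomputable def restrictV (M c V : K) : MvPolynomial (Fin 3) K →ₐ[K] Polynomial K :=
  aeval ![Polynomial.C M * Polynomial.X + Polynomial.C c, Polynomial.C V, Polynomial.X]

theorem eval_restrictU (M c V x : K) (q : MvPolynomial (Fin 3) K) :
    (restrictU M c V q).eval x = aeval ![M * x + c, x, V] q := by
  have h : (Polynomial.aeval x).comp (restrictU M c V) = aeval ![M * x + c, x, V] :=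
    algHom_ext fun i => by fin_cases i <;> simp [restrictU]
  simpa [Polynomial.aeval_def] using DFunLike.congr_fun h q

theorem eval_restrictV (M c V x : K) (q : MvPolynomial (Fin 3) K) :
    (restrictV M c V q).eval x = aeval ![M * x + c, V, x] q := by
  have h : (Polynomial.aeval x).comp (restrictV M c V) = aeval ![M * x + c, V, x] :=
    algHom_ext fun i => by fin_cases i <;> simp [restrictV]
  simpa [Polynomial.aeval_def] using DFunLike.congr_fun h q

theorem natDegree_restrictU_le (M c V : K) (q : MvPolynomial (Fin 3) K) :
    (restrictU M c V q).natDegree ≤ degreeOf 0 q + degreeOf 1 q := by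
  refine (natDegree_aeval_le _ ![1, 1, 0] (fun i => ?_) q).trans (by simp [Fin.sum_univ_three])
  fin_cases i
  · simp only [Fin.zero_eta, Matrix.cons_val_zero]
    compute_degree
  · simp
  · simp

theorem natDegree_restrictV_le (M c V : K) (q : MvPolynomial (Fin 3) K) :
    (restrictV M c V q).natDegree ≤ degreeOf 0 q + degreeOf 2 q := by
  refine (natDegree_aeval_le _ ![1, 0, 1] (fun i => ?_) q).trans (by simp [Fin.sum_univ_three])
  fin_cases i
  · simp only [Fin.zero_eta, Matrix.cons_val_zero]
    compute_degree
  · simp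
  · simp

theorem aeval_X_CX_injective : Function.Injective
    (aeval ![Polynomial.X, Polynomial.C Polynomial.X] :
      MvPolynomial (Fin 2) K →ₐ[K] Polynomial (Polynomial K)) := by
  have h : ((Polynomial.eval₂AlgHom (Polynomial.aeval (X 1 : MvPolynomial (Fin 2) K)) (X 0)
      (fun _ => Commute.all _ _))).comp
      (aeval ![Polynomial.X, Polynomial.C Polynomial.X] :
      MvPolynomial (Fin 2) K →ₐ[K] Polynomial (Polynomial K)) = AlgHom.id K _ :=
    algHom_ext fun i => by fin_cases i <;> simp
  exact Function.LeftInverse.injective (DFunLike.congr_fun h)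

theorem aeval_CX_X_injective : Function.Injective
    (aeval ![Polynomial.C Polynomial.X, Polynomial.X] :
      MvPolynomial (Fin 2) K →ₐ[K] Polynomial (Polynomial K)) := by
  have h : ((Polynomial.eval₂AlgHom (Polynomial.aeval (X 0 : MvPolynomial (Fin 2) K)) (X 1)
      (fun _ => Commute.all _ _))).comp
      (aeval ![Polynomial.C Polynomial.X, Polynomial.X] :
      MvPolynomial (Fin 2) K →ₐ[K] Polynomial (Polynomial K)) = AlgHom.id K _ :=
    algHom_ext fun i => by fin_cases i <;> simp
  exact Function.LeftInverse.injective (DFunLike.congr_fun h)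

theorem card_restrictV_rename_eq_zero_le {ι : Type*} (M c V : ι → K) (J : Finset ι)
    (hV : Set.InjOn V J) {r : MvPolynomial (Fin 2) K} (hr : r ≠ 0)
    (hJ : ∀ j ∈ J, restrictV (M j) (c j) (V j) (rename Fin.succ r) = 0) :
    J.card ≤ degreeOf 0 r := by
  classical
  set P := aeval (R := K) ![Polynomial.X, Polynomial.C (Polynomial.X : Polynomial K)] r
  have hP : P ≠ 0 := by
    rwa [Ne, map_eq_zero_iff _ aeval_X_CX_injective]
  have hdeg : P.natDegree ≤ degreeOf 0 r := by
    refine (natDegree_aeval_le _ ![1, 0] (fun i => ?_) r).trans (by simp [Fin.sum_univ_two])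
    fin_cases i <;> simp
  refine le_trans ?_ hdeg
  have hinj : Set.InjOn (fun j => Polynomial.C (V j)) J := fun a ha b hb h =>
    hV ha hb (Polynomial.C_injective h)
  rw [← card_image_of_injOn hinj]
  refine (card_le_card ?_).trans (P.roots.toFinset_card_le.trans (Polynomial.card_roots' P))
  intro x hx
  obtain ⟨j, hj, rfl⟩ := mem_image.1 hx
  rw [Multiset.mem_toFinset, Polynomial.mem_roots hP, Polynomial.IsRoot.def]
  rw [← hJ j hj]
  have h : ((Polynomial.aeval (Polynomial.C (V j))).restrictScalars K).comp
      (aeval (R := K) ![Polynomial.X, Polynomial.C (Polynomial.X : Polynomial K)]) =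
      (restrictV (M j) (c j) (V j)).comp (rename Fin.succ) :=
    algHom_ext fun i => by fin_cases i <;> simp [restrictV]
  simpa [Polynomial.aeval_def] using DFunLike.congr_fun h r

theorem card_restrictV_common_zero_le {ι : Type*} (M c V : ι → K) (J : Finset ι)
    (hV : Set.InjOn V J) {g R : MvPolynomial (Fin 3) K} (hg : Irreducible g) (hR : ¬ g ∣ R)
    (hJg : ∀ j ∈ J, restrictV (M j) (c j) (V j) g = 0)
    (hJR : ∀ j ∈ J, restrictV (M j) (c j) (V j) R = 0) :
    J.card ≤ degreeOf 0 g * degreeOf 1 R + max 1 (degreeOf 0 R) * degreeOf 1 g := by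
  obtain ⟨r, hr, ⟨a, b, hab⟩, hd⟩ := exists_elimination hg hR
  refine (card_restrictV_rename_eq_zero_le M c V J hV hr fun j hj => ?_).trans hd
  rw [hab, map_add, map_mul, map_mul, hJg j hj, hJR j hj]
  simp

theorem degreeOf_pderiv_le (i j : Fin 3) (q : MvPolynomial (Fin 3) K) :
    degreeOf j (pderiv i q) ≤ degreeOf j q := by
  rw [degreeOf_le_iff]
  intro m hm
  rw [mem_support_iff, coeff_pderiv] at hm
  have := degreeOf_le_iff.1 (le_refl (degreeOf j q)) _ (mem_support_iff.2 (left_ne_zero_of_mul hm))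
  exact le_trans (by simp) this

theorem degreeOf_pderiv_self_lt (i : Fin 3) (q : MvPolynomial (Fin 3) K) (h : degreeOf i q ≠ 0) :
    degreeOf i (pderiv i q) < degreeOf i q := by
  rw [degreeOf_lt_iff (Nat.pos_of_ne_zero h)]
  intro m hm
  rw [mem_support_iff, coeff_pderiv] at hm
  have := degreeOf_le_iff.1 (le_refl (degreeOf i q)) _ (mem_support_iff.2 (left_ne_zero_of_mul hm))
  simp at this
  omega

theorem pderiv_eq_zero_of_degreeOf_eq_zero {i : Fin 3} {q : MvPolynomial (Fin 3) K}
    (h : degreeOf i q = 0) : pderiv i q = 0 := by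
  ext m
  rw [coeff_pderiv, coeff_zero]
  by_contra hm
  have := degreeOf_le_iff.1 h.le _ (mem_support_iff.2 (left_ne_zero_of_mul hm))
  simp at this

theorem pderiv_ne_zero_of_degreeOf_ne_zero {i : Fin 3} {q : MvPolynomial (Fin 3) K}
    (h : degreeOf i q ≠ 0) (hchar : (degreeOf i q : K) ≠ 0) : pderiv i q ≠ 0 := by
  obtain ⟨m, hm, hmi⟩ : ∃ m ∈ q.support, m i = degreeOf i q := by
    by_contra! hcon
    refine lt_irrefl (degreeOf i q) ((degreeOf_lt_iff (Nat.pos_of_ne_zero h)).2 fun m hm => ?_)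
    exact lt_of_le_of_ne (degreeOf_le_iff.1 le_rfl m hm) (hcon m hm)
  intro h0
  have h1 := congrArg (coeff (m - Finsupp.single i 1)) h0
  have hle : Finsupp.single i 1 ≤ m := by
    rw [Finsupp.single_le_iff]; omega
  rw [coeff_pderiv, tsub_add_cancel_of_le hle, coeff_zero] at h1
  refine mul_ne_zero (mem_support_iff.1 hm) ?_ h1
  have : (m - Finsupp.single i 1 : Fin 3 →₀ ℕ) i + 1 = degreeOf i q := by
    simp; omega
  rw [← this] at hchar
  exact_mod_cast hchar

theorem degreeOf_aeval_X_of_ne {i j : Fin 3} (h : i ≠ j) (P : Polynomial K) :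
    degreeOf i (Polynomial.aeval (X j : MvPolynomial (Fin 3) K) P) = 0 := by
  rw [← Nat.le_zero, Polynomial.aeval_eq_sum_range]
  refine (degreeOf_sum_le _ _ _).trans (Finset.sup_le fun k _ => ?_)
  rw [MvPolynomial.smul_eq_C_mul]
  refine (degreeOf_C_mul_le _ _ _).trans ?_
  rw [degreeOf_X_pow_of_ne k h]

end LineRestriction

section RuledPair

open MvPolynomial

variable {K : Type*} [Field K]

theorem degreeOf_of_tangent_line {g : MvPolynomial (Fin 3) K} (hg : Irreducible g)
    (ht : ¬ g ∣ pderiv 0 g) (hF : g ∣ flecnode g)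
    (hchar : ∀ k : ℕ, 0 < k → k ≤ degreeOf 0 g + degreeOf 2 g → (k : K) ≠ 0)
    {M c V : K} (h0 : restrictU M c V g = 0) (h1 : restrictU M c V (pderiv 0 g) ≠ 0) :
    degreeOf 0 g ≤ 1 ∧ degreeOf 2 (pderiv 0 g) = 0 := by
  set τ : Polynomial K := Polynomial.C M * Polynomial.X + Polynomial.C c
  set α := restrictU M c V (pderiv 0 g) with hα
  set β := restrictU M c V (pderiv 2 g) with hβ
  let ι : Polynomial K →ₐ[K] MvPolynomial (Fin 3) K := Polynomial.aeval (X 1)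
  have hι : ∀ P, restrictU M c V (ι P) = P := by
    intro P
    have : (restrictU M c V).comp ι = AlgHom.id K _ :=
      Polynomial.algHom_ext (by simp [ι, restrictU])
    exact DFunLike.congr_fun this P
  let Ψ : MvPolynomial (Fin 3) K →ₐ[K] Polynomial (Polynomial K) :=
    (Polynomial.mapAlgHom (restrictU M c V)).comp (tangentShift g)
  have hΨg : Ψ g = 0 := by
    ext k : 1
    obtain ⟨w, hw⟩ := dvd_coeff_tangentShift hg.prime ht hF hchar k
    have : (Ψ g).coeff k = restrictU M c V ((tangentShift g g).coeff k) := by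
      simp [Ψ]
    rw [this, hw, map_mul, h0, zero_mul, Polynomial.coeff_zero]
  have hΨι : ∀ P, Ψ (ι P) = Polynomial.C P := by
    intro P
    have : Ψ.comp ι = Polynomial.CAlgHom :=
      Polynomial.algHom_ext (by simp [Ψ, ι, tangentShift, restrictU])
    exact DFunLike.congr_fun this P
  have hΨ0 : Ψ (X 0) = Polynomial.C τ + Polynomial.X * Polynomial.C β := by
    simp [Ψ, tangentShift, restrictU, τ, hβ, -Polynomial.X_mul_C]
  have hΨ2 : Ψ (X 2) = Polynomial.C (Polynomial.C V) - Polynomial.X * Polynomial.C α := by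
    simp [Ψ, tangentShift, restrictU, hα, -Polynomial.X_mul_C]
  set ℓ : MvPolynomial (Fin 3) K := ι α * (X 0 - ι τ) + ι β * (X 2 - C V) with hℓ
  have hΨℓ : Ψ ℓ = 0 := by
    have hCV : Ψ (C V) = Polynomial.C (Polynomial.C V) := Ψ.commutes V
    simp only [hℓ, map_add, map_mul, map_sub, hΨι, hΨ0, hΨ2, hCV]
    ring
  have hdvd : g ∣ ℓ := by
    by_contra hn
    obtain ⟨r, hr, ⟨a, b, hab⟩, -⟩ := exists_elimination hg hn
    have h2 : Ψ (rename Fin.succ r) = 0 := by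
      rw [hab, map_add, map_mul, map_mul, hΨg, hΨℓ]; simp
    have h3 : Ψ (rename Fin.succ r) =
        (aeval (R := K) ![Polynomial.C (Polynomial.X : Polynomial K), Polynomial.X] r).comp
          (Polynomial.C (Polynomial.C V) - Polynomial.X * Polynomial.C α) := by
      have hext : Ψ.comp (rename Fin.succ) = ((Polynomial.aeval
          (Polynomial.C (Polynomial.C V) - Polynomial.X * Polynomial.C α)).restrictScalars K).comp
          (aeval (R := K) ![Polynomial.C (Polynomial.X : Polynomial K), Polynomial.X]) := by
        refine algHom_ext fun i => ?_
        fin_cases i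
        · have := hΨι Polynomial.X
          simpa [ι] using this
        · simpa using hΨ2
      exact DFunLike.congr_fun hext r
    rw [h3, Polynomial.comp_eq_zero_iff] at h2
    rcases h2 with h2 | ⟨-, h2⟩
    · exact hr ((map_eq_zero_iff _ aeval_CX_X_injective).1 h2)
    · have h4 := congrArg (fun P => P.coeff 1) h2
      simp at h4
      exact h1 h4
  obtain ⟨h, hh⟩ := hdvd
  have hdι : ∀ P, pderiv 0 (ι P) = 0 := fun P =>
    pderiv_eq_zero_of_degreeOf_eq_zero (degreeOf_aeval_X_of_ne (by decide) P)
  have hdℓ : pderiv 0 ℓ = ι α := by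
    simp [hℓ, Derivation.leibniz, hdι, pderiv_X]
  have hια : ι α ≠ 0 := fun h => h1 (by rw [← hι α, h, map_zero])
  have hℓ0 : ℓ ≠ 0 := fun h => hια (by rw [← hdℓ, h, map_zero])
  have hh0 : h ≠ 0 := fun h' => hℓ0 (by rw [hh, h', mul_zero])
  have hg0 : degreeOf 0 g ≠ 0 := fun h' => ht (by
    rw [pderiv_eq_zero_of_degreeOf_eq_zero h']; exact dvd_zero _)
  have hdeg : degreeOf 0 ℓ ≤ 1 := by
    have e1 : ∀ P, degreeOf 0 (ι P) = 0 := fun P => degreeOf_aeval_X_of_ne (by decide) P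
    have e2 : degreeOf 0 (X 0 - ι τ) ≤ 1 := by
      refine (degreeOf_sub_le _ _ _).trans (max_le ?_ ?_)
      · simp
      · simp [e1]
    have e3 : degreeOf 0 (X 2 - C V : MvPolynomial (Fin 3) K) = 0 := by
      rw [← Nat.le_zero]
      refine (degreeOf_sub_le _ _ _).trans (max_le ?_ ?_)
      · rw [degreeOf_X_of_ne (by decide)]
      · simp
    refine (degreeOf_add_le _ _ _).trans (max_le ?_ ?_)
    · refine (degreeOf_mul_le _ _ _).trans ?_
      rw [e1]; omega
    · refine (degreeOf_mul_le _ _ _).trans ?_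
      rw [e1, e3]; omega
  rw [hh, degreeOf_mul_eq hg.ne_zero hh0] at hdeg
  refine ⟨by omega, ?_⟩
  have hh1 : pderiv 0 h = 0 := pderiv_eq_zero_of_degreeOf_eq_zero (by omega)
  have h5 : ι α = pderiv 0 g * h := by
    rw [← hdℓ, hh, Derivation.leibniz, hh1]
    simp [mul_comm]
  have h6 := degreeOf_aeval_X_of_ne (K := K) (i := 2) (j := 1) (by decide) α
  change degreeOf 2 (ι α) = 0 at h6
  rw [h5, degreeOf_mul_eq (fun h' => ht (by rw [h']; exact dvd_zero _)) hh0] at h6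
  omega

theorem lines_meet_of_ruled {g : MvPolynomial (Fin 3) K} (hg : Irreducible g)
    (ht : ¬ g ∣ pderiv 0 g) (hF : g ∣ flecnode g)
    (hchar : ∀ k : ℕ, 0 < k → k ≤ degreeOf 0 g + degreeOf 2 g → (k : K) ≠ 0)
    {M c V M' c' V' : K} (h0 : restrictU M c V g = 0) (h1 : restrictU M c V (pderiv 0 g) ≠ 0)
    (h2 : restrictV M' c' V' g = 0) (h3 : restrictV M' c' V' (pderiv 0 g) ≠ 0) :
    M * V' + c = M' * V + c' := by
  obtain ⟨hd, hd2⟩ := degreeOf_of_tangent_line hg ht hF hchar h0 h1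
  have hg0 : degreeOf 0 g ≠ 0 := fun h' => ht (by
    rw [pderiv_eq_zero_of_degreeOf_eq_zero h']; exact dvd_zero _)
  have hd0 := degreeOf_pderiv_self_lt 0 g hg0
  have hconst := natDegree_restrictV_le M' c' V' (pderiv 0 g)
  rw [hd2] at hconst
  have hconst' := Polynomial.eq_C_of_natDegree_eq_zero (p := restrictV M' c' V' (pderiv 0 g))
    (by omega)
  have hv : (restrictV M' c' V' (pderiv 0 g)).eval V ≠ 0 := by
    rw [hconst', Polynomial.eval_C]
    intro h
    rw [h, map_zero] at hconst'
    exact h3 hconst'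
  let η : MvPolynomial (Fin 3) K →ₐ[K] Polynomial K :=
    aeval ![Polynomial.X, Polynomial.C V', Polynomial.C V]
  have hη : ∀ x q, (η q).eval x = aeval ![x, V', V] q := by
    intro x q
    have h : (Polynomial.aeval x).comp η = aeval ![x, V', V] :=
      algHom_ext fun i => by fin_cases i <;> simp [η]
    simpa [Polynomial.aeval_def] using DFunLike.congr_fun h q
  have hder : ∀ q, Polynomial.derivative (η q) = η (pderiv 0 q) := by
    intro q
    induction q using MvPolynomial.induction_on with
    | C a =>
      have : η (C a) = Polynomial.C a := by simp [η]
      simp [this]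
    | add p q hp hq => simp [hp, hq]
    | mul_X p i hp =>
      have : Polynomial.derivative (η (X i)) = η (pderiv 0 (X i)) := by
        fin_cases i <;> simp [η, pderiv_X]
      rw [map_mul, Polynomial.derivative_mul, hp, this, Derivation.leibniz]
      simp; ring
  have hηd : (η g).natDegree ≤ 1 := by
    refine ((natDegree_aeval_le _ ![1, 0, 0] (fun i => ?_) g).trans
      (by simp [Fin.sum_univ_three])).trans hd
    fin_cases i <;> simp
  obtain ⟨a, b, hab⟩ := Polynomial.exists_eq_X_add_C_of_natDegree_le_one hηd
  have ha : a ≠ 0 := by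
    have e : η (pderiv 0 g) = Polynomial.C a := by rw [← hder, hab]; simp
    have e2 := hη (M' * V + c') (pderiv 0 g)
    rw [e, ← eval_restrictV, Polynomial.eval_C] at e2
    rwa [e2]
  have r1 := hη (M * V' + c) g
  have r2 := hη (M' * V + c') g
  rw [← eval_restrictU, h0] at r1
  rw [← eval_restrictV, h2] at r2
  rw [hab] at r1 r2
  simp at r1 r2
  have : a * ((M * V' + c) - (M' * V + c')) = 0 := by linear_combination r1 - r2
  exact sub_eq_zero.1 ((mul_eq_zero.1 this).resolve_left ha)

end RuledPair

section Transversal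

open MvPolynomial

variable {K : Type*} [Field K]

theorem exists_vanishing_polynomial {ι : Type*} (P : Finset ι) (M c V : ι → K) (E F : ℕ)
    (hdim : 2 * P.card ≤ (E + 1) * (F + 1)) :
    ∃ Q : MvPolynomial (Fin 3) K, Q ≠ 0 ∧ degreeOf 0 Q ≤ E ∧ degreeOf 1 Q ≤ E ∧
      degreeOf 2 Q ≤ F ∧ ∀ i ∈ P, restrictU (M i) (c i) (V i) Q = 0 := by
  classical
  let f : Fin 3 →₀ ℕ := Finsupp.equivFunOnFinite.symm ![E, E, F]
  let W := restrictSupport K (Finset.Iic f : Set (Fin 3 →₀ ℕ))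
  have hb : Module.Finite K W := Module.Finite.of_basis (basisRestrictSupport K _)
  have hfr : Module.finrank K W = (E + 1) * (E + 1) * (F + 1) := by
    rw [Module.finrank_eq_card_basis (basisRestrictSupport K (Finset.Iic f : Set (Fin 3 →₀ ℕ)))]
    simp only [Finset.coe_sort_coe, Fintype.card_coe]
    rw [Finsupp.card_Iic, Finset.prod_subset (Finset.subset_univ f.support)
      (f := fun i => (Finset.Iic (f i)).card) (fun i _ hi => by
        simp [Finsupp.notMem_support_iff.1 hi])]
    simp [Fin.prod_univ_three, f]
  let L : W →ₗ[K] (P → Fin (2 * E + 1) → K) :=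
    LinearMap.pi fun i => LinearMap.pi fun k =>
      (Polynomial.lcoeff K (k : ℕ)).comp
        ((restrictU (M i) (c i) (V i)).toLinearMap.comp W.subtype)
  have hker : LinearMap.ker L ≠ ⊥ := by
    apply LinearMap.ker_ne_bot_of_finrank_lt
    rw [hfr]
    simp only [Module.finrank_pi, Module.finrank_pi_fintype, Finset.sum_const, Finset.card_univ,
      Fintype.card_coe, Fintype.card_fin, smul_eq_mul]
    nlinarith
  obtain ⟨⟨Q, hQ⟩, hQk, hQ0⟩ := (Submodule.ne_bot_iff _).1 hker
  have hdeg : ∀ i, degreeOf i Q ≤ f i := fun i => degreeOf_le_iff.2 fun m hm => by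
    have : m ∈ (Finset.Iic f : Set (Fin 3 →₀ ℕ)) := (mem_restrictSupport_iff K).1 hQ hm
    have h2 : m ≤ f := by simpa using this
    exact h2 i
  have h0 : degreeOf 0 Q ≤ E := by simpa [f] using hdeg 0
  have h1 : degreeOf 1 Q ≤ E := by simpa [f] using hdeg 1
  have h2 : degreeOf 2 Q ≤ F := by simpa [f] using hdeg 2
  refine ⟨Q, fun h => hQ0 (by simpa using h), h0, h1, h2, fun i hi => ?_⟩
  ext k
  rw [Polynomial.coeff_zero]
  by_cases hk : k < 2 * E + 1
  · have := congrFun (congrFun (LinearMap.mem_ker.1 hQk) ⟨i, hi⟩) ⟨k, hk⟩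
    simpa [L] using this
  · apply Polynomial.coeff_eq_zero_of_natDegree_lt
    have := natDegree_restrictU_le (M i) (c i) (V i) Q
    omega

theorem exists_popular_factor {ι : Type*} [DecidableEq ι] (M c V : ι → K) (B : ℕ)
    (Q : MvPolynomial (Fin 3) K) : Q ≠ 0 → ∀ J : Finset ι,
    (∀ j ∈ J, restrictV (M j) (c j) (V j) Q = 0) →
    B * (degreeOf 0 Q + degreeOf 1 Q) < J.card →
    ∃ g, Irreducible g ∧ g ∣ Q ∧ ∃ J' ⊆ J, (∀ j ∈ J', restrictV (M j) (c j) (V j) g = 0) ∧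
      B * (degreeOf 0 g + degreeOf 1 g) < J'.card := by
  classical
  induction Q using WfDvdMonoid.induction_on_irreducible with
  | zero => exact fun h => absurd rfl h
  | unit u hu =>
    intro _ J hJ hcard
    obtain ⟨j, hj⟩ := Finset.card_pos.1 (Nat.zero_lt_of_lt hcard)
    have := hu.map (restrictV (M j) (c j) (V j))
    rw [hJ j hj] at this
    exact absurd this not_isUnit_zero
  | mul a i ha hi ih =>
    intro _ J hJ hcard
    rw [degreeOf_mul_eq hi.ne_zero ha, degreeOf_mul_eq hi.ne_zero ha] at hcard
    have hsplit := Finset.card_filter_add_card_filter_not (s := J)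
      (fun j => restrictV (M j) (c j) (V j) i = 0)
    by_cases h : B * (degreeOf 0 i + degreeOf 1 i) <
        (J.filter fun j => restrictV (M j) (c j) (V j) i = 0).card
    · exact ⟨i, hi, dvd_mul_right _ _, _, Finset.filter_subset _ _,
        fun j hj => (Finset.mem_filter.1 hj).2, h⟩
    · obtain ⟨g, hg, hga, J', hJ', h1, h2⟩ := ih ha
        (J.filter fun j => ¬ restrictV (M j) (c j) (V j) i = 0) (fun j hj => by
          obtain ⟨hj, hji⟩ := Finset.mem_filter.1 hj
          have := hJ j hj
          rw [map_mul] at this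
          exact (mul_eq_zero.1 this).resolve_left hji) (by
          have : B * (degreeOf 0 i + degreeOf 0 a + (degreeOf 1 i + degreeOf 1 a)) =
            B * (degreeOf 0 i + degreeOf 1 i) + B * (degreeOf 0 a + degreeOf 1 a) := by ring
          omega)
      exact ⟨g, hg, hga.mul_left _, J', hJ'.trans (Finset.filter_subset _ _), h1, h2⟩

theorem degreeOf_flecnode_le (j : Fin 3) (g : MvPolynomial (Fin 3) K) :
    degreeOf j (flecnode g) ≤ 3 * degreeOf j g := by
  have h : ∀ i, degreeOf j (pderiv i g) ≤ degreeOf j g := fun i => degreeOf_pderiv_le i j g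
  have h2 : ∀ i i', degreeOf j (pderiv i (pderiv i' g)) ≤ degreeOf j g :=
    fun i i' => (degreeOf_pderiv_le i j _).trans (h i')
  have hp : ∀ i, degreeOf j (pderiv i g ^ 2) ≤ 2 * degreeOf j g := fun i =>
    (degreeOf_pow_le _ _ _).trans (Nat.mul_le_mul_left 2 (h i))
  rw [flecnode]
  refine (degreeOf_add_le _ _ _).trans (max_le ((degreeOf_sub_le _ _ _).trans (max_le ?_ ?_)) ?_)
  · have := degreeOf_mul_le j (pderiv 0 (pderiv 0 g)) (pderiv 2 g ^ 2)
    have := h2 0 0; have := hp 2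
    omega
  · have e1 := degreeOf_mul_le j (2 * pderiv 0 (pderiv 2 g) * pderiv 0 g) (pderiv 2 g)
    have e2 := degreeOf_mul_le j (2 * pderiv 0 (pderiv 2 g)) (pderiv 0 g)
    have e3 := degreeOf_mul_le j 2 (pderiv 0 (pderiv 2 g))
    have e4 : degreeOf j (2 : MvPolynomial (Fin 3) K) = 0 := degreeOf_C (2 : K) j
    have := h2 0 2; have := h 0; have := h 2
    omega
  · have := degreeOf_mul_le j (pderiv 2 (pderiv 2 g)) (pderiv 0 g ^ 2)
    have := h2 2 2; have := hp 0
    omega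

theorem restrictV_flecnode_eq_zero {M c V : K} {g : MvPolynomial (Fin 3) K}
    (h : restrictV M c V g = 0) : restrictV M c V (flecnode g) = 0 := by
  have hder : ∀ q, Polynomial.derivative (restrictV M c V q) =
      Polynomial.C M * restrictV M c V (pderiv 0 q) + restrictV M c V (pderiv 2 q) := by
    intro q
    induction q using MvPolynomial.induction_on with
    | C a =>
      have : restrictV M c V (C a) = Polynomial.C a := (restrictV M c V).commutes a
      simp [this]
    | add p q hp hq => simp only [map_add, hp, hq]; ring
    | mul_X p i hp =>
      have : Polynomial.derivative (restrictV M c V (X i)) =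
          Polynomial.C M * restrictV M c V (pderiv 0 (X i)) +
            restrictV M c V (pderiv 2 (X i)) := by
        fin_cases i <;> simp [restrictV, pderiv_X]
      rw [map_mul, Polynomial.derivative_mul, hp, this, Derivation.leibniz, Derivation.leibniz]
      simp only [smul_eq_mul, map_add, map_mul]
      ring
  have comm : pderiv 2 (pderiv 0 g) = pderiv 0 (pderiv 2 g) := pderiv_comm_apply 2 0 g
  have h1 := hder g
  rw [h, Polynomial.derivative_zero] at h1
  have h2 := congrArg Polynomial.derivative h1
  rw [Polynomial.derivative_zero, Polynomial.derivative_add, Polynomial.derivative_C_mul,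
    hder, hder, comm] at h2
  have h3 : restrictV M c V (pderiv 2 g) = -(Polynomial.C M * restrictV M c V (pderiv 0 g)) := by
    linear_combination -h1
  simp only [flecnode, map_add, map_sub, map_mul, map_pow, map_ofNat, h3]
  linear_combination -(restrictV M c V (pderiv 0 g)) ^ 2 * h2

theorem card_le_natDegree_of_eval_eq_zero {ι : Type*} {p : Polynomial K} (hp : p ≠ 0) (V : ι → K)
    (S : Finset ι) (hV : Set.InjOn V S) (hS : ∀ i ∈ S, p.eval (V i) = 0) :
    S.card ≤ p.natDegree := by
  classical
  by_contra! h
  refine hp (Polynomial.eq_zero_of_natDegree_lt_card_of_eval_eq_zero' p (S.image V) ?_ ?_)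
  · simpa using hS
  · rwa [card_image_of_injOn hV]

theorem exists_common_transversal {ι : Type*} (P : Finset ι) (M c V : ι → K)
    (hV : Set.InjOn V P) (E F Δ : ℕ) (hE : 1 ≤ E)
    (hchar : ∀ k : ℕ, 0 < k → k ≤ E + F → (k : K) ≠ 0)
    (hdim : 2 * P.card ≤ (E + 1) * (F + 1)) (N : ι → Finset ι) (J : Finset ι) (hJP : J ⊆ P)
    (hN : ∀ j ∈ J, ∀ i ∈ N j, i ∈ P ∧ M i * V j + c i = M j * V i + c j)
    (hΔ : ∀ j ∈ J, Δ ≤ (N j).card) (hEF : E + F < Δ) (hJ : 20 * E ^ 2 < J.card) :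
    ∃ j₀ ∈ J, ∃ j₁ ∈ J, j₀ ≠ j₁ ∧ ∃ S ⊆ N j₀, Δ ≤ S.card + 2 * (E + F) ∧
      ∀ i ∈ S, M i * V j₁ + c i = M j₁ * V i + c j₁ := by
  classical
  obtain ⟨Q, hQ0, hQt, hQu, hQv, hQP⟩ := exists_vanishing_polynomial P M c V E F hdim
  have hmeet : ∀ j ∈ J, ∀ i ∈ N j, ∀ q, (restrictV (M j) (c j) (V j) q).eval (V i) =
      (restrictU (M i) (c i) (V i) q).eval (V j) := by
    intro j hj i hi q
    rw [eval_restrictU, eval_restrictV, (hN j hj i hi).2]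
  have hVN : ∀ j ∈ J, ∀ T ⊆ N j, Set.InjOn V T := fun j hj T hT =>
    hV.mono fun i hi => (hN j hj i (hT hi)).1
  have hcount : ∀ j ∈ J, ∀ T ⊆ N j, ∀ q, restrictV (M j) (c j) (V j) q ≠ 0 →
      degreeOf 0 q ≤ E → degreeOf 2 q ≤ F →
      (∀ i ∈ T, (restrictV (M j) (c j) (V j) q).eval (V i) = 0) → T.card ≤ E + F := by
    intro j hj T hT q hq h0 h2 hz
    have e1 := card_le_natDegree_of_eval_eq_zero hq V T (hVN j hj T hT) hz
    have e2 := natDegree_restrictV_le (M j) (c j) (V j) q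
    omega
  have hJQ : ∀ j ∈ J, restrictV (M j) (c j) (V j) Q = 0 := by
    intro j hj
    by_contra hne
    have := hcount j hj (N j) subset_rfl Q hne hQt hQv fun i hi => by
      rw [hmeet j hj i hi, hQP i (hN j hj i hi).1, Polynomial.eval_zero]
    have := hΔ j hj
    omega
  obtain ⟨g, hg, hgQ, J', hJ', hJ'g, hJ'card⟩ := exists_popular_factor M c V (10 * E) Q hQ0 J hJQ
    (by nlinarith)
  obtain ⟨R, hQR, hgR⟩ :=
    (FiniteMultiplicity.of_prime_left hg.prime hQ0).exists_eq_pow_mul_and_not_dvd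
  have hR0 : R ≠ 0 := fun h => hgR (h ▸ dvd_zero _)
  have hgdeg : ∀ x, degreeOf x g ≤ degreeOf x Q := fun x => by
    obtain ⟨h, hh⟩ := hgQ
    have hh0 : h ≠ 0 := fun h' => hQ0 (by rw [hh, h', mul_zero])
    rw [hh, degreeOf_mul_eq hg.ne_zero hh0]
    omega
  have hRdeg : ∀ x, degreeOf x R ≤ degreeOf x Q := fun x => by
    conv_rhs => rw [hQR, degreeOf_mul_eq (pow_ne_zero _ hg.ne_zero) hR0]
    omega
  have hVJ : ∀ T ⊆ J', Set.InjOn V T := fun T hT =>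
    hV.mono fun j hj => hJP (hJ' (hT hj))
  have hg0 := (hgdeg 0).trans hQt
  have hg1 := (hgdeg 1).trans hQu
  have hg2 := (hgdeg 2).trans hQv
  have hdt : degreeOf 0 g ≠ 0 := by
    intro h
    obtain ⟨r, hr, hrd⟩ := exists_rename_of_degreeOf_eq_zero h
    have := card_restrictV_rename_eq_zero_le M c V J' (hVJ J' subset_rfl) (r := r)
      (fun h' => hg.ne_zero (by rw [← hr, h', map_zero])) (fun j hj => by rw [hr]; exact hJ'g j hj)
    nlinarith
  have hgt : ¬ g ∣ pderiv 0 g := by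
    rintro ⟨h, hh⟩
    have h1 := pderiv_ne_zero_of_degreeOf_ne_zero hdt
      (hchar _ (Nat.pos_of_ne_zero hdt) (by omega))
    have hh0 : h ≠ 0 := fun h' => h1 (by rw [hh, h', mul_zero])
    have h2 := degreeOf_pderiv_self_lt 0 g hdt
    rw [hh, degreeOf_mul_eq hg.ne_zero hh0] at h2
    omega
  have hprod : degreeOf 0 g * degreeOf 1 g ≤ E * degreeOf 1 g := Nat.mul_le_mul_right _ hg0
  have hgF : g ∣ flecnode g := by
    by_contra hn
    have h1 := card_restrictV_common_zero_le M c V J' (hVJ J' subset_rfl) hg hn hJ'g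
      fun j hj => restrictV_flecnode_eq_zero (hJ'g j hj)
    have h2 := degreeOf_flecnode_le 0 g
    have h3 := degreeOf_flecnode_le 1 g
    have h4 : max 1 (degreeOf 0 (flecnode g)) ≤ 3 * degreeOf 0 g := max_le (by omega) h2
    have h5 := Nat.mul_le_mul_left (degreeOf 0 g) h3
    have h6 := Nat.mul_le_mul_right (degreeOf 1 g) h4
    nlinarith
  set JR := J'.filter fun j => restrictV (M j) (c j) (V j) R = 0
  set Jt := J'.filter fun j => restrictV (M j) (c j) (V j) (pderiv 0 g) = 0
  have hJR : JR.card ≤ E * (degreeOf 0 g + degreeOf 1 g) := by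
    have h1 := card_restrictV_common_zero_le M c V JR (hVJ JR (filter_subset _ _)) hg hgR
      (fun j hj => hJ'g j (mem_filter.1 hj).1) (fun j hj => (mem_filter.1 hj).2)
    have h2 : max 1 (degreeOf 0 R) ≤ E := max_le hE ((hRdeg 0).trans hQt)
    have h3 := Nat.mul_le_mul_left (degreeOf 0 g) ((hRdeg 1).trans hQu)
    have h4 := Nat.mul_le_mul_right (degreeOf 1 g) h2
    nlinarith
  have hJt : Jt.card ≤ 2 * E * (degreeOf 0 g + degreeOf 1 g) := by
    have h1 := card_restrictV_common_zero_le M c V Jt (hVJ Jt (filter_subset _ _)) hg hgt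
      (fun j hj => hJ'g j (mem_filter.1 hj).1) (fun j hj => (mem_filter.1 hj).2)
    have h2 : max 1 (degreeOf 0 (pderiv 0 g)) ≤ degreeOf 0 g :=
      max_le (by omega) (degreeOf_pderiv_le 0 0 g)
    have h3 := Nat.mul_le_mul_left (degreeOf 0 g) (degreeOf_pderiv_le 0 1 g)
    have h4 := Nat.mul_le_mul_right (degreeOf 1 g) h2
    nlinarith
  have hgood : 1 < (J' \ (JR ∪ Jt)).card := by
    have h1 := le_card_sdiff (JR ∪ Jt) J'
    have h2 := card_union_le JR Jt
    have h3 : 1 ≤ E * (degreeOf 0 g + degreeOf 1 g) :=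
      Nat.mul_pos hE (by omega)
    have h4 : 10 * E * (degreeOf 0 g + degreeOf 1 g) =
      10 * (E * (degreeOf 0 g + degreeOf 1 g)) := by ring
    have h5 : 2 * E * (degreeOf 0 g + degreeOf 1 g) =
      2 * (E * (degreeOf 0 g + degreeOf 1 g)) := by ring
    omega
  obtain ⟨j₀, hj₀, j₁, hj₁, hne⟩ := one_lt_card.1 hgood
  have hmem : ∀ j ∈ J' \ (JR ∪ Jt), j ∈ J ∧ restrictV (M j) (c j) (V j) g = 0 ∧
      restrictV (M j) (c j) (V j) R ≠ 0 ∧ restrictV (M j) (c j) (V j) (pderiv 0 g) ≠ 0 := by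
    intro j hj
    obtain ⟨h1, h2⟩ := mem_sdiff.1 hj
    rw [mem_union, not_or] at h2
    exact ⟨hJ' h1, hJ'g j h1, fun h => h2.1 (mem_filter.2 ⟨h1, h⟩),
      fun h => h2.2 (mem_filter.2 ⟨h1, h⟩)⟩
  obtain ⟨hj₀J, hj₀g, hj₀R, hj₀t⟩ := hmem j₀ hj₀
  obtain ⟨hj₁J, hj₁g, -, hj₁t⟩ := hmem j₁ hj₁
  set S := (N j₀).filter fun i => restrictU (M i) (c i) (V i) g = 0 ∧
    (restrictV (M j₀) (c j₀) (V j₀) (pderiv 0 g)).eval (V i) ≠ 0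
  refine ⟨j₀, hj₀J, j₁, hj₁J, hne, S, filter_subset _ _, ?_, fun i hi => ?_⟩
  · set A := (N j₀).filter fun i => (restrictV (M j₀) (c j₀) (V j₀) R).eval (V i) = 0
    set B := (N j₀).filter fun i =>
      (restrictV (M j₀) (c j₀) (V j₀) (pderiv 0 g)).eval (V i) = 0
    have hA : A.card ≤ E + F := hcount j₀ hj₀J A (filter_subset _ _) R hj₀R
      ((hRdeg 0).trans hQt) ((hRdeg 2).trans hQv) fun i hi => (mem_filter.1 hi).2
    have hB : B.card ≤ E + F := hcount j₀ hj₀J B (filter_subset _ _) _ hj₀t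
      ((degreeOf_pderiv_le 0 0 g).trans hg0) ((degreeOf_pderiv_le 0 2 g).trans hg2)
      fun i hi => (mem_filter.1 hi).2
    have hcov : N j₀ ⊆ S ∪ (A ∪ B) := by
      intro i hi
      by_cases h1 : (restrictV (M j₀) (c j₀) (V j₀) (pderiv 0 g)).eval (V i) = 0
      · exact mem_union_right _ (mem_union_right _ (mem_filter.2 ⟨hi, h1⟩))
      by_cases h2 : restrictU (M i) (c i) (V i) g = 0
      · exact mem_union_left _ (mem_filter.2 ⟨hi, h2, h1⟩)
      · refine mem_union_right _ (mem_union_left _ (mem_filter.2 ⟨hi, ?_⟩))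
        have h3 := hQP i (hN j₀ hj₀J i hi).1
        rw [hQR, map_mul, map_pow] at h3
        rw [hmeet j₀ hj₀J i hi, (mul_eq_zero.1 h3).resolve_left (pow_ne_zero _ h2),
          Polynomial.eval_zero]
    have h1 := card_le_card hcov
    have h2 := card_union_le S (A ∪ B)
    have h3 := card_union_le A B
    have h4 := hΔ j₀ hj₀J
    omega
  · obtain ⟨hiN, hig, hit⟩ := mem_filter.1 hi
    refine lines_meet_of_ruled hg hgt hgF (fun k hk hk' => hchar k hk (by omega)) hig ?_ hj₁g hj₁t
    intro h
    rw [hmeet j₀ hj₀J i hiN, h, Polynomial.eval_zero] at hit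
    exact hit rfl

end Transversal

section CartesianIncidence

theorem exists_forall_eval_ne_zero {K ι : Type*} [Field K] [Infinite K] (T : Finset ι)
    (f : ι → Polynomial K) (hf : ∀ i ∈ T, f i ≠ 0) : ∃ s, ∀ i ∈ T, (f i).eval s ≠ 0 := by
  by_contra! h
  have h0 : ∏ i ∈ T, f i = 0 := Polynomial.funext fun s => by
    obtain ⟨i, hi, hs⟩ := h s
    rw [Polynomial.eval_prod, Polynomial.eval_zero]
    exact prod_eq_zero hi hs
  obtain ⟨i, hi, h⟩ := prod_eq_zero_iff.1 h0
  exact hf i hi h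

open Polynomial in
theorem exists_generic_shear {F K : Type*} [Field F] [Field K] [Infinite K] (φ : F →+* K)
    (P : Finset ((F × F) × F)) :
    ∃ s : K, (∀ i ∈ P, 1 + s ^ 2 * φ i.1.1 ≠ 0) ∧
      Set.InjOn (fun i : (F × F) × F =>
        (φ i.2 + s * φ i.1.1 + s ^ 2 * φ i.1.2) / (1 + s ^ 2 * φ i.1.1)) P := by
  classical
  let num : (F × F) × F → K[X] := fun i => C (φ i.2) + X * C (φ i.1.1) + X ^ 2 * C (φ i.1.2)
  let den : (F × F) × F → K[X] := fun i => 1 + X ^ 2 * C (φ i.1.1)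
  have hden : ∀ i, den i ≠ 0 := by
    intro i h
    have := congrArg (fun f => coeff f 0) h
    simp [den, coeff_X_pow] at this
  have hdiff : ∀ i j, i ≠ j → num i * den j - num j * den i ≠ 0 := by
    intro i j hij h
    have hform : num i * den j - num j * den i =
        C (φ i.2 - φ j.2) + C (φ i.1.1 - φ j.1.1) * X ^ 1
        + C (φ i.1.2 + φ i.2 * φ j.1.1 - φ j.1.2 - φ j.2 * φ i.1.1) * X ^ 2
        + C (φ i.1.2 * φ j.1.1 - φ j.1.2 * φ i.1.1) * X ^ 4 := by
      simp only [num, den, map_sub, map_add, map_mul]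
      ring
    rw [hform] at h
    have e0 := congrArg (fun f => coeff f 0) h
    have e1 := congrArg (fun f => coeff f 1) h
    have e2 := congrArg (fun f => coeff f 2) h
    simp only [coeff_add, coeff_C_mul, coeff_X_pow, coeff_C, coeff_zero] at e0 e1 e2
    norm_num at e0 e1 e2
    have a0 : i.2 = j.2 := φ.injective (sub_eq_zero.1 e0)
    have a1 : i.1.1 = j.1.1 := φ.injective (sub_eq_zero.1 e1)
    have a2 : i.1.2 = j.1.2 := by
      apply φ.injective
      rw [a0, a1] at e2
      linear_combination e2
    exact hij (Prod.ext (Prod.ext a1 a2) a0)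
  obtain ⟨s, hs⟩ := exists_forall_eval_ne_zero (P.disjSum P.offDiag)
    (Sum.elim den fun q => num q.1 * den q.2 - num q.2 * den q.1) (by
      rintro (i | q) hi
      · exact hden i
      · exact hdiff _ _ (mem_offDiag.1 (inr_mem_disjSum.1 hi)).2.2)
  have hd : ∀ i ∈ P, 1 + s ^ 2 * φ i.1.1 ≠ 0 := fun i hi => by
    have := hs (Sum.inl i) (inl_mem_disjSum.2 hi)
    simpa only [Sum.elim_inl, den, eval_add, eval_mul, eval_C, eval_X, eval_pow, eval_one] using this
  refine ⟨s, hd, fun i hi j hj hij => ?_⟩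
  by_contra hne
  refine hs (Sum.inr (i, j)) (inr_mem_disjSum.2 (mem_offDiag.2 ⟨hi, hj, hne⟩)) ?_
  simp only [Sum.elim_inr, num, den, eval_sub, eval_mul, eval_add, eval_C, eval_X, eval_pow,
    eval_one]
  have := (div_eq_div_iff (hd i hi) (hd j hj)).1 hij
  linear_combination this

theorem shear_incidence_iff {K : Type*} [Field K] (s m c a m' c' a' : K)
    (h₁ : 1 + s ^ 2 * m ≠ 0) (h₂ : 1 + s ^ 2 * m' ≠ 0) :
    m / (1 + s ^ 2 * m) * ((a' + s * m' + s ^ 2 * c') / (1 + s ^ 2 * m')) + c / (1 + s ^ 2 * m) =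
      m' / (1 + s ^ 2 * m') * ((a + s * m + s ^ 2 * c) / (1 + s ^ 2 * m)) + c' / (1 + s ^ 2 * m')
      ↔ m * a' + c = m' * a + c' := by
  rw [← sub_eq_zero, ← sub_eq_zero (a := m * a' + c)]
  have : m / (1 + s ^ 2 * m) * ((a' + s * m' + s ^ 2 * c') / (1 + s ^ 2 * m')) + c / (1 + s ^ 2 * m)
      - (m' / (1 + s ^ 2 * m') * ((a + s * m + s ^ 2 * c) / (1 + s ^ 2 * m))
        + c' / (1 + s ^ 2 * m')) =
      (m * a' + c - (m' * a + c')) / ((1 + s ^ 2 * m) * (1 + s ^ 2 * m')) := by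
    have aux : ∀ D D' n n' : K, D ≠ 0 → D' ≠ 0 → m / D * (n' / D') + c / D -
        (m' / D' * (n / D) + c' / D') = (m * n' + c * D' - m' * n - c' * D) / (D * D') := by
      intro D D' n n' hD hD'
      field_simp
      ring
    rw [aux _ _ _ _ h₁ h₂]
    congr 1
    ring
  rw [this, div_eq_zero_iff, or_iff_left (mul_ne_zero h₁ h₂)]

/-- Affine maps over `F` form a ruled configuration over any infinite extension, so a large set
of affine maps, each in agreement with many others, contains a pair of rich transversals. -/
theorem exists_affine_transversal {p : ℕ} [Fact p.Prime] (P : Finset ((ZMod p × ZMod p) × ZMod p))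
    (E F Δ : ℕ) (hE : 1 ≤ E) (hchar : E + F < p) (hdim : 2 * P.card ≤ (E + 1) * (F + 1))
    (N : (ZMod p × ZMod p) × ZMod p → Finset ((ZMod p × ZMod p) × ZMod p))
    (J : Finset ((ZMod p × ZMod p) × ZMod p)) (hJP : J ⊆ P)
    (hN : ∀ j ∈ J, ∀ i ∈ N j, i ∈ P ∧ i.1.1 * j.2 + i.1.2 = j.1.1 * i.2 + j.1.2)
    (hΔ : ∀ j ∈ J, Δ ≤ (N j).card) (hEF : E + F < Δ) (hJ : 20 * E ^ 2 < J.card) :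
    ∃ j₀ ∈ J, ∃ j₁ ∈ J, j₀ ≠ j₁ ∧ ∃ S ⊆ N j₀, Δ ≤ S.card + 2 * (E + F) ∧
      ∀ i ∈ S, i.1.1 * j₁.2 + i.1.2 = j₁.1.1 * i.2 + j₁.1.2 := by
  let φ := algebraMap (ZMod p) (AlgebraicClosure (ZMod p))
  obtain ⟨s, hs, hinj⟩ := exists_generic_shear φ P
  have key : ∀ i ∈ P, ∀ j ∈ P, (φ i.1.1 / (1 + s ^ 2 * φ i.1.1) *
      ((φ j.2 + s * φ j.1.1 + s ^ 2 * φ j.1.2) / (1 + s ^ 2 * φ j.1.1))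
        + φ i.1.2 / (1 + s ^ 2 * φ i.1.1) =
      φ j.1.1 / (1 + s ^ 2 * φ j.1.1) *
      ((φ i.2 + s * φ i.1.1 + s ^ 2 * φ i.1.2) / (1 + s ^ 2 * φ i.1.1))
        + φ j.1.2 / (1 + s ^ 2 * φ j.1.1) ↔ i.1.1 * j.2 + i.1.2 = j.1.1 * i.2 + j.1.2) := by
    intro i hi j hj
    rw [shear_incidence_iff _ _ _ _ _ _ _ (hs i hi) (hs j hj), ← map_mul, ← map_add, ← map_mul,
      ← map_add, φ.injective.eq_iff]
  have : CharP (AlgebraicClosure (ZMod p)) p := charP_of_injective_algebraMap φ.injective p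
  obtain ⟨j₀, hj₀, j₁, hj₁, hne, S, hS, hcard, h⟩ := exists_common_transversal P
    (fun i => φ i.1.1 / (1 + s ^ 2 * φ i.1.1)) (fun i => φ i.1.2 / (1 + s ^ 2 * φ i.1.1)) _
    hinj E F Δ hE
    (fun k hk hk' h => by
      have := Nat.le_of_dvd hk ((CharP.cast_eq_zero_iff _ p k).1 h)
      omega)
    hdim N J hJP (fun j hj i hi => ⟨(hN j hj i hi).1,
      (key i (hN j hj i hi).1 j (hJP hj)).2 (hN j hj i hi).2⟩) hΔ hEF hJ
  exact ⟨j₀, hj₀, j₁, hj₁, hne, S, hS, hcard, fun i hi =>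
    (key i (hN j₀ hj₀ i (hS hi)).1 j₁ (hJP hj₁)).1 (h i hi)⟩

end CartesianIncidence

section CartesianTransversal

theorem sum_le_add_sum_card_level {ι : Type*} (P : Finset ι) (d : ι → ℕ) (a b : ℕ)
    (hd : ∀ j ∈ P, d j ≤ b) :
    ∑ j ∈ P, d j ≤ P.card * a + ∑ k ∈ Ioc a b, (P.filter fun j => k ≤ d j).card := by
  have h : ∀ j ∈ P, d j ≤ a + ((Ioc a b).filter fun k => k ≤ d j).card := by
    intro j hj
    have : Ioc a (d j) ⊆ (Ioc a b).filter fun k => k ≤ d j := fun k hk => by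
      have := mem_Ioc.1 hk
      have := hd j hj
      simp only [mem_filter, mem_Ioc]
      omega
    have := card_le_card this
    rw [Nat.card_Ioc] at this
    omega
  refine (sum_le_sum h).trans ?_
  rw [sum_add_distrib, sum_const, smul_eq_mul]
  refine Nat.add_le_add_left (le_of_eq ?_) _
  simp only [card_filter]
  exact sum_comm

theorem card_level_le {p : ℕ} [Fact p.Prime] (P : Finset ((ZMod p × ZMod p) × ZMod p))
    (Δ μ : ℕ) (N : (ZMod p × ZMod p) × ZMod p → Finset ((ZMod p × ZMod p) × ZMod p))
    (J : Finset ((ZMod p × ZMod p) × ZMod p)) (hJP : J ⊆ P)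
    (hN : ∀ j ∈ J, ∀ i ∈ N j, i ∈ P ∧ i.1.1 * j.2 + i.1.2 = j.1.1 * i.2 + j.1.2)
    (hJ : ∀ j ∈ J, Δ ≤ (N j).card)
    (hμ : ∀ j₀ ∈ J, ∀ j₁ ∈ J, j₀ ≠ j₁ → ∀ S ⊆ N j₀,
      (∀ i ∈ S, i.1.1 * j₁.2 + i.1.2 = j₁.1.1 * i.2 + j₁.1.2) → S.card ≤ μ)
    (hΔ : 512 * P.card ≤ Δ ^ 2) (hp : 512 * P.card ≤ p ^ 2) (hμΔ : 2 * μ + 9 ≤ Δ) :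
    (J.card : ℝ) ≤ 41000 * ((P.card : ℝ) ^ 2 / Δ ^ 2 + (P.card : ℝ) ^ 2 / p ^ 2 + 1) := by
  set n := P.card with hn
  have hp2 : 2 ≤ p := (Fact.out : p.Prime).two_le
  obtain ⟨t, ht⟩ : ∃ t, t = min Δ p := ⟨_, rfl⟩
  have ht0 : 0 < t := by omega
  have htn : 512 * n ≤ t ^ 2 := by
    rcases le_total Δ p with h | h
    · rwa [ht, min_eq_left h]
    · rwa [ht, min_eq_right h]
  set F := t / 16 with hF
  set e := 2 * n / (F + 1) with he
  have he1 : e * (F + 1) ≤ 2 * n := Nat.div_mul_le_self _ _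
  have he2 : 2 * n ≤ (e + 1 + 1) * (F + 1) := by
    have := Nat.lt_mul_div_succ (2 * n) (Nat.succ_pos F)
    rw [Nat.succ_eq_add_one, ← he] at this
    nlinarith
  have hF1 : t < 16 * (F + 1) := by omega
  have het : e * t ≤ 32 * n := by nlinarith
  have het' : 16 * e ≤ t := by nlinarith
  have hcard : J.card ≤ 20 * (e + 1) ^ 2 := by
    by_contra! hlt
    obtain ⟨j₀, hj₀, j₁, hj₁, hne, S, hS, hSc, h⟩ := exists_affine_transversal P (e + 1) F Δ
      (by omega) (by omega) he2 N J hJP hN hJ (by omega) hlt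
    have := hμ j₀ hj₀ j₁ hj₁ hne S hS h
    omega
  have h1 : (J.card : ℝ) ≤ 20 * ((e : ℝ) + 1) ^ 2 := by exact_mod_cast hcard
  have h2 : (e : ℝ) ^ 2 * t ^ 2 ≤ 1024 * n ^ 2 := by
    have : (e : ℝ) * t ≤ 32 * n := by exact_mod_cast het
    nlinarith [mul_nonneg (Nat.cast_nonneg (α := ℝ) e) (Nat.cast_nonneg (α := ℝ) t)]
  have ht0' : (0 : ℝ) < (t : ℝ) ^ 2 := by positivity
  have h3 : (e : ℝ) ^ 2 ≤ 1024 * ((n : ℝ) ^ 2 / t ^ 2) := by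
    rw [mul_div_assoc', le_div_iff₀ ht0']
    exact h2
  have h4 : (n : ℝ) ^ 2 / t ^ 2 ≤ (n : ℝ) ^ 2 / Δ ^ 2 + (n : ℝ) ^ 2 / p ^ 2 := by
    rcases le_total Δ p with h | h
    · rw [ht, min_eq_left h]
      have : 0 ≤ (n : ℝ) ^ 2 / p ^ 2 := by positivity
      linarith
    · rw [ht, min_eq_right h]
      have : 0 ≤ (n : ℝ) ^ 2 / Δ ^ 2 := by positivity
      linarith
  nlinarith [sq_nonneg ((e : ℝ) - 1), sq_nonneg ((n : ℝ) / t)]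

open Classical in
theorem sq_card_le_sum_card_fiber {ι κ : Type*} [DecidableEq κ] (Φ : Finset ι) (B : Finset κ)
    (f : ι → κ) (h : ∀ i ∈ Φ, f i ∈ B) :
    Φ.card ^ 2 ≤ B.card * ((Φ ×ˢ Φ).filter fun q => f q.1 = f q.2).card := by
  have h1 := card_eq_sum_card_fiberwise (s := Φ) (t := B) (f := f) h
  have h2 := card_eq_sum_card_fiberwise (s := (Φ ×ˢ Φ).filter fun q => f q.1 = f q.2) (t := B)
    (f := fun q => f q.1) fun q hq => h _ (mem_product.1 (mem_filter.1 hq).1).1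
  rw [h1, h2]
  refine (sq_sum_le_card_mul_sum_sq (s := B) (f := fun b => (Φ.filter fun i => f i = b).card)).trans
    (Nat.mul_le_mul_left _ (sum_le_sum fun b _ => ?_))
  rw [sq, ← card_product]
  refine card_le_card fun q hq => ?_
  simp only [mem_product, mem_filter] at hq ⊢
  exact ⟨⟨⟨hq.1.1, hq.2.1⟩, hq.1.2.trans hq.2.2.symm⟩, hq.1.2⟩

set_option maxHeartbeats 800000 in
/-- An incidence bound for graphs of affine maps over a small Cartesian product. -/
theorem sq_card_affine_incidences_le {p : ℕ} [Fact p.Prime] (L : Finset (ZMod p × ZMod p))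
    (A B : Finset (ZMod p)) (Φ : Finset ((ZMod p × ZMod p) × ZMod p)) (hΦ : Φ ⊆ L ×ˢ A)
    (hL : ∀ l ∈ L, l.1 ≠ 0) (hB : ∀ φ ∈ Φ, φ.1.1 * φ.2 + φ.1.2 ∈ B) (μ : ℕ)
    (hμ : ∀ a y, (Φ.filter fun φ => φ.2 = a ∧ φ.1.1 * φ.2 + φ.1.2 = y).card ≤ μ)
    (hA : A.card ≤ μ) (hp : 512 * (A.card * L.card) ≤ p ^ 2)
    (hp' : L.card ^ 2 * (A.card * L.card) ≤ p ^ 4) :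
    (Φ.card : ℝ) ^ 2 ≤ 100000 * B.card *
      ((A.card * L.card : ℕ) * (√(A.card * L.card : ℕ) + μ)) := by
  classical
  rcases Φ.eq_empty_or_nonempty with rfl | ⟨φ₀, hφ₀⟩
  · simp only [card_empty, Nat.cast_zero, ne_eq, OfNat.ofNat_ne_zero, not_false_eq_true, zero_pow]
    positivity
  obtain ⟨hl₀, ha₀⟩ := mem_product.1 (hΦ hφ₀)
  have hA1 : 1 ≤ A.card := card_pos.2 ⟨_, ha₀⟩
  have hL1 : 1 ≤ L.card := card_pos.2 ⟨_, hl₀⟩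
  set P := L ×ˢ A with hP
  have hPc : P.card = A.card * L.card := by rw [hP, card_product, mul_comm]
  rw [← hPc] at hp hp' ⊢
  set n := P.card with hn
  have hn1 : 1 ≤ n := by rw [hPc]; exact Nat.mul_pos hA1 hL1
  have hLn : L.card ≤ n := by rw [hPc]; exact Nat.le_mul_of_pos_left _ hA1
  set N : (ZMod p × ZMod p) × ZMod p → Finset ((ZMod p × ZMod p) × ZMod p) := fun j =>
    P.filter fun i => (i.1, j.2) ∈ Φ ∧ (j.1, i.2) ∈ Φ ∧
      i.1.1 * j.2 + i.1.2 = j.1.1 * i.2 + j.1.2 with hN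
  have hsq : Φ.card ^ 2 ≤ B.card * ∑ j ∈ P, (N j).card := by
    refine (sq_card_le_sum_card_fiber Φ B (fun φ => φ.1.1 * φ.2 + φ.1.2) hB).trans
      (Nat.mul_le_mul_left _ ?_)
    rw [← card_sigma]
    refine card_le_card_of_injOn (fun q => ⟨(q.2.1, q.1.2), (q.1.1, q.2.2)⟩) ?_ ?_
    · intro q hq
      simp only [coe_filter, mem_product, Set.mem_ofPred_eq] at hq
      have h1 := mem_product.1 (hΦ hq.1.1)
      have h2 := mem_product.1 (hΦ hq.1.2)
      simp only [coe_sigma, Set.mem_sigma_iff, mem_coe, hP, mem_product, hN, mem_filter]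
      exact ⟨⟨h2.1, h1.2⟩, ⟨h1.1, h2.2⟩, hq.1.1, hq.1.2, hq.2⟩
    · rintro ⟨⟨l, a⟩, l', a'⟩ - ⟨⟨k, b⟩, k', b'⟩ - h
      simp only [Sigma.mk.injEq, heq_eq_eq, Prod.mk.injEq] at h ⊢
      tauto
  have hNL : ∀ j ∈ P, (N j).card ≤ L.card := by
    intro j hj
    refine card_le_card_of_injOn Prod.fst ?_ ?_
    · intro i hi
      exact (mem_product.1 (mem_filter.1 hi).1).1
    · intro i hi i' hi' h
      have e := (mem_filter.1 hi).2.2.2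
      have e' := (mem_filter.1 hi').2.2.2
      refine Prod.ext h (mul_left_cancel₀ (hL _ (mem_product.1 hj).1) ?_)
      rw [h] at e
      linear_combination e' - e
  obtain ⟨D, hD⟩ : ∃ D, D = 23 * ⌈√(n : ℝ)⌉₊ + 2 * μ + 9 := ⟨_, rfl⟩
  have hceil : √(n : ℝ) ≤ ⌈√(n : ℝ)⌉₊ := Nat.le_ceil _
  have hceil' : (⌈√(n : ℝ)⌉₊ : ℝ) < √(n : ℝ) + 1 := Nat.ceil_lt_add_one (Real.sqrt_nonneg _)
  have hsn : √(n : ℝ) ^ 2 = n := Real.sq_sqrt (Nat.cast_nonneg _)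
  have hsn1 : 1 ≤ √(n : ℝ) := Real.one_le_sqrt.2 (by exact_mod_cast hn1)
  have hDn : 512 * n ≤ D ^ 2 := by
    have h1 : n ≤ ⌈√(n : ℝ)⌉₊ ^ 2 := by
      have : (n : ℝ) ≤ (⌈√(n : ℝ)⌉₊ : ℝ) ^ 2 := by nlinarith
      exact_mod_cast this
    rw [hD]
    nlinarith
  have hDr : (D : ℝ) = 23 * (⌈√(n : ℝ)⌉₊ : ℝ) + 2 * μ + 9 := by rw [hD]; push_cast; ring
  have hμ0 : (0 : ℝ) ≤ μ := Nat.cast_nonneg _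
  have hμ1 : (1 : ℝ) ≤ μ := by exact_mod_cast hA1.trans hA
  have hp0 : (0 : ℝ) < p := by exact_mod_cast (Fact.out : p.Prime).pos
  have hlevel : ∀ k ∈ Ioc D L.card, ((P.filter fun j => k ≤ (N j).card).card : ℝ) ≤
      41000 * ((n : ℝ) ^ 2 / k ^ 2 + (n : ℝ) ^ 2 / p ^ 2 + 1) := by
    intro k hk
    have hk' := (mem_Ioc.1 hk).1
    refine card_level_le P k μ N _ (filter_subset _ _) ?_ (fun j hj => (mem_filter.1 hj).2) ?_
      (hDn.trans (Nat.pow_le_pow_left hk'.le 2)) hp (by omega)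
    · intro j _ i hi
      exact ⟨(mem_filter.1 hi).1, (mem_filter.1 hi).2.2.2⟩
    · intro j₀ hj₀ j₁ hj₁ hne S hS h
      have hS' : ∀ i ∈ S, i ∈ P ∧ (i.1, j₀.2) ∈ Φ ∧ (j₀.1, i.2) ∈ Φ ∧
        i.1.1 * j₀.2 + i.1.2 = j₀.1.1 * i.2 + j₀.1.2 := fun i hi => mem_filter.1 (hS hi)
      by_cases ha : j₀.2 = j₁.2
      · have hconst : ∀ i ∈ S, ∀ i' ∈ S, i.2 = i'.2 := by
          intro i hi i' hi'
          have e1 := (hS' i hi).2.2.2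
          have e2 := (hS' i' hi').2.2.2
          have e3 := h i hi
          have e4 := h i' hi'
          by_contra hne'
          have hm : (j₀.1.1 - j₁.1.1) * (i.2 - i'.2) = 0 := by
            rw [← ha] at e3 e4
            linear_combination e3 - e4 - e1 + e2
          have hm' := sub_eq_zero.1 ((mul_eq_zero.1 hm).resolve_right (sub_ne_zero.2 hne'))
          refine hne (Prod.ext (Prod.ext hm' ?_) ha)
          rw [← ha, ← hm'] at e3
          linear_combination e3 - e1
        rcases S.eq_empty_or_nonempty with rfl | ⟨i₀, hi₀⟩
        · simp
        refine (card_le_card_of_injOn (fun i => (i.1, j₀.2)) ?_ ?_).trans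
          (hμ j₀.2 (j₀.1.1 * i₀.2 + j₀.1.2))
        · intro i hi
          simp only [coe_filter, Set.mem_ofPred_eq, true_and]
          refine ⟨(hS' i hi).2.1, ?_⟩
          rw [(hS' i hi).2.2.2, hconst i hi i₀ hi₀]
        · intro i hi i' hi' e
          exact Prod.ext (Prod.mk.inj e).1 (hconst i hi i' hi')
      · refine (card_le_card_of_injOn Prod.snd ?_ ?_).trans hA
        · intro i hi
          exact (mem_product.1 (hS' i hi).1).2
        · intro i hi i' hi' e
          have e1 := (hS' i hi).2.2.2
          have e2 := (hS' i' hi').2.2.2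
          have e3 := h i hi
          have e4 := h i' hi'
          rw [e] at e1 e3
          have hm : (i.1.1 - i'.1.1) * (j₀.2 - j₁.2) = 0 := by
            linear_combination e1 - e2 - e3 + e4
          have hm' := sub_eq_zero.1 ((mul_eq_zero.1 hm).resolve_right (sub_ne_zero.2 ha))
          refine Prod.ext (Prod.ext hm' ?_) e
          rw [hm'] at e1
          linear_combination e1 - e2
  have hsum : (∑ j ∈ P, ((N j).card : ℝ)) ≤ n * D + ∑ k ∈ Ioc D L.card,
      41000 * ((n : ℝ) ^ 2 / k ^ 2 + (n : ℝ) ^ 2 / p ^ 2 + 1) := by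
    have := sum_le_add_sum_card_level P (fun j => (N j).card) D L.card hNL
    have h' : ((∑ j ∈ P, (N j).card : ℕ) : ℝ) ≤ ((P.card * D + ∑ k ∈ Ioc D L.card,
      (P.filter fun j => k ≤ (N j).card).card : ℕ) : ℝ) := by exact_mod_cast this
    push_cast at h'
    exact h'.trans (add_le_add_right (sum_le_sum hlevel) _)
  have hD0 : (0 : ℝ) < D := by rw [hDr]; positivity
  have hinv : ∑ k ∈ Ioc D L.card, (n : ℝ) ^ 2 / (k : ℝ) ^ 2 ≤ n * √n := by
    have h1 : ∑ k ∈ Ioc D L.card, ((k : ℝ) ^ 2)⁻¹ ≤ (D : ℝ)⁻¹ := by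
      rcases le_total D L.card with h | h
      · have := sum_Ioc_inv_sq_le_sub (α := ℝ) (k := D) (n := L.card) (by omega) h
        have : (0 : ℝ) ≤ (L.card : ℝ)⁻¹ := by positivity
        linarith
      · rw [Ioc_eq_empty (by omega), sum_empty]
        positivity
    simp only [div_eq_mul_inv, ← mul_sum]
    have h2 : (n : ℝ) ^ 2 * (D : ℝ)⁻¹ ≤ n * √n := by
      rw [← div_eq_mul_inv, div_le_iff₀ hD0]
      have : √(n : ℝ) ≤ D := by rw [hDr]; linarith
      calc (n : ℝ) ^ 2 = n * √n * √n := by rw [mul_assoc, ← sq, hsn]; ring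
        _ ≤ n * √n * D := by gcongr
    exact (mul_le_mul_of_nonneg_left h1 (by positivity)).trans h2
  have hLp : (L.card : ℝ) * ((n : ℝ) ^ 2 / (p : ℝ) ^ 2) ≤ n * √n := by
    have h1 : (L.card : ℝ) * √n ≤ (p : ℝ) ^ 2 := by
      refine abs_le_of_sq_le_sq' ?_ (by positivity) |>.2
      rw [mul_pow, hsn]
      calc (L.card : ℝ) ^ 2 * n ≤ (p : ℝ) ^ 4 := by exact_mod_cast hp'
        _ = _ := by ring
    rw [mul_div_assoc', div_le_iff₀ (by positivity)]
    calc (L.card : ℝ) * (n : ℝ) ^ 2 = n * √n * (L.card * √n) := by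
          linear_combination -(L.card : ℝ) * n * hsn
      _ ≤ n * √n * (p : ℝ) ^ 2 := by gcongr
  have hcardI : ((Ioc D L.card).card : ℝ) ≤ L.card := by
    rw [Nat.card_Ioc]
    exact_mod_cast Nat.sub_le _ _
  have hLnr : (L.card : ℝ) ≤ n := by exact_mod_cast hLn
  have hn0 : (0 : ℝ) ≤ n := Nat.cast_nonneg _
  have htail : ∑ k ∈ Ioc D L.card, 41000 * ((n : ℝ) ^ 2 / k ^ 2 + (n : ℝ) ^ 2 / p ^ 2 + 1) ≤
      41000 * (n * √n + n * √n + n * μ) := by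
    rw [← mul_sum]
    refine mul_le_mul_of_nonneg_left ?_ (by norm_num)
    rw [sum_add_distrib, sum_add_distrib, sum_const, sum_const, nsmul_eq_mul, nsmul_eq_mul, mul_one]
    have h1 : ((Ioc D L.card).card : ℝ) * ((n : ℝ) ^ 2 / (p : ℝ) ^ 2) ≤ n * √n :=
      (mul_le_mul_of_nonneg_right hcardI (by positivity)).trans hLp
    have h2 : (L.card : ℝ) ≤ n * μ := by nlinarith
    linarith
  have hnD : (n : ℝ) * D ≤ n * (55 * √n + 2 * μ) := by
    refine mul_le_mul_of_nonneg_left ?_ hn0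
    rw [hDr]
    linarith
  have hsqr : (Φ.card : ℝ) ^ 2 ≤ B.card * ∑ j ∈ P, ((N j).card : ℝ) := by exact_mod_cast hsq
  calc (Φ.card : ℝ) ^ 2 ≤ B.card * ∑ j ∈ P, ((N j).card : ℝ) := hsqr
    _ ≤ B.card * (100000 * (n * (√n + μ))) := by
        refine mul_le_mul_of_nonneg_left ?_ (Nat.cast_nonneg _)
        have h1 : 0 ≤ (n : ℝ) * √n := by positivity
        have h2 : 0 ≤ (n : ℝ) * μ := by positivity
        linarith
    _ = _ := by ring

end CartesianTransversal

section Lines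

/-- Normalised equations `ν · x = γ` of the lines of the plane `𝔽_p²`. -/
def lineKeys (p : ℕ) [Fact p.Prime] : Finset ((ZMod p × ZMod p) × ZMod p) :=
  univ.filter fun l => l.1.1 = 1 ∨ l.1.1 = 0 ∧ l.1.2 = 1

/-- The points of the line `ν · x = γ`. -/
def linePts {p : ℕ} [Fact p.Prime] (l : (ZMod p × ZMod p) × ZMod p) : Finset (ZMod p × ZMod p) :=
  univ.filter fun x => l.1.1 * x.1 + l.1.2 * x.2 = l.2

/-- The lines containing at least `k` points of `E`. -/
def richLines {p : ℕ} [Fact p.Prime] (E : Finset (ZMod p × ZMod p)) (k : ℕ) :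
    Finset ((ZMod p × ZMod p) × ZMod p) :=
  (lineKeys p).filter fun l => k ≤ (E ∩ linePts l).card

variable {p : ℕ} [Fact p.Prime]

theorem mem_linePts {l : (ZMod p × ZMod p) × ZMod p} {x : ZMod p × ZMod p} :
    x ∈ linePts l ↔ l.1.1 * x.1 + l.1.2 * x.2 = l.2 := by
  simp [linePts]

theorem mem_lineKeys {l : (ZMod p × ZMod p) × ZMod p} :
    l ∈ lineKeys p ↔ l.1.1 = 1 ∨ l.1.1 = 0 ∧ l.1.2 = 1 := by
  simp [lineKeys]

theorem eq_of_mem_linePts {l l' : (ZMod p × ZMod p) × ZMod p} (hl : l ∈ lineKeys p)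
    (hl' : l' ∈ lineKeys p) {x y : ZMod p × ZMod p} (hxy : x ≠ y) (hx : x ∈ linePts l)
    (hy : y ∈ linePts l) (hx' : x ∈ linePts l') (hy' : y ∈ linePts l') : l = l' := by
  rw [mem_linePts] at *
  rw [mem_lineKeys] at *
  obtain ⟨⟨a, b⟩, g⟩ := l
  obtain ⟨⟨a', b'⟩, g'⟩ := l'
  obtain ⟨x1, x2⟩ := x
  obtain ⟨y1, y2⟩ := y
  simp only [Prod.mk.injEq, ne_eq, not_and_or] at *
  have hab : a = a' ∧ b = b' := by
    rcases hl with rfl | ⟨rfl, rfl⟩ <;> rcases hl' with rfl | ⟨rfl, rfl⟩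
    · refine ⟨rfl, ?_⟩
      have : (b - b') * (x2 - y2) = 0 := by linear_combination hx - hy - hx' + hy'
      rcases mul_eq_zero.1 this with h | h
      · exact sub_eq_zero.1 h
      · have h2 := sub_eq_zero.1 h
        have h1 : x1 = y1 := by rw [h2] at hx; linear_combination hx - hy
        tauto
    · have h2 : x2 = y2 := by linear_combination hx' - hy'
      have h1 : x1 = y1 := by rw [h2] at hx; linear_combination hx - hy
      tauto
    · have h2 : x2 = y2 := by linear_combination hx - hy
      have h1 : x1 = y1 := by rw [h2] at hx'; linear_combination hx' - hy'
      tauto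
    · exact ⟨rfl, rfl⟩
  obtain ⟨rfl, rfl⟩ := hab
  exact ⟨⟨rfl, rfl⟩, hx.symm.trans hx'⟩

theorem card_linePts {l : (ZMod p × ZMod p) × ZMod p} (hl : l ∈ lineKeys p) :
    (linePts l).card = p := by
  have hu : (univ : Finset (ZMod p)).card = p := by rw [card_univ, ZMod.card]
  rw [mem_lineKeys] at hl
  refine Eq.trans ?_ hu
  rcases hl with h | ⟨h, h'⟩
  · refine card_nbij' Prod.snd (fun t => (l.2 - l.1.2 * t, t)) (fun _ _ => mem_univ _) ?_ ?_ ?_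
    · intro t _
      simp [mem_linePts, h]
    · intro x hx
      have := mem_linePts.1 hx
      refine Prod.ext ?_ rfl
      simp only
      rw [h] at this
      linear_combination -this
    · intro t _
      rfl
  · refine card_nbij' Prod.fst (fun t => (t, l.2)) (fun _ _ => mem_univ _) ?_ ?_ ?_
    · intro t _
      simp [mem_linePts, h, h']
    · intro x hx
      have := mem_linePts.1 hx
      refine Prod.ext rfl ?_
      simp only
      rw [h, h'] at this
      linear_combination -this
    · intro t _
      rfl

theorem card_lineKeys_le : (lineKeys p).card ≤ 2 * p ^ 2 := by
  have h : lineKeys p ⊆ (univ : Finset (ZMod p × ZMod p)).image (fun q => ((1, q.1), q.2)) ∪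
      (univ : Finset (ZMod p)).image (fun t => ((0, 1), t)) := by
    rintro ⟨⟨a, b⟩, g⟩ hl
    rcases mem_lineKeys.1 hl with h | ⟨h, h'⟩
    · refine mem_union_left _ (mem_image.2 ⟨(b, g), mem_univ _, ?_⟩)
      simp_all
    · refine mem_union_right _ (mem_image.2 ⟨g, mem_univ _, ?_⟩)
      simp_all
  have h1 := (card_le_card h).trans (card_union_le _ _)
  have h2 := card_image_le (s := (univ : Finset (ZMod p × ZMod p)))
    (f := fun q : ZMod p × ZMod p => (((1 : ZMod p), q.1), q.2))
  have h3 := card_image_le (s := (univ : Finset (ZMod p)))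
    (f := fun t : ZMod p => (((0 : ZMod p), (1 : ZMod p)), t))
  rw [card_univ, Fintype.card_prod, ZMod.card] at h2
  rw [card_univ, ZMod.card] at h3
  have : p ≤ p ^ 2 := Nat.le_self_pow (by norm_num) p
  rw [← sq] at h2
  omega

theorem card_inter_linePts_le {l l' : (ZMod p × ZMod p) × ZMod p} (hl : l ∈ lineKeys p)
    (hl' : l' ∈ lineKeys p) (hne : l ≠ l') : (linePts l ∩ linePts l').card ≤ 1 := by
  refine card_le_one.2 fun x hx y hy => ?_
  by_contra hxy
  obtain ⟨h1, h2⟩ := mem_inter.1 hx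
  obtain ⟨h3, h4⟩ := mem_inter.1 hy
  exact hne (eq_of_mem_linePts hl hl' hxy h1 h3 h2 h4)

/-- Double counting of incidences. -/
theorem sum_card_inter_linePts (E : Finset (ZMod p × ZMod p))
    (L : Finset ((ZMod p × ZMod p) × ZMod p)) :
    ∑ l ∈ L, (E ∩ linePts l).card = ∑ x ∈ E, (L.filter fun l => x ∈ linePts l).card := by
  simp only [← filter_mem_eq_inter, card_filter]
  exact sum_comm

theorem sum_sq_card_filter_linePts (E : Finset (ZMod p × ZMod p))
    (L : Finset ((ZMod p × ZMod p) × ZMod p)) (hL : L ⊆ lineKeys p) :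
    ∑ x ∈ E, (L.filter fun l => x ∈ linePts l).card ^ 2 ≤
      ∑ l ∈ L, (E ∩ linePts l).card + L.card ^ 2 := by
  have h1 : ∑ x ∈ E, (L.filter fun l => x ∈ linePts l).card ^ 2 =
      ∑ q ∈ L ×ˢ L, (E ∩ (linePts q.1 ∩ linePts q.2)).card := by
    have h2 : ∀ x, (L.filter fun l => x ∈ linePts l).card ^ 2 =
        ((L ×ˢ L).filter fun q => x ∈ linePts q.1 ∩ linePts q.2).card := by
      intro x
      rw [sq, ← card_product, ← filter_product]
      simp only [mem_inter]
    rw [sum_congr rfl fun x _ => h2 x]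
    simp only [← filter_mem_eq_inter (s := E), card_filter]
    exact sum_comm
  rw [h1, ← diag_union_offDiag, sum_union (disjoint_diag_offDiag L), sum_diag]
  simp only [inter_self]
  refine Nat.add_le_add_left ?_ _
  refine (sum_le_card_nsmul _ _ 1 fun q hq => ?_).trans ?_
  · obtain ⟨h1, h2, h3⟩ := mem_offDiag.1 hq
    exact (card_le_card inter_subset_right).trans (card_inter_linePts_le (hL h1) (hL h2) h3)
  · rw [smul_eq_mul, mul_one, offDiag_card, sq]
    exact Nat.sub_le _ _

theorem card_mul_le_sum (E : Finset (ZMod p × ZMod p)) (L : Finset ((ZMod p × ZMod p) × ZMod p))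
    (k : ℕ) (hk : L ⊆ richLines E k) : L.card * k ≤ ∑ l ∈ L, (E ∩ linePts l).card := by
  rw [← smul_eq_mul]
  exact card_nsmul_le_sum _ _ _ fun l hl => (mem_filter.1 (hk hl)).2

theorem card_richLines_mul_le_sq (E : Finset (ZMod p × ZMod p)) (k : ℕ) :
    (richLines E k).card * (k * (k - 1)) ≤ E.card ^ 2 := by
  have h1 : (richLines E k).card * (k * (k - 1)) ≤
      ∑ l ∈ richLines E k, (E ∩ linePts l).offDiag.card := by
    rw [← smul_eq_mul]
    refine card_nsmul_le_sum _ _ _ fun l hl => ?_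
    have := (mem_filter.1 hl).2
    rw [offDiag_card, ← Nat.mul_sub_one]
    exact Nat.mul_le_mul this (Nat.sub_le_sub_right this 1)
  refine h1.trans ?_
  rw [← card_sigma, sq, ← card_product]
  refine card_le_card_of_injOn Sigma.snd ?_ ?_
  · rintro ⟨l, q⟩ hq
    obtain ⟨h1, h2, -⟩ := mem_offDiag.1 (mem_sigma.1 hq).2
    exact mem_product.2 ⟨(mem_inter.1 h1).1, (mem_inter.1 h2).1⟩
  · rintro ⟨l, q⟩ hq ⟨l', q'⟩ hq' (rfl : q = q')
    obtain ⟨hl, hq⟩ := mem_sigma.1 hq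
    obtain ⟨hl', hq'⟩ := mem_sigma.1 hq'
    obtain ⟨h1, h2, h3⟩ := mem_offDiag.1 hq
    obtain ⟨h1', h2', -⟩ := mem_offDiag.1 hq'
    have := eq_of_mem_linePts (mem_filter.1 hl).1 (mem_filter.1 hl').1 h3 (mem_inter.1 h1).2
      (mem_inter.1 h2).2 (mem_inter.1 h1').2 (mem_inter.1 h2').2
    simp only at this
    rw [this]

theorem card_lines_through_mul_le (E : Finset (ZMod p × ZMod p)) (k : ℕ)
    (L : Finset ((ZMod p × ZMod p) × ZMod p)) (hL : L ⊆ richLines E k) (x : ZMod p × ZMod p) :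
    (L.filter fun l => x ∈ linePts l).card * (k - 1) ≤ E.card := by
  have h1 : (L.filter fun l => x ∈ linePts l).card * (k - 1) ≤
      ∑ l ∈ L.filter fun l => x ∈ linePts l, ((E ∩ linePts l).erase x).card := by
    rw [← smul_eq_mul]
    refine card_nsmul_le_sum _ _ _ fun l hl => ?_
    have h1 := (mem_filter.1 (hL (mem_filter.1 hl).1)).2
    have := pred_card_le_card_erase (s := E ∩ linePts l) (a := x)
    omega
  refine h1.trans ?_
  rw [← card_sigma]
  refine card_le_card_of_injOn Sigma.snd ?_ ?_
  · rintro ⟨l, q⟩ hq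
    exact (mem_inter.1 (mem_erase.1 (mem_sigma.1 hq).2).2).1
  · rintro ⟨l, q⟩ hq ⟨l', q'⟩ hq' (rfl : q = q')
    obtain ⟨hl, hq⟩ := mem_sigma.1 hq
    obtain ⟨hl', hq'⟩ := mem_sigma.1 hq'
    obtain ⟨h1, h2⟩ := mem_erase.1 hq
    obtain ⟨-, h2'⟩ := mem_erase.1 hq'
    have := eq_of_mem_linePts (mem_filter.1 (hL (mem_filter.1 hl).1)).1
      (mem_filter.1 (hL (mem_filter.1 hl').1)).1 h1 (mem_inter.1 h2).2
      (mem_filter.1 hl).2 (mem_inter.1 h2').2 (mem_filter.1 hl').2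
    simp only at this
    rw [this]

theorem card_richLines_mul_le (E : Finset (ZMod p × ZMod p)) (k : ℕ)
    (hk : 2 * E.card < k ^ 2) : (richLines E k).card * k ≤ 2 * E.card := by
  set L := richLines E k
  set I := ∑ l ∈ L, (E ∩ linePts l).card with hI
  have h1 : L.card * k ≤ I := card_mul_le_sum E L k Subset.rfl
  have h2 : I ^ 2 ≤ E.card * (I + L.card ^ 2) := by
    refine le_trans ?_ (Nat.mul_le_mul_left _
      (sum_sq_card_filter_linePts E L (filter_subset _ _)))
    rw [hI, sum_card_inter_linePts]
    exact sq_sum_le_card_mul_sum_sq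
  by_contra! h
  have h3 : 2 * E.card < I := h.trans_le h1
  have h4 : L.card ^ 2 * k ^ 2 ≤ I ^ 2 := by rw [← mul_pow]; exact Nat.pow_le_pow_left h1 2
  have h5 : 0 < L.card := Nat.pos_of_ne_zero fun h0 => by simp [h0] at h
  have h6 : 0 < L.card ^ 2 := by positivity
  nlinarith

theorem card_richLines_mul_sq_le (E : Finset (ZMod p × ZMod p)) (k : ℕ)
    (hk : 2 * E.card ≤ k * p) : (richLines E k).card * k ^ 2 ≤ 4 * p * E.card := by
  set L := richLines E k
  have hLk : L ⊆ lineKeys p := filter_subset _ _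
  have hp : 0 < p := (Fact.out : p.Prime).pos
  have h1 : L.card * k ≤ ∑ x ∈ E, (L.filter fun l => x ∈ linePts l).card := by
    rw [← sum_card_inter_linePts]
    exact card_mul_le_sum E L k Subset.rfl
  have h2 : ∑ x : ZMod p × ZMod p, (L.filter fun l => x ∈ linePts l).card = L.card * p := by
    rw [← sum_card_inter_linePts]
    simp only [univ_inter]
    rw [sum_congr rfl fun l hl => card_linePts (hLk hl), sum_const, smul_eq_mul]
  have h3 : ∑ x : ZMod p × ZMod p, (L.filter fun l => x ∈ linePts l).card ^ 2 ≤
      L.card * p + L.card ^ 2 := by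
    have := sum_sq_card_filter_linePts univ L hLk
    rwa [sum_card_inter_linePts, h2] at this
  rcases Nat.eq_zero_or_pos L.card with h0 | h0
  · rw [h0]; simp
  have h1' : (L.card : ℝ) * k ≤ ∑ x ∈ E, ((L.filter fun l => x ∈ linePts l).card : ℝ) := by
    exact_mod_cast h1
  have h2' : ∑ x : ZMod p × ZMod p, ((L.filter fun l => x ∈ linePts l).card : ℝ) =
    L.card * p := by exact_mod_cast h2
  have h3' : ∑ x : ZMod p × ZMod p, ((L.filter fun l => x ∈ linePts l).card : ℝ) ^ 2 ≤
      L.card * p + L.card ^ 2 := by exact_mod_cast h3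
  set r : ZMod p × ZMod p → ℝ := fun x => ((L.filter fun l => x ∈ linePts l).card : ℝ)
  set a : ℝ := L.card / p with ha
  have hp' : (0 : ℝ) < p := by exact_mod_cast hp
  have hap : a * p = L.card := by rw [ha]; field_simp
  have hL0 : (0 : ℝ) < L.card := by exact_mod_cast h0
  have h4 : ∑ x : ZMod p × ZMod p, (r x - a) ^ 2 ≤ L.card * p := by
    have : ∑ x : ZMod p × ZMod p, (r x - a) ^ 2 =
        ∑ x, r x ^ 2 - 2 * a * ∑ x, r x + p * p * a ^ 2 := by
      simp only [sub_sq, sum_add_distrib, sum_sub_distrib, sum_const, card_univ,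
        Fintype.card_prod, ZMod.card, nsmul_eq_mul, Nat.cast_mul, mul_sum]
      congr 2
      exact sum_congr rfl fun x _ => by ring
    rw [this, h2']
    have : p * p * a ^ 2 = (L.card : ℝ) ^ 2 := by rw [← hap]; ring
    have h' : 2 * a * (L.card * p) = 2 * (L.card : ℝ) ^ 2 := by
      linear_combination 2 * (L.card : ℝ) * hap
    linarith
  have h5 : (∑ x ∈ E, (r x - a)) ^ 2 ≤ E.card * (L.card * p) :=
    sq_sum_le_card_mul_sum_sq.trans (mul_le_mul_of_nonneg_left
      ((sum_le_univ_sum_of_nonneg fun x => sq_nonneg _).trans h4) (Nat.cast_nonneg _))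
  have h6 : (L.card : ℝ) * k ≤ 2 * ∑ x ∈ E, (r x - a) := by
    rw [sum_sub_distrib, sum_const, nsmul_eq_mul]
    have : (E.card : ℝ) * a * 2 ≤ L.card * k := by
      rw [ha, mul_div_assoc', div_mul_eq_mul_div, div_le_iff₀ hp']
      have hk' : (2 : ℝ) * E.card ≤ k * p := by exact_mod_cast hk
      nlinarith
    linarith
  have h7 : ((L.card : ℝ) * k) ^ 2 ≤ 4 * (E.card * (L.card * p)) := by
    have : (0 : ℝ) ≤ L.card * k := by positivity
    nlinarith
  have h8 : (L.card : ℝ) * k ^ 2 ≤ 4 * p * E.card := by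
    refine le_of_mul_le_mul_left ?_ hL0
    linarith
  exact_mod_cast h8

end Lines

section Flags

variable {p : ℕ} [Fact p.Prime]

theorem sq_add_sq_ne_zero (hp : p % 4 = 3) {x y : ZMod p} (h : ¬(x = 0 ∧ y = 0)) :
    x ^ 2 + y ^ 2 ≠ 0 := by
  intro h0
  by_cases hy : y = 0
  · rw [hy] at h0
    exact h ⟨by simpa using h0, hy⟩
  · have : IsSquare (-1 : ZMod p) := ⟨x / y, by field_simp; linear_combination -h0⟩
    exact (ZMod.exists_sq_eq_neg_one_iff.1 this) hp

/-- Flags `(x, l)` of a line set whose point is joined to both `q₁` and `q₂` by lines of the set,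
in general position with respect to `q₁` and `q₂`. -/
def joinedFlags (E : Finset (ZMod p × ZMod p)) (L : Finset ((ZMod p × ZMod p) × ZMod p))
    (q₁ q₂ : ZMod p × ZMod p) : Finset ((ZMod p × ZMod p) × ((ZMod p × ZMod p) × ZMod p)) :=
  (E ×ˢ L).filter fun f => f.1 ∈ linePts f.2 ∧ q₁ ∉ linePts f.2 ∧ q₂ ∉ linePts f.2 ∧
    (∃ l ∈ L, q₁ ∈ linePts l ∧ f.1 ∈ linePts l ∧ q₂ ∉ linePts l) ∧
    (∃ l ∈ L, q₂ ∈ linePts l ∧ f.1 ∈ linePts l ∧ q₁ ∉ linePts l)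

/-- The slope and intercept of a line in the coordinates for which the pencils of lines through
`0` and `w` become the two families of coordinate lines; here `g` is the value of the
equation of the line at `0`, up to sign. -/
def pencilMap (w : ZMod p × ZMod p) (ν : ZMod p × ZMod p) (g : ZMod p) : ZMod p × ZMod p :=
  ((g - (ν.1 * w.1 + ν.2 * w.2)) / g, -(ν.2 * w.1 - ν.1 * w.2) / g)

theorem pencilMap_injective {w ν ν' : ZMod p × ZMod p} {g g' : ZMod p}
    (hw : w.1 ^ 2 + w.2 ^ 2 ≠ 0) (hg : g ≠ 0) (hg' : g' ≠ 0)
    (hν : ν.1 = 1 ∨ ν.1 = 0 ∧ ν.2 = 1) (hν' : ν'.1 = 1 ∨ ν'.1 = 0 ∧ ν'.2 = 1)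
    (h : pencilMap w ν g = pencilMap w ν' g') : ν = ν' ∧ g = g' := by
  obtain ⟨h1, h2⟩ := Prod.mk.inj h
  rw [div_eq_div_iff hg hg'] at h1 h2
  have e1 : ν.1 * g' = ν'.1 * g := by
    refine mul_left_cancel₀ hw ?_
    linear_combination -w.1 * h1 + w.2 * h2
  have e2 : ν.2 * g' = ν'.2 * g := by
    refine mul_left_cancel₀ hw ?_
    linear_combination -w.2 * h1 - w.1 * h2
  have hgg : g = g' := by
    rcases hν with h | ⟨h, h'⟩ <;> rcases hν' with h'' | ⟨h'', h'''⟩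
    · rw [h, h''] at e1
      linear_combination -e1
    · rw [h, h''] at e1
      exact absurd (by linear_combination e1) hg'
    · rw [h, h''] at e1
      exact absurd (by linear_combination -e1) hg
    · rw [h', h'''] at e2
      linear_combination -e2
  rw [hgg] at e1 e2
  exact ⟨Prod.ext (mul_right_cancel₀ hg' e1) (mul_right_cancel₀ hg' e2), hgg⟩

set_option maxHeartbeats 400000 in
open Classical in
theorem sq_card_joinedFlags_le (hp : p % 4 = 3) (E : Finset (ZMod p × ZMod p))
    (L : Finset ((ZMod p × ZMod p) × ZMod p)) (hL : L ⊆ lineKeys p) (μ : ℕ)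
    (hμ : ∀ x ∈ E, (L.filter fun l => x ∈ linePts l).card ≤ μ)
    (hp1 : 512 * (μ * L.card) ≤ p ^ 2) (hp2 : L.card ^ 3 * μ ≤ p ^ 4)
    {q₁ q₂ : ZMod p × ZMod p} (hq : q₁ ≠ q₂) (hq₁ : q₁ ∈ E) :
    ((joinedFlags E L q₁ q₂).card : ℝ) ^ 2 ≤
      100000 * ((L.filter fun l => q₂ ∈ linePts l).card : ℝ) *
        (((L.filter fun l => q₁ ∈ linePts l).card * L.card : ℕ) *
          (√((L.filter fun l => q₁ ∈ linePts l).card * L.card : ℕ) + μ)) := by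
  set r₁ := (L.filter fun l => q₁ ∈ linePts l).card
  set r₂ := (L.filter fun l => q₂ ∈ linePts l).card
  obtain ⟨w, hwdef⟩ : ∃ w : ZMod p × ZMod p, w = (q₂.1 - q₁.1, q₂.2 - q₁.2) := ⟨_, rfl⟩
  have hw1 : q₂.1 = q₁.1 + w.1 := by rw [hwdef]; ring
  have hw2 : q₂.2 = q₁.2 + w.2 := by rw [hwdef]; ring
  have hw : w.1 ^ 2 + w.2 ^ 2 ≠ 0 := by
    refine sq_add_sq_ne_zero hp fun h => hq (Prod.ext ?_ ?_)
    · rw [hw1, h.1, add_zero]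
    · rw [hw2, h.2, add_zero]
  set ψ : (ZMod p × ZMod p) × ZMod p → ZMod p × ZMod p := fun l =>
    pencilMap w l.1 (l.2 - (l.1.1 * q₁.1 + l.1.2 * q₁.2)) with hψ
  set α : ZMod p × ZMod p → ZMod p := fun x => (x.1 - q₁.1) * w.1 + (x.2 - q₁.2) * w.2 with hα
  set β : ZMod p × ZMod p → ZMod p := fun x => (x.2 - q₁.2) * w.1 - (x.1 - q₁.1) * w.2 with hβ
  set κ : (ZMod p × ZMod p) × ZMod p → ZMod p := fun l =>
    -(l.1.2 * w.1 - l.1.1 * w.2) / (l.1.1 * w.1 + l.1.2 * w.2) with hκ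
  set A := (L.filter fun l => q₁ ∈ linePts l).image κ with hA
  set B := (L.filter fun l => q₂ ∈ linePts l).image κ with hB
  set L' := L.filter fun l => q₁ ∉ linePts l ∧ q₂ ∉ linePts l with hL'
  have hgood : ∀ l ∈ L', l.2 - (l.1.1 * q₁.1 + l.1.2 * q₁.2) ≠ 0 ∧
      l.2 - (l.1.1 * q₁.1 + l.1.2 * q₁.2) - (l.1.1 * w.1 + l.1.2 * w.2) ≠ 0 := by
    intro l hl
    obtain ⟨-, h1, h2⟩ := mem_filter.1 hl
    rw [mem_linePts] at h1 h2
    refine ⟨fun h => h1 (by linear_combination -h), fun h => h2 ?_⟩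
    rw [hw1, hw2]
    linear_combination -h
  have hψinj : Set.InjOn ψ L' := by
    intro l hl l' hl' h
    have h1 := mem_lineKeys.1 (hL (mem_filter.1 hl).1)
    have h2 := mem_lineKeys.1 (hL (mem_filter.1 hl').1)
    obtain ⟨e1, e2⟩ := pencilMap_injective hw (hgood l hl).1 (hgood l' hl').1 h1 h2 h
    refine Prod.ext e1 ?_
    rw [e1] at e2
    linear_combination e2
  have hflag : ∀ f ∈ joinedFlags E L q₁ q₂, f.1 ∈ E ∧ f.2 ∈ L' ∧ f.1 ∈ linePts f.2 ∧
      β f.1 ≠ 0 ∧ α f.1 / β f.1 ∈ A ∧ (α f.1 - (w.1 ^ 2 + w.2 ^ 2)) / β f.1 ∈ B ∧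
      (ψ f.2).1 * (α f.1 / β f.1) + (ψ f.2).2 = (α f.1 - (w.1 ^ 2 + w.2 ^ 2)) / β f.1 := by
    rintro ⟨x, l⟩ hf
    obtain ⟨hf0, hxl, hl1, hl2, ⟨l₁, hl₁, ha1, ha2, ha3⟩, l₂, hl₂, hb1, hb2, hb3⟩ :=
      mem_filter.1 hf
    obtain ⟨hxE, hlL⟩ := mem_product.1 hf0
    have hlL' : l ∈ L' := mem_filter.2 ⟨hlL, hl1, hl2⟩
    have hg := hgood l hlL'
    rw [mem_linePts] at hxl ha1 ha2 ha3 hb1 hb2 hb3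
    simp only at hxl ha2 hb2 ⊢
    have hν₁ : l₁.1.1 * w.1 + l₁.1.2 * w.2 ≠ 0 := fun h => ha3 (by
      rw [hw1, hw2]; linear_combination ha1 + h)
    have hν₂ : l₂.1.1 * w.1 + l₂.1.2 * w.2 ≠ 0 := fun h => hb3 (by
      rw [hw1, hw2] at hb1; linear_combination hb1 - h)
    have k0 : α x * (l.1.1 * w.1 + l.1.2 * w.2) + β x * (l.1.2 * w.1 - l.1.1 * w.2) =
        (l.2 - (l.1.1 * q₁.1 + l.1.2 * q₁.2)) * (w.1 ^ 2 + w.2 ^ 2) := by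
      simp only [hα, hβ]
      linear_combination (w.1 ^ 2 + w.2 ^ 2) * hxl
    have k1 : α x * (l₁.1.1 * w.1 + l₁.1.2 * w.2) + β x * (l₁.1.2 * w.1 - l₁.1.1 * w.2) = 0 := by
      simp only [hα, hβ]
      linear_combination (w.1 ^ 2 + w.2 ^ 2) * (ha2 - ha1)
    have k2 : (α x - (w.1 ^ 2 + w.2 ^ 2)) * (l₂.1.1 * w.1 + l₂.1.2 * w.2)
        + β x * (l₂.1.2 * w.1 - l₂.1.1 * w.2) = 0 := by
      simp only [hα, hβ]
      rw [hw1, hw2] at hb1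
      linear_combination (w.1 ^ 2 + w.2 ^ 2) * (hb2 - hb1)
    have hβ0 : β x ≠ 0 := by
      intro h
      rw [h, zero_mul, add_zero] at k1 k0
      rw [(mul_eq_zero.1 k1).resolve_right hν₁, zero_mul] at k0
      exact mul_ne_zero hg.1 hw k0.symm
    refine ⟨hxE, hlL', mem_linePts.2 hxl, hβ0, ?_, ?_, ?_⟩
    · refine mem_image.2 ⟨l₁, mem_filter.2 ⟨hl₁, mem_linePts.2 ha1⟩, ?_⟩
      simp only [hκ]
      rw [div_eq_div_iff hν₁ hβ0]
      linear_combination -k1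
    · refine mem_image.2 ⟨l₂, mem_filter.2 ⟨hl₂, mem_linePts.2 hb1⟩, ?_⟩
      simp only [hκ]
      rw [div_eq_div_iff hν₂ hβ0]
      linear_combination -k2
    · simp only [hψ, pencilMap]
      have hg1 := hg.1
      generalize l.2 - (l.1.1 * q₁.1 + l.1.2 * q₁.2) = g at hg1 k0
      field_simp
      linear_combination -k0
  have hxinj : ∀ x x' : ZMod p × ZMod p, β x ≠ 0 → β x' ≠ 0 → α x / β x = α x' / β x' →
      (α x - (w.1 ^ 2 + w.2 ^ 2)) / β x = (α x' - (w.1 ^ 2 + w.2 ^ 2)) / β x' → x = x' := by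
    intro x x' h h' e1 e2
    rw [div_eq_div_iff h h'] at e1 e2
    have e3 : β x = β x' := mul_left_cancel₀ hw (by linear_combination e2 - e1)
    have e4 : α x = α x' := by
      rw [e3] at e1
      exact mul_right_cancel₀ h' e1
    simp only [hα, hβ] at e3 e4
    refine Prod.ext (mul_left_cancel₀ hw ?_) (mul_left_cancel₀ hw ?_)
    · linear_combination w.1 * e4 - w.2 * e3
    · linear_combination w.2 * e4 + w.1 * e3
  set Ψ : (ZMod p × ZMod p) × ((ZMod p × ZMod p) × ZMod p) → (ZMod p × ZMod p) × ZMod p :=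
    fun f => (ψ f.2, α f.1 / β f.1) with hΨ
  have hΨinj : Set.InjOn Ψ (joinedFlags E L q₁ q₂) := by
    intro f hf f' hf' h
    obtain ⟨-, b2, -, b4, -, -, b7⟩ := hflag f hf
    obtain ⟨-, c2, -, c4, -, -, c7⟩ := hflag f' hf'
    obtain ⟨h1, h2⟩ := Prod.mk.inj h
    refine Prod.ext (hxinj _ _ b4 c4 h2 ?_) (hψinj b2 c2 h1)
    rw [← b7, ← c7, h1, h2]
  have hAr : A.card ≤ r₁ := card_image_le
  have hLr : (L'.image ψ).card ≤ L.card := card_image_le.trans (card_le_card (filter_subset _ _))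
  have hAμ : A.card ≤ μ := hAr.trans (hμ q₁ hq₁)
  have hmain := sq_card_affine_incidences_le (L'.image ψ) A B ((joinedFlags E L q₁ q₂).image Ψ)
    (by
      intro φ hφ
      obtain ⟨f, hf, rfl⟩ := mem_image.1 hφ
      obtain ⟨-, b2, -, -, b5, -, -⟩ := hflag f hf
      exact mem_product.2 ⟨mem_image_of_mem _ b2, b5⟩)
    (by
      intro φ hφ
      obtain ⟨l, hl, rfl⟩ := mem_image.1 hφ
      exact div_ne_zero (hgood l hl).2 (hgood l hl).1)
    (by
      intro φ hφ
      obtain ⟨f, hf, rfl⟩ := mem_image.1 hφ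
      obtain ⟨-, -, -, -, -, b6, b7⟩ := hflag f hf
      simp only [hΨ]
      rwa [b7])
    μ
    (by
      intro a y
      rcases (((joinedFlags E L q₁ q₂).image Ψ).filter fun φ => φ.2 = a ∧
        φ.1.1 * φ.2 + φ.1.2 = y).eq_empty_or_nonempty with h | ⟨φ₀, hφ₀⟩
      · rw [h]; simp
      obtain ⟨h0, h1, h2⟩ := mem_filter.1 hφ₀
      obtain ⟨f₀, hf₀, rfl⟩ := mem_image.1 h0
      obtain ⟨b1, b2, b3, b4, b5, b6, b7⟩ := hflag f₀ hf₀
      refine le_trans ?_ (hμ f₀.1 b1)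
      refine (card_le_card ?_).trans (card_image_le (f := fun l => (ψ l, a)))
      intro φ hφ
      obtain ⟨h0', h1', h2'⟩ := mem_filter.1 hφ
      obtain ⟨f, hf, rfl⟩ := mem_image.1 h0'
      obtain ⟨c1, c2, c3, c4, c5, c6, c7⟩ := hflag f hf
      simp only [hΨ] at h1 h1' h2 h2'
      rw [b7] at h2
      rw [c7] at h2'
      have : f.1 = f₀.1 := hxinj _ _ c4 b4 (h1'.trans h1.symm) (h2'.trans h2.symm)
      refine mem_image.2 ⟨f.2, mem_filter.2 ⟨(mem_filter.1 c2).1, this ▸ c3⟩, ?_⟩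
      simp only [hΨ]
      rw [h1'])
    hAμ
    ((Nat.mul_le_mul_left _ (Nat.mul_le_mul hAμ hLr)).trans hp1)
    (by
      refine le_trans ?_ hp2
      calc _ ≤ L.card ^ 2 * (μ * L.card) :=
            Nat.mul_le_mul (Nat.pow_le_pow_left hLr 2) (Nat.mul_le_mul hAμ hLr)
        _ = _ := by ring)
  rw [card_image_of_injOn hΨinj] at hmain
  have hBr : (B.card : ℝ) ≤ r₂ := by exact_mod_cast card_image_le
  have hn : ((A.card * (L'.image ψ).card : ℕ) : ℝ) ≤ (r₁ * L.card : ℕ) := by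
    exact_mod_cast Nat.mul_le_mul hAr hLr
  refine hmain.trans ?_
  exact mul_le_mul (mul_le_mul_of_nonneg_left hBr (by norm_num))
    (mul_le_mul hn (add_le_add_left (Real.sqrt_le_sqrt hn) _)
      (add_nonneg (Real.sqrt_nonneg _) (Nat.cast_nonneg _)) (Nat.cast_nonneg _))
    (mul_nonneg (Nat.cast_nonneg _) (add_nonneg (Real.sqrt_nonneg _) (Nat.cast_nonneg _)))
    (mul_nonneg (by norm_num) (Nat.cast_nonneg _))

end Flags

section FlagCount

variable {p : ℕ} [Fact p.Prime]

open Classical in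
theorem card_joining_pairs_ge (E : Finset (ZMod p × ZMod p))
    (L : Finset ((ZMod p × ZMod p) × ZMod p)) (k : ℕ) (hL : L ⊆ richLines E k)
    {x : ZMod p × ZMod p} {l : (ZMod p × ZMod p) × ZMod p} (hx : x ∈ E) (hl : l ∈ L)
    (hxl : x ∈ linePts l) :
    ((L.filter fun l => x ∈ linePts l).card - 1) * ((L.filter fun l => x ∈ linePts l).card - 2) *
      (k - 1) ^ 2 ≤ (E.offDiag.filter fun q => (x, l) ∈ joinedFlags E L q.1 q.2).card := by
  set Lx := L.filter fun l => x ∈ linePts l with hLx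
  set P : (ZMod p × ZMod p) × ZMod p → Finset (ZMod p × ZMod p) := fun m =>
    (E ∩ linePts m).erase x with hP
  have hPk : ∀ m ∈ L, k - 1 ≤ (P m).card := by
    intro m hm
    have h1 := (mem_filter.1 (hL hm)).2
    exact (Nat.sub_le_sub_right h1 1).trans pred_card_le_card_erase
  have key : ∀ m ∈ L, ∀ m' ∈ L, m ≠ m' → x ∈ linePts m → x ∈ linePts m' → ∀ q ∈ P m,
      q ∉ linePts m' := by
    intro m hm m' hm' hne h h' q hq hq'
    obtain ⟨h1, h2⟩ := mem_erase.1 hq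
    exact hne (eq_of_mem_linePts (mem_filter.1 (hL hm)).1 (mem_filter.1 (hL hm')).1 h1
      (mem_inter.1 h2).2 h hq' h')
  have hcard : (Lx.card - 1) * (Lx.card - 2) * (k - 1) ^ 2 ≤
      ((Lx.erase l).offDiag.sigma fun m => P m.1 ×ˢ P m.2).card := by
    rw [card_sigma]
    have h1 : (Lx.erase l).offDiag.card = (Lx.card - 1) * (Lx.card - 2) := by
      rw [offDiag_card, card_erase_of_mem (mem_filter.2 ⟨hl, hxl⟩), ← Nat.mul_sub_one,
        Nat.sub_sub]
    rw [← h1, ← smul_eq_mul]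
    refine card_nsmul_le_sum _ _ _ fun m hm => ?_
    obtain ⟨h2, h3, -⟩ := mem_offDiag.1 hm
    rw [card_product, sq]
    exact Nat.mul_le_mul (hPk _ (mem_filter.1 (mem_erase.1 h2).2).1)
      (hPk _ (mem_filter.1 (mem_erase.1 h3).2).1)
  refine hcard.trans (card_le_card_of_injOn Sigma.snd ?_ ?_)
  · rintro ⟨⟨m, m'⟩, q, q'⟩ hs
    obtain ⟨hm, hq⟩ := mem_sigma.1 hs
    obtain ⟨h1, h2, h3⟩ := mem_offDiag.1 hm
    obtain ⟨hq1, hq2⟩ := mem_product.1 hq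
    simp only at h1 h2 h3 hq1 hq2
    obtain ⟨hml, hmx⟩ := mem_erase.1 h1
    obtain ⟨hml', hmx'⟩ := mem_erase.1 h2
    obtain ⟨hmL, hmx⟩ := mem_filter.1 hmx
    obtain ⟨hmL', hmx'⟩ := mem_filter.1 hmx'
    have hqm := mem_inter.1 (mem_erase.1 hq1).2
    have hqm' := mem_inter.1 (mem_erase.1 hq2).2
    refine mem_filter.2 ⟨mem_offDiag.2 ⟨hqm.1, hqm'.1, ?_⟩, mem_filter.2
      ⟨mem_product.2 ⟨hx, hl⟩, hxl, key m hmL l hl hml hmx hxl q hq1,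
      key m' hmL' l hl hml' hmx' hxl q' hq2,
      ⟨m, hmL, hqm.2, hmx, key m' hmL' m hmL h3.symm hmx' hmx q' hq2⟩,
      ⟨m', hmL', hqm'.2, hmx', key m hmL m' hmL' h3 hmx hmx' q hq1⟩⟩⟩
    intro h
    exact key m hmL m' hmL' h3 hmx hmx' q hq1 ((show q = q' from h) ▸ hqm'.2)
  · rintro ⟨⟨m, m'⟩, q⟩ hs ⟨⟨n, n'⟩, q'⟩ hs' (rfl : q = q')
    obtain ⟨hm, hq⟩ := mem_sigma.1 hs
    obtain ⟨h1, h2, -⟩ := mem_offDiag.1 hm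
    obtain ⟨hn, hq'⟩ := mem_sigma.1 hs'
    obtain ⟨h1', h2', -⟩ := mem_offDiag.1 hn
    simp only [mem_product] at h1 h2 h1' h2' hq hq'
    have hLm := fun {m} (h : m ∈ Lx.erase l) => mem_filter.1 (mem_erase.1 h).2
    have e1 : m = n := by
      by_contra hne
      exact key m (hLm h1).1 n (hLm h1').1 hne (hLm h1).2 (hLm h1').2 q.1 hq.1
        (mem_inter.1 (mem_erase.1 hq'.1).2).2
    have e2 : m' = n' := by
      by_contra hne
      exact key m' (hLm h2).1 n' (hLm h2').1 hne (hLm h2).2 (hLm h2').2 q.2 hq.2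
        (mem_inter.1 (mem_erase.1 hq'.2).2).2
    rw [e1, e2]

open Classical in
theorem sum_le_sum_card_joinedFlags (E : Finset (ZMod p × ZMod p))
    (L : Finset ((ZMod p × ZMod p) × ZMod p)) (k : ℕ) (hL : L ⊆ richLines E k) :
    ∑ x ∈ E, (L.filter fun l => x ∈ linePts l).card *
      (((L.filter fun l => x ∈ linePts l).card - 1) *
        ((L.filter fun l => x ∈ linePts l).card - 2) * (k - 1) ^ 2) ≤
      ∑ q ∈ E.offDiag, (joinedFlags E L q.1 q.2).card := by
  have h1 : ∑ q ∈ E.offDiag, (joinedFlags E L q.1 q.2).card =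
      ∑ f ∈ E ×ˢ L, (E.offDiag.filter fun q => f ∈ joinedFlags E L q.1 q.2).card := by
    simp only [card_filter]
    rw [sum_comm]
    refine sum_congr rfl fun q _ => ?_
    rw [← card_filter, filter_mem_eq_inter,
      inter_eq_right.2 (show joinedFlags E L q.1 q.2 ⊆ E ×ˢ L from filter_subset _ _)]
  rw [h1, sum_product]
  refine sum_le_sum fun x hx => ?_
  refine le_trans ?_ (sum_le_sum_of_subset (filter_subset (fun l => x ∈ linePts l) L))
  rw [← smul_eq_mul]
  exact card_nsmul_le_sum _ _ _ fun l hl =>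
    card_joining_pairs_ge E L k hL hx (mem_filter.1 hl).1 (mem_filter.1 hl).2

end FlagCount

section RichLines

theorem le_linearised_flag_bound {f r₁ r₂ Λ μ R W : ℝ} (hr₁ : 0 ≤ r₁) (hr₂ : 0 ≤ r₂)
    (hΛ : 0 ≤ Λ) (hR : 0 < R) (hW : 0 ≤ W)
    (hW4 : W ^ 4 = 2 * 10 ^ 10 * (R ^ 4 * Λ ^ 2 * (R * Λ + μ ^ 2)))
    (h : f ^ 2 ≤ 100000 * r₂ * (r₁ * Λ * (√(r₁ * Λ) + μ))) :
    f ≤ (1 + r₁ / R) * (1 + r₂ / R) * W := by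
  obtain ⟨s₁, hs₁⟩ : ∃ s, s = 1 + r₁ / R := ⟨_, rfl⟩
  obtain ⟨s₂, hs₂⟩ : ∃ s, s = 1 + r₂ / R := ⟨_, rfl⟩
  have h1 : 1 ≤ s₁ := by rw [hs₁]; linarith [div_nonneg hr₁ hR.le]
  have h2 : 1 ≤ s₂ := by rw [hs₂]; linarith [div_nonneg hr₂ hR.le]
  have e1 : r₁ ≤ R * s₁ := by rw [hs₁, mul_add, mul_div_cancel₀ _ hR.ne']; linarith
  have e2 : r₂ ≤ R * s₂ := by rw [hs₂, mul_add, mul_div_cancel₀ _ hR.ne']; linarith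
  rw [← hs₁, ← hs₂]
  have hs₁0 : 0 ≤ s₁ := by linarith
  have hs₂0 : 0 ≤ s₂ := by linarith
  refine le_of_sq_le_sq ?_ (by positivity)
  refine le_of_sq_le_sq ?_ (by positivity)
  have hn : 0 ≤ r₁ * Λ := mul_nonneg hr₁ hΛ
  calc (f ^ 2) ^ 2 ≤ (100000 * r₂ * (r₁ * Λ * (√(r₁ * Λ) + μ))) ^ 2 :=
        pow_le_pow_left₀ (sq_nonneg _) h 2
    _ = 10 ^ 10 * r₂ ^ 2 * (r₁ * Λ) ^ 2 * (√(r₁ * Λ) + μ) ^ 2 := by ring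
    _ ≤ 10 ^ 10 * r₂ ^ 2 * (r₁ * Λ) ^ 2 * (2 * (r₁ * Λ + μ ^ 2)) := by
        refine mul_le_mul_of_nonneg_left ?_ (by positivity)
        have := Real.sq_sqrt hn
        nlinarith [sq_nonneg (√(r₁ * Λ) - μ)]
    _ ≤ 10 ^ 10 * (R * s₂) ^ 2 * (R * s₁ * Λ) ^ 2 * (2 * (R * s₁ * Λ + μ ^ 2)) := by
        gcongr
    _ = 2 * 10 ^ 10 * (R ^ 4 * Λ ^ 2 * (s₁ ^ 2 * s₂ ^ 2 * (R * Λ * s₁ + μ ^ 2))) := by ring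
    _ ≤ 2 * 10 ^ 10 * (R ^ 4 * Λ ^ 2 * (s₁ ^ 4 * s₂ ^ 4 * (R * Λ + μ ^ 2))) := by
        refine mul_le_mul_of_nonneg_left (mul_le_mul_of_nonneg_left ?_ (by positivity))
          (by norm_num)
        have h4 : s₁ ^ 2 * s₂ ^ 2 * s₁ ≤ s₁ ^ 4 * s₂ ^ 4 := by
          have a1 : s₁ ^ 3 ≤ s₁ ^ 4 := pow_le_pow_right₀ h1 (by norm_num)
          have a2 : s₂ ^ 2 ≤ s₂ ^ 4 := pow_le_pow_right₀ h2 (by norm_num)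
          calc s₁ ^ 2 * s₂ ^ 2 * s₁ = s₁ ^ 3 * s₂ ^ 2 := by ring
            _ ≤ _ := by gcongr
        have h5 : s₁ ^ 2 * s₂ ^ 2 ≤ s₁ ^ 4 * s₂ ^ 4 := by
          gcongr <;> first | assumption | norm_num
        have h6 : 0 ≤ R * Λ := by positivity
        have h7 : 0 ≤ μ ^ 2 := by positivity
        nlinarith [mul_le_mul_of_nonneg_left h4 h6, mul_le_mul_of_nonneg_left h5 h7]
    _ = ((s₁ * s₂ * W) ^ 2) ^ 2 := by
        rw [show ((s₁ * s₂ * W) ^ 2) ^ 2 = s₁ ^ 4 * s₂ ^ 4 * W ^ 4 by ring, hW4]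
        ring

theorem rich_lines_numeric {k Λ N R μ W : ℝ} (hk : 0 < k) (hΛ : 0 < Λ) (hN : 1 ≤ N)
    (hμ : 0 ≤ μ) (hR : 0 < R) (hkN : k ^ 2 ≤ 8 * N) (hμN : μ * k ≤ 2 * N)
    (hRN : k * Λ ≤ R * N)
    (hW4 : W ^ 4 = 2 * 10 ^ 10 * (R ^ 4 * Λ ^ 2 * (R * Λ + μ ^ 2)))
    (h : k ^ 2 / 4 * (N * R ^ 3 / 4 - 16 * N) ≤ 4 * N ^ 2 * W) :
    Λ ^ 4 * k ^ 15 ≤ 10 ^ 20 * N ^ 11 := by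
  have hN0 : 0 < N := by linarith
  rcases lt_or_ge R 6 with hR6 | hR6
  · refine le_of_sq_le_sq ?_ (by positivity)
    have h1 : k * Λ ≤ 6 * N := hRN.trans (by nlinarith)
    calc (Λ ^ 4 * k ^ 15) ^ 2 = (k * Λ) ^ 8 * (k ^ 2) ^ 11 := by ring
      _ ≤ (6 * N) ^ 8 * (8 * N) ^ 11 := by gcongr
      _ = 6 ^ 8 * 8 ^ 11 * N ^ 19 := by ring
      _ ≤ 10 ^ 40 * N ^ 22 := by
          refine mul_le_mul (by norm_num) (pow_le_pow_right₀ hN (by norm_num)) (by positivity)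
            (by norm_num)
      _ = _ := by ring
  have h1 : k ^ 2 * R ^ 3 ≤ 128 * N * W := by
    have hR3 : 216 ≤ R ^ 3 := by
      calc (216 : ℝ) = 6 ^ 3 := by norm_num
        _ ≤ R ^ 3 := by gcongr
    have h2 : k ^ 2 / 4 * (N * R ^ 3 / 8) ≤ 4 * N ^ 2 * W := by
      refine le_trans (mul_le_mul_of_nonneg_left ?_ (by positivity)) h
      nlinarith
    refine le_of_mul_le_mul_left ?_ (show 0 < N / 32 by positivity)
    linarith
  have h2 : k ^ 8 * R ^ 8 ≤ 128 ^ 4 * (2 * 10 ^ 10) * (N ^ 4 * Λ ^ 2 * (R * Λ + μ ^ 2)) := by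
    refine le_of_mul_le_mul_left ?_ (show 0 < R ^ 4 by positivity)
    calc R ^ 4 * (k ^ 8 * R ^ 8) = (k ^ 2 * R ^ 3) ^ 4 := by ring
      _ ≤ (128 * N * W) ^ 4 := by gcongr
      _ = 128 ^ 4 * N ^ 4 * W ^ 4 := by ring
      _ = _ := by rw [hW4]; ring
  rcases le_total (μ ^ 2) (R * Λ) with hc | hc
  · have h3 : k ^ 8 * R ^ 7 ≤ 128 ^ 4 * (4 * 10 ^ 10) * (N ^ 4 * Λ ^ 3) := by
      refine le_of_mul_le_mul_left ?_ hR
      calc R * (k ^ 8 * R ^ 7) = k ^ 8 * R ^ 8 := by ring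
        _ ≤ _ := h2
        _ ≤ 128 ^ 4 * (2 * 10 ^ 10) * (N ^ 4 * Λ ^ 2 * (R * Λ + R * Λ)) := by gcongr
        _ = _ := by ring
    refine le_of_mul_le_mul_left ?_ (show 0 < Λ ^ 3 by positivity)
    calc Λ ^ 3 * (Λ ^ 4 * k ^ 15) = k ^ 8 * (k * Λ) ^ 7 := by ring
      _ ≤ k ^ 8 * (R * N) ^ 7 := by gcongr
      _ = k ^ 8 * R ^ 7 * N ^ 7 := by ring
      _ ≤ 128 ^ 4 * (4 * 10 ^ 10) * (N ^ 4 * Λ ^ 3) * N ^ 7 := by gcongr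
      _ = 128 ^ 4 * (4 * 10 ^ 10) * (Λ ^ 3 * N ^ 11) := by ring
      _ ≤ 10 ^ 20 * (Λ ^ 3 * N ^ 11) := by gcongr; norm_num
      _ = _ := by ring
  · have h3 : k ^ 8 * R ^ 8 ≤ 128 ^ 4 * (4 * 10 ^ 10) * (N ^ 4 * Λ ^ 2 * μ ^ 2) := by
      calc k ^ 8 * R ^ 8 ≤ _ := h2
        _ ≤ 128 ^ 4 * (2 * 10 ^ 10) * (N ^ 4 * Λ ^ 2 * (μ ^ 2 + μ ^ 2)) := by gcongr
        _ = _ := by ring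
    have h4 : k ^ 18 * Λ ^ 6 ≤ 128 ^ 4 * (16 * 10 ^ 10) * N ^ 14 := by
      refine le_of_mul_le_mul_left ?_ (show 0 < Λ ^ 2 by positivity)
      calc Λ ^ 2 * (k ^ 18 * Λ ^ 6) = k ^ 10 * (k * Λ) ^ 8 := by ring
        _ ≤ k ^ 10 * (R * N) ^ 8 := by gcongr
        _ = k ^ 8 * R ^ 8 * (k ^ 2 * N ^ 8) := by ring
        _ ≤ 128 ^ 4 * (4 * 10 ^ 10) * (N ^ 4 * Λ ^ 2 * μ ^ 2) * (k ^ 2 * N ^ 8) := by gcongr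
        _ = 128 ^ 4 * (4 * 10 ^ 10) * (Λ ^ 2 * N ^ 12 * (μ * k) ^ 2) := by ring
        _ ≤ 128 ^ 4 * (4 * 10 ^ 10) * (Λ ^ 2 * N ^ 12 * (2 * N) ^ 2) := by gcongr
        _ = _ := by ring
    refine le_of_pow_le_pow_left₀ (n := 6) (by norm_num) (by positivity) ?_
    calc (Λ ^ 4 * k ^ 15) ^ 6 = (k ^ 18 * Λ ^ 6) ^ 4 * (k ^ 2) ^ 9 := by ring
      _ ≤ (128 ^ 4 * (16 * 10 ^ 10) * N ^ 14) ^ 4 * (8 * N) ^ 9 := by gcongr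
      _ = (128 ^ 4 * (16 * 10 ^ 10)) ^ 4 * 8 ^ 9 * N ^ 65 := by ring
      _ ≤ 10 ^ 120 * N ^ 66 := by
          refine mul_le_mul (by norm_num) (pow_le_pow_right₀ hN (by norm_num)) (by positivity)
            (by norm_num)
      _ = _ := by ring

theorem cube_div_four_sub_le (r : ℕ) :
    (r : ℝ) ^ 3 / 4 - 16 ≤ ((r * ((r - 1) * (r - 2)) : ℕ) : ℝ) := by
  rcases le_or_gt r 3 with h | h
  · interval_cases r <;> norm_num
  · obtain ⟨m, rfl⟩ : ∃ m, r = m + 4 := ⟨r - 4, by omega⟩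
    rw [show m + 4 - 1 = m + 3 by omega, show m + 4 - 2 = m + 2 by omega]
    push_cast
    have : (0 : ℝ) ≤ m := Nat.cast_nonneg _
    nlinarith [pow_nonneg this 3, pow_nonneg this 2]

variable {p : ℕ} [Fact p.Prime]

theorem card_lines_pow_le (hp : p % 4 = 3) (E : Finset (ZMod p × ZMod p)) (k : ℕ) (hk : 2 ≤ k)
    (hkN : k ^ 2 ≤ 8 * E.card) (L : Finset ((ZMod p × ZMod p) × ZMod p))
    (hL : L ⊆ richLines E k) (hp1 : 512 * (2 * E.card / k * L.card) ≤ p ^ 2)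
    (hp2 : L.card ^ 3 * (2 * E.card / k) ≤ p ^ 4) :
    L.card ^ 4 * k ^ 15 ≤ 10 ^ 20 * E.card ^ 11 := by
  classical
  rcases Nat.eq_zero_or_pos L.card with hL0 | hL0
  · rw [hL0]; simp
  set N := E.card with hN
  have hN1 : 1 ≤ N := by
    by_contra! h
    have : 0 < k ^ 2 := by positivity
    omega
  have hN1' : (1 : ℝ) ≤ N := by exact_mod_cast hN1
  obtain ⟨μ, hμ⟩ : ∃ μ, μ = 2 * N / k := ⟨_, rfl⟩
  rw [← hμ] at hp1 hp2
  set r : ZMod p × ZMod p → ℕ := fun x => (L.filter fun l => x ∈ linePts l).card with hr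
  have hrμ : ∀ x ∈ E, r x ≤ μ := by
    intro x _
    have h1 : r x * (k - 1) ≤ N := card_lines_through_mul_le E k L hL x
    rw [hμ, Nat.le_div_iff_mul_le (by omega)]
    calc r x * k ≤ r x * (2 * (k - 1)) := Nat.mul_le_mul_left _ (by omega)
      _ ≤ 2 * N := by linarith
  have hμN : μ * k ≤ 2 * N := by rw [hμ]; exact Nat.div_mul_le_self _ _
  have hsum : L.card * k ≤ ∑ x ∈ E, r x := by
    rw [hr, ← sum_card_inter_linePts]
    exact card_mul_le_sum E L k hL
  obtain ⟨R, hR⟩ : ∃ R : ℝ, R = (∑ x ∈ E, (r x : ℝ)) / N := ⟨_, rfl⟩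
  have hRN : R * N = ∑ x ∈ E, (r x : ℝ) := by rw [hR]; field_simp
  obtain ⟨Λ, hΛ⟩ : ∃ Λ : ℝ, Λ = L.card := ⟨_, rfl⟩
  have hRN' : (k : ℝ) * Λ ≤ R * N := by
    rw [hRN, mul_comm, hΛ]
    exact_mod_cast hsum
  have hk0 : (0 : ℝ) < k := by exact_mod_cast (by omega : 0 < k)
  have hΛ0 : 0 < Λ := by rw [hΛ]; exact_mod_cast hL0
  have hR0 : 0 < R := by
    have : 0 < (k : ℝ) * Λ := mul_pos hk0 hΛ0
    by_contra! h
    nlinarith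
  obtain ⟨X, hX⟩ : ∃ X, X = 2 * 10 ^ 10 * (R ^ 4 * Λ ^ 2 * (R * Λ + (μ : ℝ) ^ 2)) := ⟨_, rfl⟩
  have hX0 : 0 ≤ X := by rw [hX]; positivity
  obtain ⟨W, hW, hW4⟩ : ∃ W : ℝ, 0 ≤ W ∧
      W ^ 4 = 2 * 10 ^ 10 * (R ^ 4 * Λ ^ 2 * (R * Λ + (μ : ℝ) ^ 2)) := by
    rw [← hX]
    refine ⟨√(√X), Real.sqrt_nonneg _, ?_⟩
    rw [show (√(√X)) ^ 4 = ((√(√X)) ^ 2) ^ 2 by ring, Real.sq_sqrt (Real.sqrt_nonneg _),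
      Real.sq_sqrt hX0]
  have hflag : ∀ q ∈ E.offDiag, ((joinedFlags E L q.1 q.2).card : ℝ) ≤
      (1 + r q.1 / R) * (1 + r q.2 / R) * W := by
    intro q hq
    obtain ⟨h1, h2, h3⟩ := mem_offDiag.1 hq
    have := sq_card_joinedFlags_le hp E L (hL.trans (filter_subset _ _)) μ hrμ hp1 hp2 h3 h1
    rw [Nat.cast_mul, ← hΛ] at this
    exact le_linearised_flag_bound (Nat.cast_nonneg _) (Nat.cast_nonneg _) hΛ0.le hR0 hW hW4 this
  have hup : ∑ q ∈ E.offDiag, ((joinedFlags E L q.1 q.2).card : ℝ) ≤ 4 * (N : ℝ) ^ 2 * W := by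
    calc _ ≤ ∑ q ∈ E.offDiag, (1 + r q.1 / R) * (1 + r q.2 / R) * W := sum_le_sum hflag
      _ ≤ ∑ q ∈ E ×ˢ E, (1 + r q.1 / R) * (1 + r q.2 / R) * W :=
          sum_le_sum_of_subset_of_nonneg (fun q hq => by
            rw [mem_offDiag] at hq
            exact mem_product.2 ⟨hq.1, hq.2.1⟩) fun q _ _ => by positivity
      _ = (∑ x ∈ E, (1 + r x / R)) * (∑ x ∈ E, (1 + r x / R)) * W := by
          rw [sum_mul_sum, ← sum_product', sum_mul]
      _ = 4 * (N : ℝ) ^ 2 * W := by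
          have : ∑ x ∈ E, (1 + r x / R) = 2 * N := by
            rw [sum_add_distrib, ← sum_div, ← hRN, sum_const, nsmul_eq_mul, mul_one]
            field_simp
            ring
          rw [this]
          ring
  have hlow : (k : ℝ) ^ 2 / 4 * (N * R ^ 3 / 4 - 16 * N) ≤
      ∑ q ∈ E.offDiag, ((joinedFlags E L q.1 q.2).card : ℝ) := by
    have h1 : ((∑ x ∈ E, r x * ((r x - 1) * (r x - 2) * (k - 1) ^ 2) : ℕ) : ℝ) ≤
        ((∑ q ∈ E.offDiag, (joinedFlags E L q.1 q.2).card : ℕ) : ℝ) := by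
      exact_mod_cast sum_le_sum_card_joinedFlags E L k hL
    rw [Nat.cast_sum, Nat.cast_sum] at h1
    refine le_trans ?_ h1
    have h2 : ∀ x ∈ E, (k : ℝ) ^ 2 / 4 * ((r x : ℝ) ^ 3 / 4 - 16) ≤
        ((r x * ((r x - 1) * (r x - 2) * (k - 1) ^ 2) : ℕ) : ℝ) := by
      intro x _
      have h3 := cube_div_four_sub_le (r x)
      have h4 : (k : ℝ) ^ 2 / 4 ≤ (((k - 1) ^ 2 : ℕ) : ℝ) := by
        obtain ⟨m, rfl⟩ : ∃ m, k = m + 2 := ⟨k - 2, by omega⟩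
        rw [show m + 2 - 1 = m + 1 by omega]
        push_cast
        have : (0 : ℝ) ≤ m := Nat.cast_nonneg _
        nlinarith
      rw [← mul_assoc, ← mul_assoc, mul_assoc (r x), Nat.cast_mul, mul_comm]
      exact (mul_le_mul_of_nonneg_right h3 (by positivity)).trans
        (mul_le_mul_of_nonneg_left h4 (Nat.cast_nonneg _))
    refine le_trans ?_ (sum_le_sum h2)
    rw [← mul_sum, sum_sub_distrib, ← sum_div, sum_const, nsmul_eq_mul]
    refine mul_le_mul_of_nonneg_left ?_ (by positivity)
    have h5 : (N : ℝ) * R ^ 3 ≤ ∑ x ∈ E, (r x : ℝ) ^ 3 := by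
      have := pow_sum_div_card_le_sum_pow (s := E) (f := fun x => (r x : ℝ))
        (fun x _ => Nat.cast_nonneg _) 2
      rw [← hRN, ← hN] at this
      refine le_trans (le_of_eq ?_) this
      field_simp
      ring
    linarith
  have := rich_lines_numeric hk0 hΛ0 hN1' (Nat.cast_nonneg μ) hR0 (by exact_mod_cast hkN)
    (by exact_mod_cast hμN) hRN' hW4 (hlow.trans hup)
  rw [hΛ] at this
  exact_mod_cast this

end RichLines

section RichLineBound

variable {p : ℕ} [Fact p.Prime]

/-- A point-line bound in the plane over `𝔽_p` in the style of Stevens and de Zeeuw. -/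
theorem card_richLines_pow_le (hp : p % 4 = 3) (E : Finset (ZMod p × ZMod p)) (k : ℕ)
    (hk : 2 ≤ k) (hkN : k ^ 2 ≤ 8 * E.card) (hkp : 2 * E.card ≤ k * p) :
    (richLines E k).card ^ 4 * k ^ 15 ≤ 10 ^ 23 * E.card ^ 11 := by
  obtain ⟨N, hN⟩ : ∃ N, N = E.card := ⟨_, rfl⟩
  obtain ⟨X, hX⟩ : ∃ X, X = (richLines E k).card := ⟨_, rfl⟩
  have hN1 : 1 ≤ N := by
    by_contra! h
    have : 0 < k ^ 2 := by positivity
    omega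
  obtain ⟨m, hm⟩ : ∃ m, m = min N p := ⟨_, rfl⟩
  have hXm : X * k ^ 2 ≤ 4 * N * m := by
    rcases le_total N p with h | h
    · rw [hm, min_eq_left h]
      have h1 := card_richLines_mul_le_sq E k
      rw [← hX, ← hN] at h1
      have h2 : k ^ 2 ≤ 2 * (k * (k - 1)) := by
        rw [sq, mul_left_comm]
        exact Nat.mul_le_mul_left _ (by omega)
      have := Nat.mul_le_mul_left X h2
      nlinarith
    · rw [hm, min_eq_right h, hX, hN]
      have := card_richLines_mul_sq_le E k hkp
      linarith
  rw [← hN] at hkN hkp ⊢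
  rw [← hX]
  rcases le_or_gt (k ^ 7 * m ^ 4) (10 ^ 20 * N ^ 7) with hc | hc
  · calc X ^ 4 * k ^ 15 = (X * k ^ 2) ^ 4 * k ^ 7 := by ring
      _ ≤ (4 * N * m) ^ 4 * k ^ 7 := by gcongr
      _ = 256 * N ^ 4 * (k ^ 7 * m ^ 4) := by ring
      _ ≤ 256 * N ^ 4 * (10 ^ 20 * N ^ 7) := by gcongr
      _ = 256 * 10 ^ 20 * N ^ 11 := by ring
      _ ≤ 10 ^ 23 * N ^ 11 := Nat.mul_le_mul_right _ (by norm_num)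
  by_contra! hlt
  have hex : ∃ t : ℕ, 10 ^ 20 * N ^ 11 < t ^ 4 * k ^ 15 :=
    ⟨X, lt_of_le_of_lt (Nat.mul_le_mul_right _ (by norm_num)) hlt⟩
  classical
  obtain ⟨Λ, hΛ⟩ : ∃ Λ, Λ = Nat.find hex := ⟨_, rfl⟩
  have hΛ1 : 10 ^ 20 * N ^ 11 < Λ ^ 4 * k ^ 15 := by rw [hΛ]; exact Nat.find_spec hex
  have hΛX : Λ ≤ X := by
    rw [hΛ]
    exact Nat.find_min' hex (lt_of_le_of_lt (Nat.mul_le_mul_right _ (by norm_num)) hlt)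
  have hk30 : ∀ j, k ^ (2 * j) ≤ 8 ^ j * N ^ j := fun j => by
    rw [pow_mul, ← mul_pow]
    exact Nat.pow_le_pow_left hkN j
  have hΛ2 : 2 ≤ Λ := by
    by_contra! h
    have h1 : 10 ^ 20 * N ^ 11 < k ^ 15 := by
      refine hΛ1.trans_le ?_
      calc Λ ^ 4 * k ^ 15 ≤ 1 ^ 4 * k ^ 15 := by gcongr; omega
        _ = k ^ 15 := by ring
    have h2 : (10 ^ 20 * N ^ 11) ^ 2 < (k ^ 15) ^ 2 := Nat.pow_lt_pow_left h1 (by norm_num)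
    have h3 : (10 ^ 20 * N ^ 11) ^ 2 < 10 ^ 40 * N ^ 22 := by
      calc _ < (k ^ 15) ^ 2 := h2
        _ = k ^ (2 * 15) := by ring
        _ ≤ 8 ^ 15 * N ^ 15 := hk30 15
        _ ≤ 10 ^ 40 * N ^ 22 := Nat.mul_le_mul (by norm_num)
            (Nat.pow_le_pow_right hN1 (by norm_num))
    exact absurd h3 (not_lt.2 (le_of_eq (by ring)))
  have hΛ3 : Λ ^ 4 * k ^ 15 ≤ 16 * 10 ^ 20 * N ^ 11 := by
    have h1 := Nat.find_min hex (m := Λ - 1) (by omega)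
    rw [not_lt] at h1
    calc Λ ^ 4 * k ^ 15 ≤ (2 * (Λ - 1)) ^ 4 * k ^ 15 := by gcongr; omega
      _ = 16 * ((Λ - 1) ^ 4 * k ^ 15) := by ring
      _ ≤ 16 * (10 ^ 20 * N ^ 11) := by gcongr
      _ = _ := by ring
  obtain ⟨μ, hμ⟩ : ∃ μ, μ = 2 * N / k := ⟨_, rfl⟩
  have hμN : μ * k ≤ 2 * N := by rw [hμ]; exact Nat.div_mul_le_self _ _
  have hμΛ : μ ≤ Λ := by
    by_contra! h
    have h1 : 10 ^ 20 * N ^ 7 * N ^ 4 < 16 * k ^ 11 * N ^ 4 := by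
      calc 10 ^ 20 * N ^ 7 * N ^ 4 = 10 ^ 20 * N ^ 11 := by ring
        _ < _ := hΛ1
        _ ≤ μ ^ 4 * k ^ 15 := by gcongr
        _ = (μ * k) ^ 4 * k ^ 11 := by ring
        _ ≤ (2 * N) ^ 4 * k ^ 11 := by gcongr
        _ = _ := by ring
    have h2 := lt_of_mul_lt_mul_right h1 (Nat.zero_le _)
    have h3 := Nat.pow_lt_pow_left h2 (two_ne_zero)
    have h4 : (10 ^ 20 * N ^ 7) ^ 2 < 10 ^ 40 * N ^ 14 := by
      calc _ < (16 * k ^ 11) ^ 2 := h3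
        _ = 256 * k ^ (2 * 11) := by ring
        _ ≤ 256 * (8 ^ 11 * N ^ 11) := Nat.mul_le_mul_left _ (hk30 11)
        _ = 256 * 8 ^ 11 * N ^ 11 := by ring
        _ ≤ 10 ^ 40 * N ^ 14 := Nat.mul_le_mul (by norm_num)
            (Nat.pow_le_pow_right hN1 (by norm_num))
    exact absurd h4 (not_lt.2 (le_of_eq (by ring)))
  have hk0 : 0 < k := by omega
  have hkey : 2 ^ 18 * (Λ ^ 3 * μ) ≤ p ^ 4 := by
    have hm28 : m ^ 28 ≤ p ^ 16 * N ^ 12 := by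
      calc m ^ 28 = m ^ 16 * m ^ 12 := by ring
        _ ≤ p ^ 16 * N ^ 12 := by
          rw [hm]
          exact Nat.mul_le_mul (Nat.pow_le_pow_left (min_le_right _ _) _)
            (Nat.pow_le_pow_left (min_le_left _ _) _)
    have h1 : 10 ^ 140 * N ^ 37 ≤ k ^ 49 * p ^ 16 := by
      refine le_of_mul_le_mul_right ?_ (show 0 < N ^ 12 by positivity)
      calc 10 ^ 140 * N ^ 37 * N ^ 12 = (10 ^ 20 * N ^ 7) ^ 7 := by ring
        _ ≤ (k ^ 7 * m ^ 4) ^ 7 := by gcongr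
        _ = k ^ 49 * m ^ 28 := by ring
        _ ≤ k ^ 49 * (p ^ 16 * N ^ 12) := by gcongr
        _ = _ := by ring
    refine le_of_pow_le_pow_left₀ (n := 4) (by norm_num) (Nat.zero_le _) ?_
    refine le_of_mul_le_mul_right ?_ (show 0 < k ^ 49 by positivity)
    calc (2 ^ 18 * (Λ ^ 3 * μ)) ^ 4 * k ^ 49 = 2 ^ 72 * ((Λ ^ 4 * k ^ 15) ^ 3 * (μ * k) ^ 4) := by
          ring
      _ ≤ 2 ^ 72 * ((16 * 10 ^ 20 * N ^ 11) ^ 3 * (2 * N) ^ 4) := by gcongr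
      _ = 2 ^ 72 * (16 * 10 ^ 20) ^ 3 * 16 * N ^ 37 := by ring
      _ ≤ 10 ^ 140 * N ^ 37 := Nat.mul_le_mul_right _ (by norm_num)
      _ ≤ k ^ 49 * p ^ 16 := h1
      _ = _ := by ring
  obtain ⟨L, hL, hLc⟩ := exists_subset_card_eq (hΛX.trans_eq hX)
  have hfin := card_lines_pow_le hp E k hk (by rwa [← hN]) L hL
    (by
      rw [← hN, ← hμ, hLc]
      refine le_of_pow_le_pow_left₀ two_ne_zero (Nat.zero_le _) ?_
      calc (512 * (μ * Λ)) ^ 2 = 2 ^ 18 * (Λ ^ 2 * μ * μ) := by ring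
        _ ≤ 2 ^ 18 * (Λ ^ 2 * μ * Λ) := by gcongr
        _ = 2 ^ 18 * (Λ ^ 3 * μ) := by ring
        _ ≤ p ^ 4 := hkey
        _ = _ := by ring)
    (by
      rw [← hN, ← hμ, hLc]
      exact (Nat.le_mul_of_pos_left _ (by norm_num)).trans hkey)
  rw [hLc, ← hN] at hfin
  exact absurd hfin (not_le.2 hΛ1)

end RichLineBound

section Bisectors

variable {p : ℕ} [Fact p.Prime]

/-- The normalised equation of the perpendicular bisector of two distinct points. -/
def bisector (q : Pt p × Pt p) : Pt p × ZMod p :=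
  if q.2.1 = q.1.1 then ((0, 1), (norm2 q.2 - norm2 q.1) / (2 * (q.2.2 - q.1.2)))
  else ((1, (q.2.2 - q.1.2) / (q.2.1 - q.1.1)),
    (norm2 q.2 - norm2 q.1) / (2 * (q.2.1 - q.1.1)))

theorem bisector_mem_lineKeys (q : Pt p × Pt p) : bisector q ∈ lineKeys p := by
  rw [mem_lineKeys, bisector]
  split_ifs <;> simp

theorem norm2_bisector_ne_zero (hp : p % 4 = 3) (q : Pt p × Pt p) :
    norm2 (bisector q).1 ≠ 0 := by
  refine sq_add_sq_ne_zero hp ?_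
  rintro ⟨e1, e2⟩
  rcases mem_lineKeys.1 (bisector_mem_lineKeys q) with hk | ⟨-, hk⟩
  · exact one_ne_zero (hk.symm.trans e1)
  · exact one_ne_zero (hk.symm.trans e2)

theorem exists_smul_bisector (h2 : (2 : ZMod p) ≠ 0) {q : Pt p × Pt p} (hq : q.1 ≠ q.2) :
    ∃ t : ZMod p, t ≠ 0 ∧ 2 * (q.2.1 - q.1.1) = t * (bisector q).1.1 ∧
      2 * (q.2.2 - q.1.2) = t * (bisector q).1.2 ∧
      norm2 q.2 - norm2 q.1 = t * (bisector q).2 := by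
  rw [bisector]
  split_ifs with h
  · have h' : q.2.2 - q.1.2 ≠ 0 := fun h0 => hq (Prod.ext h.symm (sub_eq_zero.1 h0).symm)
    refine ⟨2 * (q.2.2 - q.1.2), mul_ne_zero h2 h', ?_, ?_, ?_⟩
    · simp [h]
    · simp
    · simp only
      field_simp
  · have h' : q.2.1 - q.1.1 ≠ 0 := sub_ne_zero.2 h
    refine ⟨2 * (q.2.1 - q.1.1), mul_ne_zero h2 h', ?_, ?_, ?_⟩
    · simp
    · simp only
      field_simp
    · simp only
      field_simp

theorem mem_linePts_bisector (h2 : (2 : ZMod p) ≠ 0) {q : Pt p × Pt p} (hq : q.1 ≠ q.2) {c : Pt p}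
    (h : dist2 q.1 c = dist2 q.2 c) : c ∈ linePts (bisector q) := by
  obtain ⟨t, ht, h1, h2, h3⟩ := exists_smul_bisector h2 hq
  rw [mem_linePts]
  refine mul_left_cancel₀ ht ?_
  simp only [dist2, norm2] at *
  linear_combination -c.1 * h1 - c.2 * h2 + h3 + h

/-- A point and a perpendicular bisector determine the mirror image of the point. -/
theorem eq_of_bisector_eq (hp : p % 4 = 3) (h2 : (2 : ZMod p) ≠ 0) {a b b' : Pt p} (hb : a ≠ b)
    (hb' : a ≠ b') (h : bisector (a, b) = bisector (a, b')) : b = b' := by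
  obtain ⟨t, ht, h1, h3, h4⟩ := exists_smul_bisector h2 (q := (a, b)) hb
  obtain ⟨s, hs, g1, g3, g4⟩ := exists_smul_bisector h2 (q := (a, b')) hb'
  have hn := norm2_bisector_ne_zero hp (a, b)
  rw [← h] at g1 g3 g4
  generalize bisector (a, b) = l at *
  simp only [norm2] at *
  have k1 : t * (l.1.1 ^ 2 + l.1.2 ^ 2) = 4 * (l.2 - l.1.1 * a.1 - l.1.2 * a.2) := by
    refine mul_left_cancel₀ ht ?_
    linear_combination (-t * l.1.1 - 2 * (b.1 - a.1) - 4 * a.1) * h1 +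
      (-t * l.1.2 - 2 * (b.2 - a.2) - 4 * a.2) * h3 + 4 * h4
  have k2 : s * (l.1.1 ^ 2 + l.1.2 ^ 2) = 4 * (l.2 - l.1.1 * a.1 - l.1.2 * a.2) := by
    refine mul_left_cancel₀ hs ?_
    linear_combination (-s * l.1.1 - 2 * (b'.1 - a.1) - 4 * a.1) * g1 +
      (-s * l.1.2 - 2 * (b'.2 - a.2) - 4 * a.2) * g3 + 4 * g4
  have hts : t = s := mul_right_cancel₀ hn (k1.trans k2.symm)
  rw [← hts] at g1 g3
  refine Prod.ext (mul_left_cancel₀ h2 ?_) (mul_left_cancel₀ h2 ?_)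
  · linear_combination h1 - g1
  · linear_combination h3 - g3

/-- Equal-length segments with a common bisector are translates of each other up to
orientation. -/
theorem sub_eq_or_sub_eq_of_bisector_eq (hp : p % 4 = 3) (h2 : (2 : ZMod p) ≠ 0)
    {q r : Pt p × Pt p} (hq : q.1 ≠ q.2)
    (hr : r.1 ≠ r.2) (h : bisector q = bisector r) (hd : dist2 q.1 q.2 = dist2 r.1 r.2) :
    (r.2 - r.1 = q.2 - q.1 ∧ norm2 r.2 - norm2 r.1 = norm2 q.2 - norm2 q.1) ∨
    (r.1 - r.2 = q.2 - q.1 ∧ norm2 r.1 - norm2 r.2 = norm2 q.2 - norm2 q.1) := by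
  obtain ⟨t, ht, h1, h3, h4⟩ := exists_smul_bisector h2 hq
  obtain ⟨s, hs, g1, g3, g4⟩ := exists_smul_bisector h2 hr
  have hn := norm2_bisector_ne_zero hp q
  rw [← h] at g1 g3 g4
  generalize bisector q = l at *
  have hst : s ^ 2 = t ^ 2 := by
    refine mul_right_cancel₀ hn ?_
    simp only [dist2] at hd
    rw [norm2]
    linear_combination (-2 * (r.2.1 - r.1.1) - s * l.1.1) * g1 +
      (-2 * (r.2.2 - r.1.2) - s * l.1.2) * g3 + (2 * (q.2.1 - q.1.1) + t * l.1.1) * h1 +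
      (2 * (q.2.2 - q.1.2) + t * l.1.2) * h3 - 4 * hd
  rcases sq_eq_sq_iff_eq_or_eq_neg.1 hst with rfl | rfl
  · refine Or.inl ⟨Prod.ext (mul_left_cancel₀ h2 ?_) (mul_left_cancel₀ h2 ?_), ?_⟩
    · simp only [Prod.fst_sub]
      linear_combination g1 - h1
    · simp only [Prod.snd_sub]
      linear_combination g3 - h3
    · linear_combination g4 - h4
  · refine Or.inr ⟨Prod.ext (mul_left_cancel₀ h2 ?_) (mul_left_cancel₀ h2 ?_), ?_⟩
    · simp only [Prod.fst_sub]
      linear_combination -g1 - h1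
    · simp only [Prod.snd_sub]
      linear_combination -g3 - h3
    · linear_combination -g4 - h4

theorem isRectangle_of_sub_eq {a b c d : Pt p} (h : c - d = b - a)
    (hn : norm2 c - norm2 d = norm2 b - norm2 a) (h2 : (2 : ZMod p) ≠ 0) :
    IsRectangle a b c d := by
  have h1 : c.1 - d.1 = b.1 - a.1 := congrArg Prod.fst h
  have h3 : c.2 - d.2 = b.2 - a.2 := congrArg Prod.snd h
  have hc1 : c.1 = d.1 + b.1 - a.1 := by linear_combination h1
  have hc2 : c.2 = d.2 + b.2 - a.2 := by linear_combination h3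
  simp only [norm2, hc1, hc2] at hn
  refine ⟨?_, ?_, ?_, ?_⟩
  · refine mul_left_cancel₀ h2 ?_
    linear_combination hn
  · refine mul_left_cancel₀ h2 ?_
    simp only [hc1, hc2]
    linear_combination -hn
  · refine mul_left_cancel₀ h2 ?_
    simp only [hc1, hc2]
    linear_combination hn
  · refine mul_left_cancel₀ h2 ?_
    simp only [hc1, hc2]
    linear_combination -hn

theorem not_collinear_of_isCorner (hp : p % 4 = 3) {a b c d : Pt p} (h : IsCorner a b d)
    (hb : b ≠ a) (hd : d ≠ a) : ¬ Collinear (ZMod p) ({a, b, c, d} : Set (Pt p)) := by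
  intro hc
  rw [collinear_iff_of_mem (p₀ := a) (by simp)] at hc
  obtain ⟨v, hv⟩ := hc
  obtain ⟨r, hr⟩ := hv b (by simp)
  obtain ⟨s, hs⟩ := hv d (by simp)
  simp only [vadd_eq_add] at hr hs
  have hv0 : v.1 ^ 2 + v.2 ^ 2 ≠ 0 := by
    refine sq_add_sq_ne_zero hp fun h0 => hb ?_
    have : v = 0 := Prod.ext h0.1 h0.2
    rw [hr, this, smul_zero, zero_add]
  have : r * s * (v.1 ^ 2 + v.2 ^ 2) = 0 := by
    rw [IsCorner, hr, hs] at h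
    simp only [Prod.fst_add, Prod.snd_add, Prod.smul_fst, Prod.smul_snd, smul_eq_mul] at h
    linear_combination h
  rcases mul_eq_zero.1 ((mul_eq_zero.1 this).resolve_right hv0) with h0 | h0
  · exact hb (by rw [hr, h0, zero_smul, zero_add])
  · exact hd (by rw [hs, h0, zero_smul, zero_add])

/-- The ordered pairs of distinct points of `E` with perpendicular bisector `l`. -/
def bisectedPairs (E : Finset (Pt p)) (l : Pt p × ZMod p) : Finset (Pt p × Pt p) :=
  E.offDiag.filter fun q => bisector q = l

theorem two_ne_zero_of_mod_four (hp : p % 4 = 3) : (2 : ZMod p) ≠ 0 := by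
  have : ((2 : ℕ) : ZMod p) ≠ 0 := by
    rw [Ne, ZMod.natCast_eq_zero_iff]
    intro h
    have := Nat.le_of_dvd (by norm_num) h
    omega
  exact_mod_cast this

theorem triCount_le (hp : p % 4 = 3) (E : Finset (Pt p)) :
    triCount E ≤ E.card ^ 2 +
      ∑ l ∈ lineKeys p, (bisectedPairs E l).card * (E ∩ linePts l).card := by
  have h1 : ∑ l ∈ lineKeys p, (bisectedPairs E l).card * (E ∩ linePts l).card =
      ∑ q ∈ E.offDiag, (E ∩ linePts (bisector q)).card := by
    rw [← sum_fiberwise_of_maps_to (t := lineKeys p) (g := bisector)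
      fun q _ => bisector_mem_lineKeys q]
    refine sum_congr rfl fun l _ => ?_
    rw [sum_congr rfl fun q hq => by rw [(mem_filter.1 hq).2], sum_const, smul_eq_mul,
      bisectedPairs]
  rw [h1, ← card_sigma, triCount, ← card_filter_add_card_filter_not (fun q => q.1 = q.2.1)]
  refine Nat.add_le_add ?_ ?_
  · rw [sq, ← card_product]
    refine card_le_card_of_injOn (fun q => (q.1, q.2.2)) ?_ ?_
    · intro q hq
      simp only [coe_filter, mem_filter, mem_product, Set.mem_ofPred_eq] at hq
      simp only [coe_product, Set.mem_prod, mem_coe]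
      tauto
    · rintro ⟨a, b, c⟩ hq ⟨a', b', c'⟩ hq' h
      simp only [coe_filter, mem_filter, Set.mem_ofPred_eq] at hq hq'
      simp only [Prod.mk.injEq] at h ⊢
      exact ⟨h.1, by rw [← hq.2, ← hq'.2, h.1], h.2⟩
  · refine card_le_card_of_injOn (fun q => ⟨(q.1, q.2.1), q.2.2⟩) ?_ ?_
    · intro q hq
      simp only [coe_filter, mem_filter, mem_product, Set.mem_ofPred_eq] at hq
      simp only [mem_coe, mem_sigma, mem_offDiag, mem_inter]
      refine ⟨⟨hq.1.1.1, hq.1.1.2.1, hq.2⟩, hq.1.1.2.2, ?_⟩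
      exact mem_linePts_bisector (two_ne_zero_of_mod_four hp) hq.2 hq.1.2.1
    · rintro ⟨a, b, c⟩ hq ⟨a', b', c'⟩ hq' h
      simp only [Sigma.mk.injEq, Prod.mk.injEq, heq_eq_eq] at h ⊢
      tauto

theorem card_bisectedPairs_le (hp : p % 4 = 3) (E : Finset (Pt p)) (l : Pt p × ZMod p) :
    (bisectedPairs E l).card ≤ E.card := by
  refine card_le_card_of_injOn Prod.fst ?_ ?_
  · intro q hq
    exact (mem_offDiag.1 (mem_filter.1 hq).1).1
  · rintro ⟨a, b⟩ hq ⟨a', b'⟩ hq' h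
    obtain ⟨h1, h2⟩ := mem_filter.1 hq
    obtain ⟨h3, h4⟩ := mem_filter.1 hq'
    simp only at h
    subst h
    exact Prod.ext rfl (eq_of_bisector_eq hp (two_ne_zero_of_mod_four hp) (mem_offDiag.1 h1).2.2
      (mem_offDiag.1 h3).2.2 (h2.trans h4.symm))

theorem sum_card_bisectedPairs (E : Finset (Pt p)) :
    ∑ l ∈ lineKeys p, (bisectedPairs E l).card = E.card * E.card - E.card := by
  rw [← offDiag_card]
  exact (card_eq_sum_card_fiberwise fun q _ => bisector_mem_lineKeys q).symm

theorem card_translated_pairs_le (hp : p % 4 = 3) (E : Finset (Pt p)) :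
    ((E.offDiag ×ˢ E.offDiag).filter fun z => z.2.2 - z.2.1 = z.1.2 - z.1.1 ∧
      norm2 z.2.2 - norm2 z.2.1 = norm2 z.1.2 - norm2 z.1.1).card ≤
      E.card ^ 2 + rectCount p E := by
  rw [← card_filter_add_card_filter_not (fun z => z.2.1 = z.1.1)]
  refine Nat.add_le_add ?_ ?_
  · rw [sq, ← card_product]
    refine card_le_card_of_injOn Prod.fst ?_ ?_
    · intro z hz
      simp only [coe_filter, mem_filter, mem_product, mem_offDiag, Set.mem_ofPred_eq] at hz
      simp only [coe_product, Set.mem_prod, mem_coe]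
      tauto
    · rintro ⟨⟨a, b⟩, a', b'⟩ hz ⟨⟨c, d⟩, c', d'⟩ hz' h
      simp only [coe_filter, mem_filter, Set.mem_ofPred_eq] at hz hz'
      simp only [Prod.mk.injEq] at h ⊢
      obtain ⟨rfl, rfl⟩ := h
      have h1 := hz.1.2.1
      have h2 := hz'.1.2.1
      rw [hz.2] at h1
      rw [hz'.2] at h2
      exact ⟨⟨rfl, rfl⟩, hz.2.trans hz'.2.symm,
        (sub_left_injective h1).trans (sub_left_injective h2).symm⟩
  · rw [← Set.ncard_coe_finset, rectCount]
    refine Set.ncard_le_ncard_of_injOn (fun z => (z.1.1, z.1.2, z.2.2, z.2.1)) ?_ ?_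
      (Set.toFinite _)
    · intro z hz
      simp only [coe_filter, mem_filter, mem_product, mem_offDiag, Set.mem_ofPred_eq] at hz
      obtain ⟨⟨⟨⟨h1, h2, h3⟩, h4, h5, -⟩, h6, h7⟩, h8⟩ := hz
      have hr := isRectangle_of_sub_eq h6 h7 (two_ne_zero_of_mod_four hp)
      exact ⟨h1, h2, h5, h4, hr, not_collinear_of_isCorner hp hr.1 (Ne.symm h3) h8⟩
    · rintro ⟨⟨a, b⟩, a', b'⟩ _ ⟨⟨c, d⟩, c', d'⟩ _ h
      simp only [Prod.mk.injEq] at h ⊢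
      tauto

theorem card_bisected_pairs_le (hp : p % 4 = 3) (E : Finset (Pt p)) :
    ((E.offDiag ×ˢ E.offDiag).filter fun z => bisector z.1 = bisector z.2 ∧
      dist2 z.1.1 z.1.2 = dist2 z.2.1 z.2.2).card ≤ 2 * (E.card ^ 2 + rectCount p E) := by
  classical
  have h0 := card_translated_pairs_le hp E
  set S := (E.offDiag ×ˢ E.offDiag).filter fun z => z.2.2 - z.2.1 = z.1.2 - z.1.1 ∧
      norm2 z.2.2 - norm2 z.2.1 = norm2 z.1.2 - norm2 z.1.1 with hS
  have h1 : ((E.offDiag ×ˢ E.offDiag).filter fun z => bisector z.1 = bisector z.2 ∧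
      dist2 z.1.1 z.1.2 = dist2 z.2.1 z.2.2) ⊆ S ∪ S.image fun z => (z.1, z.2.swap) := by
    intro z hz
    simp only [mem_filter, mem_product, mem_offDiag] at hz
    obtain ⟨⟨⟨h1, h2, h3⟩, h4, h5, h6⟩, h7, h8⟩ := hz
    rcases sub_eq_or_sub_eq_of_bisector_eq hp (two_ne_zero_of_mod_four hp) h3 h6 h7 h8 with h | h
    · refine mem_union_left _ ?_
      simp only [hS, mem_filter, mem_product, mem_offDiag]
      tauto
    · refine mem_union_right _ (mem_image.2 ⟨(z.1, z.2.swap), ?_, by simp⟩)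
      simp only [hS, mem_filter, mem_product, mem_offDiag, Prod.fst_swap, Prod.snd_swap]
      have := Ne.symm h6
      tauto
  have h2 := (card_le_card h1).trans (card_union_le _ _)
  have h3 := card_image_le (s := S) (f := fun z => (z.1, z.2.swap))
  omega

theorem sum_sq_card_bisectedPairs_le (hp : p % 4 = 3) (E : Finset (Pt p)) :
    ∑ l ∈ lineKeys p, (bisectedPairs E l).card ^ 2 ≤
      2 * ((distSet E).card * (E.card ^ 2 + rectCount p E)) := by
  classical
  have h1 : ∀ l, (bisectedPairs E l).card ^ 2 ≤ (distSet E).card *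
      (((E.offDiag ×ˢ E.offDiag).filter fun z => bisector z.1 = bisector z.2 ∧
      dist2 z.1.1 z.1.2 = dist2 z.2.1 z.2.2).filter fun z => bisector z.1 = l).card := by
    intro l
    refine (sq_card_le_sum_card_fiber (bisectedPairs E l) (distSet E) (fun q => dist2 q.1 q.2)
      ?_).trans ?_
    · intro q hq
      have := mem_offDiag.1 (mem_filter.1 hq).1
      exact mem_image.2 ⟨q, mem_product.2 ⟨this.1, this.2.1⟩, rfl⟩
    · refine Nat.mul_le_mul_left _ (card_le_card fun z hz => ?_)
      simp only [bisectedPairs, mem_filter, mem_product] at hz ⊢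
      refine ⟨⟨⟨hz.1.1.1, hz.1.2.1⟩, hz.1.1.2.trans hz.1.2.2.symm, hz.2⟩, hz.1.1.2⟩
  refine (sum_le_sum fun l _ => h1 l).trans ?_
  rw [← mul_sum, ← card_eq_sum_card_fiberwise fun z _ => bisector_mem_lineKeys z.1]
  have := Nat.mul_le_mul_left (distSet E).card (card_bisected_pairs_le hp E)
  linarith

end Bisectors

section Isosceles

variable {p : ℕ} [Fact p.Prime]

theorem sum_sq_card_inter_linePts_le (hp : p % 4 = 3) (E : Finset (Pt p)) (K : ℕ) (hK : 2 ≤ K)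
    (hKp : 2 * E.card ≤ K * p) (κ G : ℝ) (hκ : 0 < κ) (hκK : κ ≤ K) (hG0 : 0 ≤ G)
    (hG : 10 ^ 23 * (E.card : ℝ) ^ 11 ≤ G ^ 4 * κ ^ 3) :
    ∑ l ∈ (lineKeys p).filter fun l => K ≤ (E ∩ linePts l).card ∧
      (E ∩ linePts l).card ^ 2 ≤ 8 * E.card, ((E ∩ linePts l).card : ℝ) ^ 2 ≤ 3 * G / κ := by
  set M := (lineKeys p).filter fun l => K ≤ (E ∩ linePts l).card ∧
      (E ∩ linePts l).card ^ 2 ≤ 8 * E.card with hM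
  obtain ⟨R, hR⟩ : ∃ R, R = Nat.sqrt (8 * E.card) := ⟨_, rfl⟩
  have hMR : ∀ l ∈ M, K ≤ (E ∩ linePts l).card ∧ (E ∩ linePts l).card ≤ R := by
    intro l hl
    have := (mem_filter.1 hl).2
    refine ⟨this.1, ?_⟩
    rw [hR, Nat.le_sqrt']
    exact this.2
  rcases lt_or_ge R K with hRK | hRK
  · have : M = ∅ := eq_empty_of_forall_notMem fun l hl => by
      have := hMR l hl
      omega
    rw [this, sum_empty]
    positivity
  have hbound : ∀ k, K ≤ k → k ≤ R → ((richLines E k).card : ℝ) * k ^ 3 ≤ G := by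
    intro k hk hkR
    have h1 := card_richLines_pow_le hp E k (hK.trans hk)
      (by rw [hR, Nat.le_sqrt'] at hkR; exact hkR) (hKp.trans (Nat.mul_le_mul_right _ hk))
    have h2 : ((richLines E k).card : ℝ) ^ 4 * (k : ℝ) ^ 15 ≤ 10 ^ 23 * (E.card : ℝ) ^ 11 := by
      exact_mod_cast h1
    have hκk : κ ≤ k := hκK.trans (by exact_mod_cast hk)
    generalize ((richLines E k).card : ℝ) = x at *
    generalize (k : ℝ) = y at *
    have hy : 0 < y := hκ.trans_le hκk
    refine le_of_pow_le_pow_left₀ (n := 4) (by norm_num) hG0 ?_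
    refine le_of_mul_le_mul_right ?_ (pow_pos hκ 3)
    calc (x * y ^ 3) ^ 4 * κ ^ 3 ≤ (x * y ^ 3) ^ 4 * y ^ 3 :=
          mul_le_mul_of_nonneg_left (pow_le_pow_left₀ hκ.le hκk 3) (by positivity)
      _ = x ^ 4 * y ^ 15 := by ring
      _ ≤ _ := h2.trans hG
  have hlevel : ∀ l ∈ M, (E ∩ linePts l).card ^ 2 ≤
      K ^ 2 + ∑ k ∈ Ioc K R, if k ≤ (E ∩ linePts l).card then 2 * k else 0 := by
    intro l hl
    obtain ⟨h1, h2⟩ := hMR l hl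
    generalize (E ∩ linePts l).card = i at *
    have h3 : ∀ j, K ≤ j → j ^ 2 ≤ K ^ 2 + ∑ k ∈ Ioc K j, 2 * k := by
      intro j hj
      induction j, hj using Nat.le_induction with
      | base => simp
      | succ j hj ih =>
        rw [sum_Ioc_succ_top hj]
        nlinarith
    refine (h3 i h1).trans (Nat.add_le_add_left ?_ _)
    rw [← sum_filter]
    refine sum_le_sum_of_subset fun k hk => ?_
    rw [mem_Ioc] at hk
    rw [mem_filter, mem_Ioc]
    omega
  have hsum : ∑ l ∈ M, (E ∩ linePts l).card ^ 2 ≤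
      (richLines E K).card * K ^ 2 + ∑ k ∈ Ioc K R, 2 * k * (richLines E k).card := by
    refine (sum_le_sum hlevel).trans ?_
    rw [sum_add_distrib, sum_const, smul_eq_mul, sum_comm]
    refine Nat.add_le_add (Nat.mul_le_mul_right _ (card_le_card fun l hl => ?_))
      (sum_le_sum fun k _ => ?_)
    · exact mem_filter.2 ⟨(mem_filter.1 hl).1, (hMR l hl).1⟩
    · rw [← sum_filter, sum_const, smul_eq_mul, mul_comm]
      refine Nat.mul_le_mul_left _ (card_le_card fun l hl => ?_)
      obtain ⟨h1, h2⟩ := mem_filter.1 hl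
      exact mem_filter.2 ⟨(mem_filter.1 h1).1, h2⟩
  have hsum' : ∑ l ∈ M, ((E ∩ linePts l).card : ℝ) ^ 2 ≤
      ((richLines E K).card : ℝ) * (K : ℝ) ^ 2 +
        ∑ k ∈ Ioc K R, 2 * (k : ℝ) * ((richLines E k).card : ℝ) := by
    exact_mod_cast hsum
  have hK0 : (0 : ℝ) < K := hκ.trans_le hκK
  have e1 : ((richLines E K).card : ℝ) * (K : ℝ) ^ 2 ≤ G / K := by
    rw [le_div_iff₀ hK0]
    have := hbound K le_rfl hRK
    linarith
  have e2 : ∑ k ∈ Ioc K R, 2 * (k : ℝ) * ((richLines E k).card : ℝ) ≤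
      ∑ k ∈ Ioc K R, 2 * G * ((k : ℝ) ^ 2)⁻¹ := by
    refine sum_le_sum fun k hk => ?_
    rw [mem_Ioc] at hk
    have hk0 : (0 : ℝ) < k := by
      have : 0 < k := by omega
      exact_mod_cast this
    have := hbound k hk.1.le hk.2
    rw [← div_eq_mul_inv, le_div_iff₀ (pow_pos hk0 2)]
    linarith
  have e3 := sum_Ioc_inv_sq_le_sub (α := ℝ) (k := K) (n := R) (by omega) hRK
  rw [← mul_sum] at e2
  have e4 : (0 : ℝ) ≤ (R : ℝ)⁻¹ := by positivity
  have e5 : 2 * G * ∑ k ∈ Ioc K R, ((k : ℝ) ^ 2)⁻¹ ≤ 2 * G * (K : ℝ)⁻¹ :=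
    mul_le_mul_of_nonneg_left (by linarith) (by linarith)
  have e6 : 3 * G / K ≤ 3 * G / κ := div_le_div_of_nonneg_left (by linarith) hκ hκK
  have e7 : G / K + 2 * G * (K : ℝ)⁻¹ = 3 * G / K := by
    rw [div_eq_mul_inv, div_eq_mul_inv]
    ring
  linarith

theorem sum_card_inter_linePts_high_le (E : Finset (Pt p)) :
    ∑ l ∈ (lineKeys p).filter fun l => 8 * E.card < (E ∩ linePts l).card ^ 2,
      ((E ∩ linePts l).card : ℝ) ≤ 2 * E.card + 2 * E.card * (1 + Real.log E.card) := by
  set M := (lineKeys p).filter fun l => 8 * E.card < (E ∩ linePts l).card ^ 2 with hM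
  obtain ⟨a, ha⟩ : ∃ a, a = Nat.sqrt (8 * E.card) + 1 := ⟨_, rfl⟩
  have haN : 2 * E.card < a ^ 2 := by
    have := Nat.lt_succ_sqrt' (8 * E.card)
    rw [Nat.succ_eq_add_one, ← ha] at this
    omega
  have h1 := sum_le_add_sum_card_level M (fun l => (E ∩ linePts l).card) a E.card
    fun l _ => card_le_card inter_subset_left
  have h2 : M.card * a ≤ 2 * E.card := by
    refine le_trans (Nat.mul_le_mul_right _ (card_le_card fun l hl => ?_))
      (card_richLines_mul_le E a haN)
    obtain ⟨h3, h4⟩ := mem_filter.1 hl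
    refine mem_filter.2 ⟨h3, ?_⟩
    rw [ha]
    exact Nat.sqrt_lt'.2 h4
  have h3 : ∀ k ∈ Ioc a E.card, ((M.filter fun l => k ≤ (E ∩ linePts l).card).card : ℝ) ≤
      2 * E.card * (k : ℝ)⁻¹ := by
    intro k hk
    rw [mem_Ioc] at hk
    have h4 : (M.filter fun l => k ≤ (E ∩ linePts l).card).card * k ≤ 2 * E.card := by
      refine le_trans (Nat.mul_le_mul_right _ (card_le_card fun l hl => ?_))
        (card_richLines_mul_le E k (haN.trans_le (Nat.pow_le_pow_left hk.1.le 2)))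
      obtain ⟨h3, h4⟩ := mem_filter.1 hl
      exact mem_filter.2 ⟨(mem_filter.1 h3).1, h4⟩
    have hk0 : (0 : ℝ) < k := by
      have : 0 < k := by omega
      exact_mod_cast this
    rw [← div_eq_mul_inv, le_div_iff₀ hk0]
    exact_mod_cast h4
  have h5 : ∑ k ∈ Ioc a E.card, (k : ℝ)⁻¹ ≤ 1 + Real.log E.card := by
    refine le_trans ?_ (harmonic_le_one_add_log E.card)
    rw [harmonic_eq_sum_Icc]
    push_cast
    refine sum_le_sum_of_subset_of_nonneg (fun k hk => ?_) fun k _ _ => by positivity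
    rw [mem_Ioc] at hk
    rw [mem_Icc]
    omega
  have h6 : ∑ l ∈ M, ((E ∩ linePts l).card : ℝ) ≤ ((M.card * a : ℕ) : ℝ) +
      ∑ k ∈ Ioc a E.card, ((M.filter fun l => k ≤ (E ∩ linePts l).card).card : ℝ) := by
    exact_mod_cast h1
  have h7 : ((M.card * a : ℕ) : ℝ) ≤ 2 * E.card := by exact_mod_cast h2
  have h8 := sum_le_sum h3
  rw [← mul_sum] at h8
  have h9 := mul_le_mul_of_nonneg_left h5 (show (0 : ℝ) ≤ 2 * E.card by positivity)
  linarith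

theorem triCount_le_of_scale (hp : p % 4 = 3) (E : Finset (Pt p)) (hE : 2 ≤ E.card)
    (hEp : 2 ^ 31 * E.card ^ 4 ≤ p ^ 7) (κ β : ℝ) (hκ : 0 < κ)
    (hβ : β = (distSet E).card * ((E.card : ℝ) ^ 2 + rectCount p E))
    (hκβ : κ ^ 15 * (E.card : ℝ) ^ 5 = β ^ 4) :
    (triCount E : ℝ) ≤
      4000 * ((E.card : ℝ) ^ 2 * Real.log E.card + κ * (E.card : ℝ) ^ 2) := by
  obtain ⟨K, hK⟩ : ∃ K, K = ⌈κ⌉₊ := ⟨_, rfl⟩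
  have hκK : κ ≤ K := by rw [hK]; exact Nat.le_ceil κ
  have hb2 : ∑ l ∈ lineKeys p, ((bisectedPairs E l).card : ℝ) ^ 2 ≤ 2 * β := by
    have := sum_sq_card_bisectedPairs_le hp E
    rw [hβ]
    exact_mod_cast this
  have hb1 : ∑ l ∈ lineKeys p, ((bisectedPairs E l).card : ℝ) =
      (E.card : ℝ) ^ 2 - (E.card : ℝ) := by
    have := sum_card_bisectedPairs E
    have h1 : E.card ≤ E.card * E.card := Nat.le_mul_self _
    rw [← Nat.cast_sum, this, Nat.cast_sub h1]
    push_cast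
    ring
  have hN : (2 : ℝ) ≤ E.card := by exact_mod_cast hE
  have hΔ : (1 : ℝ) ≤ (distSet E).card := by
    have : 0 < (distSet E).card := by
      refine card_pos.2 (Nonempty.image ?_ _)
      have : E.Nonempty := card_pos.1 (by omega)
      exact this.product this
    exact_mod_cast this
  have hβN : (E.card : ℝ) ^ 2 ≤ β := by
    have hr : (0 : ℝ) ≤ rectCount p E := Nat.cast_nonneg _
    rw [hβ]
    generalize ((distSet E).card : ℝ) = x at *
    generalize (E.card : ℝ) = N at *
    nlinarith [sq_nonneg N]
  have hβp : (E.card : ℝ) ^ 4 ≤ 16 * (p : ℝ) ^ 2 * β := by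
    have h1 := sq_sum_le_card_mul_sum_sq (s := lineKeys p)
      (f := fun l => ((bisectedPairs E l).card : ℝ))
    rw [hb1] at h1
    have h2 : ((lineKeys p).card : ℝ) ≤ 2 * (p : ℝ) ^ 2 := by exact_mod_cast card_lineKeys_le
    have h3 : ((E.card : ℝ) ^ 2 - E.card) ^ 2 ≤ 2 * (p : ℝ) ^ 2 * (2 * β) :=
      h1.trans (mul_le_mul h2 hb2 (sum_nonneg fun _ _ => sq_nonneg _) (by positivity))
    generalize (E.card : ℝ) = N at *
    have h4 : N ^ 2 / 2 ≤ N ^ 2 - N := by nlinarith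
    have h5 := pow_le_pow_left₀ (by positivity) h4 2
    nlinarith
  have hbN : ∀ l, ((bisectedPairs E l).card : ℝ) ≤ E.card := fun l => by
    exact_mod_cast card_bisectedPairs_le hp E l
  have hEp' : 2 ^ 31 * (E.card : ℝ) ^ 4 ≤ (p : ℝ) ^ 7 := by exact_mod_cast hEp
  have hp0 : (0 : ℝ) < p := by exact_mod_cast (Fact.out : p.Prime).pos
  have hlow : ∑ l ∈ (lineKeys p).filter (fun l => (E ∩ linePts l).card < K),
      ((bisectedPairs E l).card : ℝ) * ((E ∩ linePts l).card : ℝ) ≤ κ * (E.card : ℝ) ^ 2 := by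
    have h1 : ∀ l ∈ (lineKeys p).filter (fun l => (E ∩ linePts l).card < K),
        ((bisectedPairs E l).card : ℝ) * ((E ∩ linePts l).card : ℝ) ≤
          κ * ((bisectedPairs E l).card : ℝ) := by
      intro l hl
      have := (mem_filter.1 hl).2
      rw [hK, Nat.lt_ceil] at this
      rw [mul_comm]
      exact mul_le_mul_of_nonneg_right this.le (Nat.cast_nonneg _)
    refine (sum_le_sum h1).trans ?_
    rw [← mul_sum]
    refine mul_le_mul_of_nonneg_left ?_ hκ.le
    refine (sum_le_sum_of_subset_of_nonneg (filter_subset _ _)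
      fun _ _ _ => Nat.cast_nonneg _).trans ?_
    rw [hb1]
    linarith
  have hhigh : ∑ l ∈ (lineKeys p).filter (fun l => 8 * E.card < (E ∩ linePts l).card ^ 2),
      ((bisectedPairs E l).card : ℝ) * ((E ∩ linePts l).card : ℝ) ≤
        E.card * (2 * E.card + 2 * E.card * (1 + Real.log E.card)) := by
    refine le_trans (sum_le_sum fun l _ =>
      mul_le_mul_of_nonneg_right (hbN l) (Nat.cast_nonneg _)) ?_
    rw [← mul_sum]
    exact mul_le_mul_of_nonneg_left (sum_card_inter_linePts_high_le E) (Nat.cast_nonneg _)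
  have hmid : ∑ l ∈ (lineKeys p).filter (fun l => K ≤ (E ∩ linePts l).card ∧
      (E ∩ linePts l).card ^ 2 ≤ 8 * E.card),
      ((bisectedPairs E l).card : ℝ) * ((E ∩ linePts l).card : ℝ) ≤
        3000 * (κ * (E.card : ℝ) ^ 2) := by
    have hβ0 : 0 < β := by nlinarith
    have hκ1 : 1 < κ := by
      by_contra! hle
      have h1 : κ ^ 15 ≤ 1 := pow_le_one₀ hκ.le hle
      have h2 : ((E.card : ℝ) ^ 2) ^ 4 ≤ β ^ 4 := pow_le_pow_left₀ (by positivity) hβN 4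
      rw [← hκβ] at h2
      generalize (E.card : ℝ) = N at *
      have h3 : (N ^ 2) ^ 4 = N ^ 3 * N ^ 5 := by ring
      have h4 : 2 ^ 3 ≤ N ^ 3 := pow_le_pow_left₀ (by norm_num) hN 3
      have h5 : 0 < N ^ 5 := by positivity
      nlinarith
    have hK2 : 2 ≤ K := by
      have : (1 : ℝ) < K := hκ1.trans_le hκK
      exact_mod_cast this
    have hκp : 2 * (E.card : ℝ) ≤ κ * p := by
      generalize (E.card : ℝ) = N at *
      generalize (p : ℝ) = P at *
      have hN0 : 0 < N := by linarith
      refine le_of_pow_le_pow_left₀ (n := 15) (by norm_num) (by positivity) ?_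
      refine le_of_mul_le_mul_right ?_ (show 0 < 2 ^ 16 * N ^ 5 by positivity)
      calc (2 * N) ^ 15 * (2 ^ 16 * N ^ 5) = (2 ^ 31 * N ^ 4) * N ^ 16 := by ring
        _ ≤ P ^ 7 * N ^ 16 := by gcongr
        _ = P ^ 7 * (N ^ 4) ^ 4 := by ring
        _ ≤ P ^ 7 * (16 * P ^ 2 * β) ^ 4 := by gcongr
        _ = 2 ^ 16 * P ^ 15 * β ^ 4 := by ring
        _ = (κ * P) ^ 15 * (2 ^ 16 * N ^ 5) := by rw [← hκβ]; ring
    have hKp : 2 * E.card ≤ K * p := by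
      have : 2 * (E.card : ℝ) ≤ K * p := hκp.trans (mul_le_mul_of_nonneg_right hκK hp0.le)
      exact_mod_cast this
    have h1 := sum_sq_card_inter_linePts_le hp E K hK2 hKp κ (10 ^ 6 * κ ^ 3 * E.card ^ 4 / β) hκ
      hκK (by positivity) (by
        generalize (E.card : ℝ) = N at *
        have e : (10 ^ 6 * κ ^ 3 * N ^ 4 / β) ^ 4 * κ ^ 3 =
            10 ^ 24 * N ^ 11 * ((κ ^ 15 * N ^ 5) / β ^ 4) := by
          field_simp
        have hN0 : 0 < N ^ 11 := pow_pos (by linarith) 11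
        rw [e, hκβ, div_self (by positivity)]
        linarith)
    refine le_of_pow_le_pow_left₀ (n := 2) two_ne_zero (by positivity) ?_
    refine (sum_mul_sq_le_sq_mul_sq _ _ _).trans ?_
    have h2 : ∑ l ∈ (lineKeys p).filter (fun l => K ≤ (E ∩ linePts l).card ∧
      (E ∩ linePts l).card ^ 2 ≤ 8 * E.card), ((bisectedPairs E l).card : ℝ) ^ 2 ≤ 2 * β :=
      (sum_le_sum_of_subset_of_nonneg (filter_subset _ _) fun _ _ _ => sq_nonneg _).trans hb2
    refine (mul_le_mul h2 h1 (sum_nonneg fun _ _ => sq_nonneg _) (by positivity)).trans ?_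
    generalize (E.card : ℝ) = N at *
    have e : 2 * β * (3 * (10 ^ 6 * κ ^ 3 * N ^ 4 / β) / κ) = 6 * 10 ^ 6 * (κ * N ^ 2) ^ 2 := by
      field_simp
      norm_num
    rw [e, mul_pow 3000]
    exact mul_le_mul_of_nonneg_right (by norm_num) (sq_nonneg _)
  have hT : (triCount E : ℝ) ≤ (E.card : ℝ) ^ 2 +
      ∑ l ∈ lineKeys p, ((bisectedPairs E l).card : ℝ) * ((E ∩ linePts l).card : ℝ) := by
    exact_mod_cast triCount_le hp E
  have hsplit : ∑ l ∈ lineKeys p, ((bisectedPairs E l).card : ℝ) * ((E ∩ linePts l).card : ℝ) ≤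
      ∑ l ∈ (lineKeys p).filter (fun l => (E ∩ linePts l).card < K),
        ((bisectedPairs E l).card : ℝ) * ((E ∩ linePts l).card : ℝ) +
      (∑ l ∈ (lineKeys p).filter (fun l => K ≤ (E ∩ linePts l).card ∧
        (E ∩ linePts l).card ^ 2 ≤ 8 * E.card),
        ((bisectedPairs E l).card : ℝ) * ((E ∩ linePts l).card : ℝ) +
      ∑ l ∈ (lineKeys p).filter (fun l => 8 * E.card < (E ∩ linePts l).card ^ 2),
        ((bisectedPairs E l).card : ℝ) * ((E ∩ linePts l).card : ℝ)) := by
    simp only [sum_filter, ← sum_add_distrib]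
    refine sum_le_sum fun l _ => ?_
    have h0 : (0 : ℝ) ≤ ((bisectedPairs E l).card : ℝ) * ((E ∩ linePts l).card : ℝ) := by
      positivity
    split_ifs <;> first | linarith | omega
  have hlog : 1 / 2 ≤ Real.log E.card := by
    have h1 := Real.log_le_log (by norm_num) hN
    have h2 := Real.log_two_gt_d9
    linarith
  have hκN : 0 ≤ κ * (E.card : ℝ) ^ 2 := by positivity
  have hfin := mul_le_mul_of_nonneg_left hlog (sq_nonneg (E.card : ℝ))
  have hsq := sq_nonneg (E.card : ℝ)
  linarith

end Isosceles

theorem triCount_eq_zero_of_card_le_one {p : ℕ} {E : Finset (Pt p)} (hE : E.card ≤ 1) :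
    triCount E = 0 := by
  rw [triCount, card_eq_zero, filter_eq_empty_iff]
  rintro ⟨a, b, c⟩ h ⟨-, h2⟩
  simp only [mem_product] at h
  refine h2 ?_
  rw [card_le_one.1 hE a h.1 c h.2.2]
  simp [dist2]

/-- There exist absolute constants `C, c > 0` such that for every prime `p ≡ 3 (mod 4)` and
every `E ⊆ 𝔽_p²` with `|E| ≤ c·p^{8/5}`, one has
`T(E) ≤ C·(|E|²·log|E| + |Δ(E)|^{4/15}·|E|^{33/15} + |E|^{5/3}·|Δ(E)|^{4/15}·□(E)^{4/15})`. -/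
theorem distance_rectangle_main :
    ∃ C c : ℝ, 0 < C ∧ 0 < c ∧
      ∀ (p : ℕ) [Fact p.Prime], p % 4 = 3 →
        ∀ E : Finset (Pt p), (E.card : ℝ) ≤ c * (p : ℝ) ^ ((8 : ℝ) / 5) →
          (triCount E : ℝ) ≤
            C * ((E.card : ℝ) ^ 2 * Real.log (E.card : ℝ)
              + ((distSet E).card : ℝ) ^ ((4 : ℝ) / 15) * (E.card : ℝ) ^ ((33 : ℝ) / 15)
              + (E.card : ℝ) ^ ((5 : ℝ) / 3) * ((distSet E).card : ℝ) ^ ((4 : ℝ) / 15)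
                  * (rectCount p E : ℝ) ^ ((4 : ℝ) / 15)) := by
  refine ⟨4000, 1 / 256, by norm_num, by norm_num, fun p _ hp E hE => ?_⟩
  have hlog0 : 0 ≤ Real.log (E.card : ℝ) := Real.log_natCast_nonneg _
  rcases le_or_gt E.card 1 with h1 | h1
  · rw [triCount_eq_zero_of_card_le_one h1, Nat.cast_zero]
    have := mul_nonneg (sq_nonneg (E.card : ℝ)) hlog0
    positivity
  have hN : (2 : ℝ) ≤ E.card := by exact_mod_cast h1
  have hN0 : (0 : ℝ) < E.card := by linarith
  have hΔ : (1 : ℝ) ≤ (distSet E).card := by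
    have : 0 < (distSet E).card := by
      refine card_pos.2 (Nonempty.image ?_ _)
      have : E.Nonempty := card_pos.1 (by omega)
      exact this.product this
    exact_mod_cast this
  have hr : (0 : ℝ) ≤ rectCount p E := Nat.cast_nonneg _
  have hp1 : (1 : ℝ) ≤ p := by exact_mod_cast (Fact.out : p.Prime).one_le
  have hEp : 2 ^ 31 * E.card ^ 4 ≤ p ^ 7 := by
    have hP : ((p : ℝ) ^ ((8 : ℝ) / 5)) ^ 4 ≤ (p : ℝ) ^ 7 := by
      rw [← Real.rpow_natCast, ← Real.rpow_natCast, ← Real.rpow_mul (by linarith)]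
      exact Real.rpow_le_rpow_of_exponent_le hp1 (by norm_num)
    have h2 := pow_le_pow_left₀ hN0.le hE 4
    rw [mul_pow] at h2
    have h3 : 2 ^ 31 * (E.card : ℝ) ^ 4 ≤ (p : ℝ) ^ 7 := by
      have h4 : (0 : ℝ) ≤ (p : ℝ) ^ 7 := by positivity
      generalize (E.card : ℝ) ^ 4 = x at *
      generalize (p : ℝ) ^ 7 = y at *
      generalize ((p : ℝ) ^ ((8 : ℝ) / 5)) ^ 4 = z at *
      norm_num at h2 ⊢
      linarith
    exact_mod_cast h3
  obtain ⟨β, hβ⟩ : ∃ β : ℝ, β = (distSet E).card * ((E.card : ℝ) ^ 2 + rectCount p E) := ⟨_, rfl⟩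
  have hmain := fun κ hκ h => triCount_le_of_scale hp E h1 hEp κ β hκ hβ h
  generalize (rectCount p E : ℝ) = r at *
  generalize ((distSet E).card : ℝ) = D at *
  generalize (E.card : ℝ) = N at *
  have hD0 : 0 < D := by linarith
  have hβ0 : 0 < β := by rw [hβ]; positivity
  refine (hmain (N ^ (-(1 : ℝ) / 3) * β ^ ((4 : ℝ) / 15)) (by positivity) ?_).trans
    (mul_le_mul_of_nonneg_left ?_ (by norm_num))
  · rw [mul_pow, ← Real.rpow_natCast, ← Real.rpow_natCast, ← Real.rpow_natCast,
      ← Real.rpow_natCast, ← Real.rpow_mul hN0.le, ← Real.rpow_mul hβ0.le, mul_right_comm,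
      ← Real.rpow_add hN0]
    norm_num
  · have e1 : N ^ (-(1 : ℝ) / 3) * β ^ ((4 : ℝ) / 15) * N ^ 2 =
        N ^ ((5 : ℝ) / 3) * β ^ ((4 : ℝ) / 15) := by
      rw [mul_right_comm, ← Real.rpow_natCast, ← Real.rpow_add hN0]
      norm_num
    have e2 : β ^ ((4 : ℝ) / 15) ≤ D ^ ((4 : ℝ) / 15) *
        (N ^ ((8 : ℝ) / 15) + r ^ ((4 : ℝ) / 15)) := by
      rw [hβ, Real.mul_rpow hD0.le (by positivity)]
      refine mul_le_mul_of_nonneg_left ?_ (by positivity)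
      have := Real.rpow_add_le_add_rpow (p := (4 : ℝ) / 15) (sq_nonneg N) hr (by norm_num)
        (by norm_num)
      have e0 : (N ^ 2) ^ ((4 : ℝ) / 15) = N ^ ((8 : ℝ) / 15) := by
        rw [← Real.rpow_natCast, ← Real.rpow_mul hN0.le]
        norm_num
      rwa [e0] at this
    have e3 : N ^ ((33 : ℝ) / 15) = N ^ ((5 : ℝ) / 3) * N ^ ((8 : ℝ) / 15) := by
      rw [← Real.rpow_add hN0]
      norm_num
    rw [e1, e3]
    have := mul_le_mul_of_nonneg_left e2 (show 0 ≤ N ^ ((5 : ℝ) / 3) by positivity)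
    linarith

end FpDist
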